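/- **Setting.** Let $G$ be a finite simple connected graph with exactly three leaves (vertices of degree one). For $S\subseteq V(G)$ let $G[S]$ be the induced subgraph. A *sapling* of $G$ is an induced subgraph of $G$ that is a tree containing all three leaves of $G$. For vertex sets $U,W$, an induced $UW$-path is a single vertex of $U\cap W$ or an induced path of $G$ with one end-vertex in $U$ and the other in $W$; a *$UW$-rung* is an induced $UW$-path whose vertex set is inclusion-minimal. **Sprouts.** For vertex sets $S,V_1,V_2$, an *$(S,V_1,V_2)$-sprout* is an induced subgraph of $G$ that is (S1) a tree meeting each of $S,V_1,V_2$ in exactly one vertex; or (S2) the disjoint union, with no edge of $G$ in between, of an $SV_1$-rung avoiding $V_2$ and an $SV_2$-rung avoiding $V_1$; or (S3) the disjoint union, with no edge of $G$ in between, of a $V_1V_2$-rung avoiding $S$ and an $S(V_1\cup V_2)$-rung. **Nets.** Let $X\subseteq V(G)$. For a multigraph $\mathbb H$ let $\nabla(\mathbb H)$ be obtained from it by adding an edge between each pair of its leaf nodes. An *$X$-net* of $G$ is a loopless multigraph $\mathbb H$ (parallel arcs allowed) whose vertices ("nodes") and edges ("arcs") are subsets of $X$ such that: (N1) $\mathbb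 H$ is connected and $\nabla(\mathbb H)$ is biconnected; (N2) the arcs are nonempty and partition $X$; (N3) $\mathbb H$ has exactly three leaf nodes, each of the form $\{v\}$ with $v$ a leaf of $G$; (N4) for each arc $E$ with end-nodes $U,W$, every vertex of $E$ lies on a $UW$-rung of $G[E]$; (N5) an arc $E$ and a node $N$ intersect if and only if $N$ is an end-node of $E$; (N6) for $u\in E$, $v\in F$ with $E\neq F$ arcs, $uv$ is an edge of $G$ if and only if $E$ and $F$ have a common end-node containing both $u$ and $v$. **Chunks and self-aiding nets.** A *split component* for $\mathbb H$ with split pair $\{U,W\}$ is either an arc with end-nodes $U,W$, or, if $\{U,W\}$ is a cutset of $\nabla(\mathbb H)$ (i.e. $\nabla(\mathbb H)-\{U,W\}$ is disconnected), a maximal subgraph of $\nabla(\mathbb H)$ containing $U$ and $W$ in which $U,W$ are nonadjacent and do not form a cutset, provided it contains none of the added edges. A *$UW$-chunk* is the union of the arcs of one or more split components with split pair $\{U,W\}$; a chunk is *maximal* if it is not properly contained in another chunk. The *aiding net* of $\mathbb H$ is obtained by merging every maximal chunk $C$: for a maximal $UW$-chunk $C$, all arcs meeting $C$ are replaced by a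 single arc $C$ with end-nodes $U,W$, and nodes left without incident arcs are deleted. $\mathbb H$ is *self-aiding* if it equals its aiding net. **Wild sets.** A set $S\subseteq X$ is *tamed* if every two vertices of $S$ lie in a common arc or in a common node of $\mathbb H$. A set $Y\subseteq V(G)\setminus X$ is tamed if $N(Y)\cap X$ is tamed. $Y\subseteq V(G)\setminus X$ is *$\mathbb H$-wild* if $G[Y]$ is a path, $Y$ is not tamed, and every proper subset $Z\subsetneq Y$ such that $G[Z]$ is a path is tamed. **Sticky sets.** A set $S\subseteq X$ is *solid* if it is a node of $\mathbb H$, or a subset of an arc $E$ with end-nodes $U,W$ such that $G[E]$ contains no $(S,U,W)$-sprout. For $Y\subseteq V(G)\setminus X$ with $G[Y]$ a path: $Y$ is *$\mathbb H$-solid* if $N(Y)\cap X$ is the union of two solid sets and no internal vertex of the path $G[Y]$ has a neighbor in $X$; $Y$ is *$\mathbb H$-podded* if for some nodes $V_1,V_2$ there is a $V_1V_2$-chunk $C$ of $\mathbb H$ with (P1) $N(Y)\cap X\subseteq V_1\cup C\cup V_2$ and (P2) for each $i\in\{1,2\}$ and each end-vertex $y$ of the path $G[Y]$, $N(y)\cap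 V_i\subseteq C$ or $V_i\subseteq C\cup N(y)$. $Y$ is *$\mathbb H$-nonsticky* if it is neither $\mathbb H$-solid nor $\mathbb H$-podded. **Statement.** Let $\mathbb H_0$ be a self-aiding $X$-net of $G$ and let $Y$ be an $\mathbb H_0$-wild, $\mathbb H_0$-nonsticky set. Then $G[X\cup Y]$ contains a sapling of $G$. -/

import Mathlib

namespace ThreeInATree

/-! ### Leaves, saplings, rungs and sprouts of the graph `G` -/

/-- A leaf of a simple graph: a vertex with exactly one neighbor. -/
def IsLeaf {V : Type*} (G : SimpleGraph V) (v : V) : Prop := ∃! w, G.Adj v w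

/-- `T` is the vertex set of a sapling of `G`: `G[T]` is a tree and `T` contains every leaf
of `G`. -/
def IsSapling {V : Type*} (G : SimpleGraph V) (T : Set V) : Prop :=
  (G.induce T).IsTree ∧ ∀ v, IsLeaf G v → v ∈ T

/-- `G[P]` is a (nonempty) path. -/
def IsPathSet {V : Type*} (G : SimpleGraph V) (P : Set V) : Prop :=
  ∃ (n : ℕ) (f : SimpleGraph.pathGraph (n + 1) ↪g G), Set.range f = P

/-- `v` is an end-vertex of the path `G[P]`: it has at most one neighbor in `P`.
(The only vertex of a one-vertex path is an end-vertex.) -/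
def IsEndOf {V : Type*} (G : SimpleGraph V) (P : Set V) (v : V) : Prop :=
  v ∈ P ∧ {w ∈ P | G.Adj v w}.Subsingleton

/-- `G[P]` is an induced `UW`-path: a path with one end-vertex in `U` and the other in `W`
(for `n = 0`, a single vertex of `U ∩ W`). -/
def IsInducedUWPath {V : Type*} (G : SimpleGraph V) (U W P : Set V) : Prop :=
  ∃ (n : ℕ) (f : SimpleGraph.pathGraph (n + 1) ↪g G),
    Set.range f = P ∧ f 0 ∈ U ∧ f (Fin.last n) ∈ W

/-- `G[P]` is a `UW`-rung: an induced `UW`-path that is minimal with respect to inclusion of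
vertex sets. For `P ⊆ A`, being a rung of `G` and being a rung of `G[A]` are the same. -/
def IsRung {V : Type*} (G : SimpleGraph V) (U W P : Set V) : Prop :=
  Minimal (IsInducedUWPath G U W) P

/-- `P` and `Q` are disjoint and no edge of `G` joins them, so that `G[P ∪ Q]` is the disjoint
union of `G[P]` and `G[Q]`. -/
def Separated {V : Type*} (G : SimpleGraph V) (P Q : Set V) : Prop :=
  Disjoint P Q ∧ ∀ p ∈ P, ∀ q ∈ Q, ¬ G.Adj p q

/-- The induced subgraph `G[T]` is an `(S, V₁, V₂)`-sprout, of Type S1, S2 or S3. -/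
def IsSprout {V : Type*} (G : SimpleGraph V) (S V₁ V₂ T : Set V) : Prop :=
  ((G.induce T).IsTree ∧ (∃ s, T ∩ S = {s}) ∧ (∃ v, T ∩ V₁ = {v}) ∧ (∃ v, T ∩ V₂ = {v})) ∨
  (∃ P Q, T = P ∪ Q ∧ Separated G P Q ∧
    IsRung G S V₁ P ∧ Disjoint P V₂ ∧ IsRung G S V₂ Q ∧ Disjoint Q V₁) ∨
  (∃ P Q, T = P ∪ Q ∧ Separated G P Q ∧
    IsRung G V₁ V₂ P ∧ Disjoint P S ∧ IsRung G S (V₁ ∪ V₂) Q)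

/-! ### Multigraphs: leaf nodes, `∇`, connectivity, cut pairs -/

/-- A leaf node of a multigraph: a node incident to exactly one arc. -/
def IsLeafNode {α β : Type*} (H : Graph α β) (x : α) : Prop := ∃! e, H.Inc e x

/-- `∇(H)`: add to `H` an edge between each pair of its leaf nodes. The original arcs are
`Sum.inl e`, the added edges are `Sum.inr s(x, y)`. -/
def nabla {α β : Type*} (H : Graph α β) : Graph α (β ⊕ Sym2 α) where
  vertexSet := H.vertexSet
  IsLink e x y := (∃ e₀, e = Sum.inl e₀ ∧ H.IsLink e₀ x y) ∨
    (e = Sum.inr s(x, y) ∧ x ≠ y ∧ IsLeafNode H x ∧ IsLeafNode H y)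
  isLink_symm := by
    rintro e -
    refine ⟨fun x y h => ?_⟩
    rcases h with ⟨e₀, rfl, h⟩ | ⟨rfl, h1, h2, h3⟩
    · exact Or.inl ⟨e₀, rfl, h.symm⟩
    · exact Or.inr ⟨by rw [Sym2.eq_swap], h1.symm, h3, h2⟩
  eq_or_eq_of_isLink_of_isLink := by
    rintro e x y v w (⟨e₀, rfl, h⟩ | ⟨rfl, -, -, -⟩) (⟨e₁, h', k⟩ | ⟨h', -, -, -⟩)
    · cases h'
      exact h.left_eq_or_eq k
    · cases h'
    · cases h'
    · have h2 : s(x, y) = s(v, w) := Sum.inr.inj h'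
      rcases Sym2.eq_iff.mp h2 with ⟨h, -⟩ | ⟨h, -⟩
      · exact Or.inl h
      · exact Or.inr h
  left_mem_of_isLink := by
    rintro e x y (⟨e₀, rfl, h⟩ | ⟨rfl, -, ⟨e, ⟨z, h⟩, -⟩, -⟩)
    · exact h.left_mem
    · exact h.left_mem

/-- A connected multigraph that stays connected after the deletion of any node. -/
def IsBiconnected {α β : Type*} (H : Graph α β) : Prop :=
  H.toSimpleGraph.Connected ∧ ∀ x ∈ H.vertexSet, (H.deleteVerts {x}).toSimpleGraph.Connected

/-- `{x, y}` is a cutset of `H`: deleting the nodes `x` and `y` leaves a disconnected graph. -/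
def IsCutPair {α β : Type*} (H : Graph α β) (x y : α) : Prop :=
  x ∈ H.vertexSet ∧ y ∈ H.vertexSet ∧ x ≠ y ∧
    ¬ (H.deleteVerts {x, y}).toSimpleGraph.Preconnected

/-! ### Nets -/

/-- Conditions N1-N6: the loopless multigraph `H`, whose nodes and arcs are subsets of `X`, is
an `X`-net of `G`. -/
structure IsNet {V : Type*} (G : SimpleGraph V) (X : Set V) (H : Graph (Set V) (Set V)) :
    Prop where
  loopless : ∀ E U W, H.IsLink E U W → U ≠ W
  node_subset : ∀ N ∈ H.vertexSet, N ⊆ X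
  connected : H.toSimpleGraph.Connected
  biconnected : IsBiconnected (nabla H)
  arc_nonempty : ∀ E ∈ H.edgeSet, E.Nonempty
  arc_disjoint : H.edgeSet.PairwiseDisjoint id
  arc_cover : ⋃₀ H.edgeSet = X
  leaf_card : {N | IsLeafNode H N}.ncard = 3
  leaf_single : ∀ N, IsLeafNode H N → ∃ v, IsLeaf G v ∧ N = {v}
  exists_rung : ∀ E U W, H.IsLink E U W → ∀ x ∈ E, ∃ P ⊆ E, x ∈ P ∧ IsRung G U W P
  meets_iff : ∀ E ∈ H.edgeSet, ∀ N ∈ H.vertexSet, (E ∩ N).Nonempty ↔ H.Inc E N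
  adj_iff : ∀ E ∈ H.edgeSet, ∀ F ∈ H.edgeSet, E ≠ F → ∀ u ∈ E, ∀ v ∈ F,
    (G.Adj u v ↔ ∃ N, H.Inc E N ∧ H.Inc F N ∧ u ∈ N ∧ v ∈ N)

/-! ### Split components, chunks, the aiding net -/

/-- `K` is a subgraph of `Γ` containing `x` and `y` in which `x` and `y` are nonadjacent and
do not form a cutset. -/
def IsUnsplitSubgraph {α γ : Type*} (Γ : Graph α γ) (x y : α) (K : Graph α γ) : Prop :=
  K ≤ Γ ∧ x ∈ K.vertexSet ∧ y ∈ K.vertexSet ∧ ¬ K.Adj x y ∧ ¬ IsCutPair K x y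

/-- `A` is the set of arcs of a split component for `H` with split pair `{U, W}`: either a single
arc with end-nodes `U` and `W`, or, when `{U, W}` is a cutset of `∇(H)`, the arcs of a maximal
subgraph of `∇(H)` containing `U` and `W` in which `U` and `W` are nonadjacent and do not form a
cutset, provided that this subgraph is a subgraph of `H` (it uses no added edge). -/
def IsSplitComponentArcs {α β : Type*} (H : Graph α β) (U W : α) (A : Set β) : Prop :=
  (∃ E, H.IsLink E U W ∧ A = {E}) ∨
  (IsCutPair (nabla H) U W ∧
    ∃ K : Graph α (β ⊕ Sym2 α), Maximal (IsUnsplitSubgraph (nabla H) U W) K ∧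
      (∀ s, Sum.inr s ∉ K.edgeSet) ∧ A = {E | Sum.inl E ∈ K.edgeSet})

/-- `C` is a `UW`-chunk of `H`: the union of the arcs of one or more split components for `H`
with split pair `{U, W}`. -/
def IsChunk {V : Type*} (H : Graph (Set V) (Set V)) (U W C : Set V) : Prop :=
  ∃ 𝒜 : Set (Set (Set V)), 𝒜.Nonempty ∧ (∀ A ∈ 𝒜, IsSplitComponentArcs H U W A) ∧
    C = ⋃₀ ⋃₀ 𝒜

/-- A chunk that is not properly contained in any other chunk. -/
def IsMaxChunk {V : Type*} (H : Graph (Set V) (Set V)) (C : Set V) : Prop :=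
  Maximal (fun C => ∃ U W, IsChunk H U W C) C

/-- `H'` is obtained from `H` by applying `merge(C)` for every `C` in a family `𝒞` of (pairwise
disjoint) chunks: all arcs meeting some `C ∈ 𝒞` are deleted, each `UW`-chunk `C ∈ 𝒞` becomes an
arc `C` with end-nodes `U` and `W`, and the nodes that are left without an incident arc are
deleted. -/
structure IsMerge {V : Type*} (H : Graph (Set V) (Set V)) (𝒞 : Set (Set V))
    (H' : Graph (Set V) (Set V)) : Prop where
  isLink_iff : ∀ E U W, H'.IsLink E U W ↔
    (E ∈ 𝒞 ∧ IsChunk H U W E) ∨ (H.IsLink E U W ∧ ∀ C ∈ 𝒞, Disjoint E C)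
  mem_nodes_iff : ∀ N, N ∈ H'.vertexSet ↔ N ∈ H.vertexSet ∧ ∃ E, H'.Inc E N

/-- `H'` aids `H` (`H' = H†`): it is obtained from `H` by merging every maximal chunk of `H`. -/
def Aids {V : Type*} (H' H : Graph (Set V) (Set V)) : Prop :=
  IsMerge H {C | IsMaxChunk H C} H'

/-- `H` aids itself. -/
def SelfAiding {V : Type*} (H : Graph (Set V) (Set V)) : Prop := Aids H H

/-! ### Tamed, wild, solid, podded and sticky sets -/

/-- `N(Y) ∩ X`, for `Y` disjoint from `X`. -/
def nbrIn {V : Type*} (G : SimpleGraph V) (X Y : Set V) : Set V :=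
  {x ∈ X | ∃ y ∈ Y, G.Adj y x}

/-- A set `S ⊆ X` is `H`-tamed if every two of its vertices lie in a common arc or in a common
node of `H`. -/
def Tamed {V : Type*} (H : Graph (Set V) (Set V)) (S : Set V) : Prop :=
  ∀ u ∈ S, ∀ v ∈ S,
    (∃ E ∈ H.edgeSet, u ∈ E ∧ v ∈ E) ∨ (∃ N ∈ H.vertexSet, u ∈ N ∧ v ∈ N)

/-- `Y` is an `H`-wild set: among the sets `Y ⊆ V(G) ∖ X` such that `G[Y]` is a path, `Y` is a
minimal `H`-untamed one. -/
def Wild {V : Type*} (G : SimpleGraph V) (X : Set V) (H : Graph (Set V) (Set V)) (Y : Set V) :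
    Prop :=
  Minimal (fun Y => Disjoint Y X ∧ IsPathSet G Y ∧ ¬ Tamed H (nbrIn G X Y)) Y

/-- An `H`-solid set `S ⊆ X`: a node of `H`, or a subset of an arc `E = UW` of `H` such that
`G[E]` contains no `(S, U, W)`-sprout. -/
def SolidSet {V : Type*} (G : SimpleGraph V) (H : Graph (Set V) (Set V)) (S : Set V) : Prop :=
  S ∈ H.vertexSet ∨ ∃ E U W, H.IsLink E U W ∧ S ⊆ E ∧ ¬ ∃ T ⊆ E, IsSprout G S U W T

/-- `Y`, with `G[Y]` a path disjoint from `X`, is `H`-solid: `N(Y) ∩ X` is the union of two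
`H`-solid sets, and no internal vertex of the path `G[Y]` has a neighbor in `X`. -/
def Solid {V : Type*} (G : SimpleGraph V) (X : Set V) (H : Graph (Set V) (Set V)) (Y : Set V) :
    Prop :=
  (∃ S₁ S₂, SolidSet G H S₁ ∧ SolidSet G H S₂ ∧ nbrIn G X Y = S₁ ∪ S₂) ∧
    ∀ y ∈ Y, ¬ IsEndOf G Y y → nbrIn G X {y} = ∅

/-- The `V₁V₂`-chunk `C` of `H` is a pod of `Y`: Conditions P1 and P2. In P2, each end-vertex `y`
of the path `G[Y]` is, for each `i`, adjacent to none or to all of `Vᵢ ∖ C`. -/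
def IsPod {V : Type*} (G : SimpleGraph V) (X : Set V) (H : Graph (Set V) (Set V)) (Y C : Set V) :
    Prop :=
  ∃ V₁ V₂, IsChunk H V₁ V₂ C ∧ nbrIn G X Y ⊆ V₁ ∪ C ∪ V₂ ∧
    ∀ y, IsEndOf G Y y →
      (G.neighborSet y ∩ V₁ ⊆ C ∨ V₁ ⊆ C ∪ G.neighborSet y) ∧
      (G.neighborSet y ∩ V₂ ⊆ C ∨ V₂ ⊆ C ∪ G.neighborSet y)

/-- `Y` has a pod in `H`. -/
def Podded {V : Type*} (G : SimpleGraph V) (X : Set V) (H : Graph (Set V) (Set V)) (Y : Set V) :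
    Prop :=
  ∃ C, IsPod G X H Y C

/-- `Y` is `H`-solid or `H`-podded. -/
def Sticky {V : Type*} (G : SimpleGraph V) (X : Set V) (H : Graph (Set V) (Set V)) (Y : Set V) :
    Prop :=
  Solid G X H Y ∨ Podded G X H Y

end ThreeInATree

namespace ThreeInATree

/-! ### Connected vertex sets -/

section Connectivity

variable {α : Type*} {G : SimpleGraph α} {S A B : Set α} {x y a b : α}

/-- `C` is closed under taking `G`-neighbors inside `S`. -/
def ClosedIn (G : SimpleGraph α) (S C : Set α) : Prop :=
  ∀ x ∈ C, ∀ y ∈ S, G.Adj x y → y ∈ C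

/-- `G[S]` is preconnected, phrased with closed subsets. -/
def SConn (G : SimpleGraph α) (S : Set α) : Prop :=
  ∀ C ⊆ S, C.Nonempty → ClosedIn G S C → S ⊆ C

/-- The vertex set of the component of `G[S]` that contains `x`. -/
def comp (G : SimpleGraph α) (S : Set α) (x : α) : Set α :=
  {y ∈ S | ∀ C ⊆ S, x ∈ C → ClosedIn G S C → y ∈ C}

lemma comp_subset : comp G S x ⊆ S := fun _ h => h.1

lemma mem_comp (hx : x ∈ S) : x ∈ comp G S x := ⟨hx, fun _ _ h _ => h⟩

lemma comp_closed : ClosedIn G S (comp G S x) :=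
  fun _ hy _ hz hyz => ⟨hz, fun C hC hxC hcl => hcl _ (hy.2 C hC hxC hcl) _ hz hyz⟩

lemma comp_sconn (hx : x ∈ S) : SConn G (comp G S x) := by
  intro D hD hne hcl
  by_cases hxD : x ∈ D
  · intro y hy
    exact hy.2 D (hD.trans comp_subset) hxD fun u hu v hv huv =>
      hcl u hu v (comp_closed u (hD hu) v hv huv) huv
  · exfalso
    obtain ⟨d, hd⟩ := hne
    have := (hD hd).2 (comp G S x \ D) (Set.sdiff_subset.trans comp_subset) ⟨mem_comp hx, hxD⟩
      fun u hu v hv huv => ⟨comp_closed u hu.1 v hv huv, fun hvD => hu.2 (hcl v hvD u hu.1 huv.symm)⟩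
    exact this.2 hd

lemma SConn.exists_adj (h : SConn G S) (hA : A ⊆ S) (ha : a ∈ A) (hb : b ∈ S) (hbA : b ∉ A) :
    ∃ u ∈ A, ∃ v ∈ S, v ∉ A ∧ G.Adj u v := by
  by_contra hcon
  push Not at hcon
  exact hbA (h A hA ⟨a, ha⟩ (fun u hu v hv huv => by
    by_contra hvA
    exact hcon u hu v hv hvA huv) hb)

lemma SConn.subset_comp (h : SConn G A) (hA : A ⊆ S) (hx : x ∈ A) : A ⊆ comp G S x := by
  intro y hy
  refine ⟨hA hy, fun C _ hxC hcl => ?_⟩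
  have := h (C ∩ A) Set.inter_subset_right ⟨x, hxC, hx⟩
    fun u hu v hv huv => ⟨hcl u hu.1 v (hA hv) huv, hv⟩
  exact (this hy).1

lemma sconn_singleton : SConn G {a} := by
  rintro C hC ⟨c, hc⟩ - y rfl
  have := hC hc
  simp only [Set.mem_singleton_iff] at this
  exact this ▸ hc

lemma SConn.union_of_mem (hA : SConn G A) (hB : SConn G B) (ha : x ∈ A) (hb : x ∈ B) :
    SConn G (A ∪ B) := by
  intro C hC hne hcl
  have key : x ∈ C := by
    obtain ⟨c, hc⟩ := hne
    rcases hC hc with h | h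
    · exact (hA (C ∩ A) Set.inter_subset_right ⟨c, hc, h⟩
        (fun u hu v hv huv => ⟨hcl u hu.1 v (Or.inl hv) huv, hv⟩) ha).1
    · exact (hB (C ∩ B) Set.inter_subset_right ⟨c, hc, h⟩
        (fun u hu v hv huv => ⟨hcl u hu.1 v (Or.inr hv) huv, hv⟩) hb).1
  rintro y (hy | hy)
  · exact (hA (C ∩ A) Set.inter_subset_right ⟨x, key, ha⟩
        (fun u hu v hv huv => ⟨hcl u hu.1 v (Or.inl hv) huv, hv⟩) hy).1
  · exact (hB (C ∩ B) Set.inter_subset_right ⟨x, key, hb⟩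
        (fun u hu v hv huv => ⟨hcl u hu.1 v (Or.inr hv) huv, hv⟩) hy).1

lemma sconn_pair (h : G.Adj a b) : SConn G {a, b} := by
  rintro C hC ⟨c, hc⟩ hcl
  have h1 : a ∈ C ∧ b ∈ C := by
    rcases hC hc with rfl | h'
    · exact ⟨hc, hcl _ hc _ (by simp) h⟩
    · rw [Set.mem_singleton_iff] at h'
      subst h'
      exact ⟨hcl _ hc _ (by simp) h.symm, hc⟩
  rintro y (rfl | hy)
  · exact h1.1
  · rw [Set.mem_singleton_iff] at hy
    exact hy ▸ h1.2

lemma SConn.union_of_adj (hA : SConn G A) (hB : SConn G B) (ha : a ∈ A) (hb : b ∈ B)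
    (h : G.Adj a b) : SConn G (A ∪ B) := by
  have h1 := hA.union_of_mem (sconn_pair h) ha (by simp)
  have h2 := h1.union_of_mem hB (x := b) (by simp) hb
  convert h2 using 1
  ext y
  simp only [Set.mem_union, Set.mem_insert_iff, Set.mem_singleton_iff]
  constructor
  · tauto
  · rintro ((h | rfl | rfl) | h) <;> tauto

lemma SConn.insert_of_adj (hA : SConn G A) (ha : a ∈ A) (h : G.Adj a b) :
    SConn G (insert b A) := by
  rw [Set.insert_eq, Set.union_comm]
  exact hA.union_of_adj sconn_singleton ha rfl h

lemma sconn_support {u v : α} (p : G.Walk u v) : SConn G {w | w ∈ p.support} := by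
  induction p with
  | nil => simpa using sconn_singleton
  | cons h p ih =>
    have := ih.insert_of_adj (a := _) (b := _) p.start_mem_support h.symm
    convert this using 1
    ext w
    simp

lemma SConn.exists_walk (h : SConn G S) (ha : a ∈ S) (hb : b ∈ S) :
    ∃ p : G.Walk a b, ∀ w ∈ p.support, w ∈ S := by
  have := h {y | y ∈ S ∧ ∃ p : G.Walk a y, ∀ w ∈ p.support, w ∈ S} (fun _ h => h.1)
    ⟨a, ha, .nil, by simpa using ha⟩ (by
      rintro u ⟨hu, p, hp⟩ v hv huv
      refine ⟨hv, p.concat huv, fun w hw => ?_⟩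
      rw [SimpleGraph.Walk.support_concat] at hw
      simp only [List.mem_append, List.mem_singleton] at hw
      rcases hw with hw | rfl
      · exact hp w hw
      · exact hv)
  exact (this hb).2

lemma SConn.exists_path (h : SConn G S) (ha : a ∈ S) (hb : b ∈ S) :
    ∃ p : G.Walk a b, p.IsPath ∧ ∀ w ∈ p.support, w ∈ S := by
  classical
  obtain ⟨p, hp⟩ := h.exists_walk ha hb
  exact ⟨p.bypass, p.bypass_isPath, fun w hw => hp w (p.support_bypass_subset_support hw)⟩

lemma sconn_iff_induce : SConn G S ↔ (G.induce S).Preconnected := by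
  constructor
  · rintro h ⟨a, ha⟩ ⟨b, hb⟩
    obtain ⟨p, hp⟩ := h.exists_walk ha hb
    exact ⟨p.induce S hp⟩
  · intro h C hC hne hcl y hy
    obtain ⟨c, hc⟩ := hne
    obtain ⟨p⟩ := h ⟨c, hC hc⟩ ⟨y, hy⟩
    have : ∀ (u v : S) (_ : (G.induce S).Walk u v), (u : α) ∈ C → (v : α) ∈ C := by
      intro u v p
      induction p with
      | nil => exact id
      | cons h p ih => exact fun hu => ih (hcl _ hu _ (Subtype.property _) h)
    exact this _ _ p hc

/-- In a connected set one of two vertices can be reached from `x` without the other. -/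
lemma SConn.comp_diff_or (h : SConn G S) (hx : x ∈ S) (ha : a ∈ S) (hxa : x ≠ a)
    (hb : b ∉ comp G (S \ {a}) x) (hab : a ≠ b) : a ∈ comp G (S \ {b}) x := by
  have hxS : x ∈ S \ {a} := ⟨hx, hxa⟩
  have hxc := mem_comp (G := G) hxS
  obtain ⟨u, hu, v, hv, hvn, huv⟩ := h.exists_adj (comp_subset.trans Set.sdiff_subset) hxc ha
    (fun h => (comp_subset h).2 rfl)
  have hva : v = a := by
    by_contra hva
    exact hvn (comp_closed u hu v ⟨hv, hva⟩ huv)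
  subst hva
  have h1 := (comp_sconn hxS).insert_of_adj hu huv
  refine h1.subset_comp (x := x) ?_ (Or.inr hxc) (Or.inl rfl)
  rintro y (rfl | hy)
  · exact ⟨ha, hab⟩
  · exact ⟨(comp_subset hy).1, fun hyb => hb (hyb ▸ hy)⟩

/-- The component of `x` in `S ∖ {a}` has a vertex adjacent to `a`. -/
lemma SConn.exists_comp_diff_adj (h : SConn G S) (hx : x ∈ S) (ha : a ∈ S) (hxa : x ≠ a) :
    ∃ u ∈ comp G (S \ {a}) x, G.Adj u a := by
  have hxS : x ∈ S \ {a} := ⟨hx, hxa⟩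
  obtain ⟨u, hu, v, hv, hvn, huv⟩ := h.exists_adj (comp_subset.trans Set.sdiff_subset)
    (mem_comp (G := G) hxS) ha (fun h => (comp_subset h).2 rfl)
  have hva : v = a := by
    by_contra hva
    exact hvn (comp_closed u hu v ⟨hv, hva⟩ huv)
  exact ⟨u, hu, hva ▸ huv⟩

end Connectivity

/-! ### Induced trees -/

section Trees

variable {V : Type*} {G : SimpleGraph V} {S T T₁ T₂ F : Set V}

/-- The edges of `G[T]`, as unordered pairs of vertices of `G`. -/
def edgesOn (G : SimpleGraph V) (T : Set V) : Set (Sym2 V) := {e ∈ G.edgeSet | ∀ v ∈ e, v ∈ T}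

lemma card_edgeSet_induce (G : SimpleGraph V) (T : Set V) :
    Nat.card (G.induce T).edgeSet = (edgesOn G T).ncard := by
  rw [← Nat.card_coe_set_eq]
  have : edgesOn G T = Sym2.map Subtype.val '' (G.induce T).edgeSet := by
    ext e
    induction e with | _ u v
    simp only [edgesOn, Set.mem_ofPred_eq, SimpleGraph.mem_edgeSet, Sym2.mem_iff, Set.mem_image]
    constructor
    · rintro ⟨h, hT⟩
      exact ⟨s(⟨u, hT u (Or.inl rfl)⟩, ⟨v, hT v (Or.inr rfl)⟩), by simpa using h, by simp⟩
    · rintro ⟨e, he, heq⟩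
      induction e with | _ a b
      simp only [SimpleGraph.mem_edgeSet, SimpleGraph.comap_adj, Function.Embedding.subtype_apply] at he
      simp only [Sym2.map_mk, Sym2.eq_iff] at heq
      rcases heq with ⟨rfl, rfl⟩ | ⟨rfl, rfl⟩
      · exact ⟨he, by rintro w (rfl | rfl) <;> exact Subtype.property _⟩
      · exact ⟨he.symm, by rintro w (rfl | rfl) <;> exact Subtype.property _⟩
  rw [this, Nat.card_image_of_injective (Sym2.map.injective Subtype.val_injective)]

lemma isTree_induce_iff [Finite V] :
    (G.induce T).IsTree ↔ SConn G T ∧ T.Nonempty ∧ (edgesOn G T).ncard + 1 = T.ncard := by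
  rw [SimpleGraph.isTree_iff_connected_and_card, card_edgeSet_induce, Nat.card_coe_set_eq,
    SimpleGraph.connected_iff, sconn_iff_induce, Set.nonempty_coe_sort, and_assoc]

lemma isTree_sconn (h : (G.induce T).IsTree) : SConn G T := sconn_iff_induce.2 h.connected.preconnected

lemma isTree_singleton (v : V) : (G.induce {v}).IsTree := by
  have : Subsingleton ({v} : Set V) := by
    constructor
    rintro ⟨a, rfl⟩ ⟨b, hb⟩
    exact Subtype.ext hb.symm
  have : Nonempty ({v} : Set V) := ⟨⟨v, rfl⟩⟩
  exact SimpleGraph.IsTree.of_subsingleton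

/-- Two disjoint induced trees joined by exactly one edge form an induced tree. -/
lemma isTree_union [Finite V] (h₁ : (G.induce T₁).IsTree) (h₂ : (G.induce T₂).IsTree)
    (hd : Disjoint T₁ T₂) {a b : V} (ha : a ∈ T₁) (hb : b ∈ T₂) (hab : G.Adj a b)
    (huniq : ∀ u ∈ T₁, ∀ v ∈ T₂, G.Adj u v → u = a ∧ v = b) : (G.induce (T₁ ∪ T₂)).IsTree := by
  rw [isTree_induce_iff] at *
  obtain ⟨c₁, n₁, e₁⟩ := h₁
  obtain ⟨c₂, n₂, e₂⟩ := h₂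
  refine ⟨c₁.union_of_adj c₂ ha hb hab, n₁.inl, ?_⟩
  have key : edgesOn G (T₁ ∪ T₂) = insert s(a, b) (edgesOn G T₁ ∪ edgesOn G T₂) := by
    ext e
    induction e with | _ u v
    simp only [edgesOn, Set.mem_ofPred_eq, SimpleGraph.mem_edgeSet, Sym2.mem_iff, Set.mem_union,
      Set.mem_insert_iff, Sym2.eq_iff]
    constructor
    · rintro ⟨huv, h⟩
      rcases h u (Or.inl rfl) with hu | hu <;> rcases h v (Or.inr rfl) with hv | hv
      · exact Or.inr (Or.inl ⟨huv, by rintro w (rfl | rfl) <;> assumption⟩)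
      · exact Or.inl (Or.inl (huniq u hu v hv huv))
      · exact Or.inl (Or.inr ((huniq v hv u hu huv.symm).symm))
      · exact Or.inr (Or.inr ⟨huv, by rintro w (rfl | rfl) <;> assumption⟩)
    · rintro ((⟨rfl, rfl⟩ | ⟨rfl, rfl⟩) | ⟨h, h'⟩ | ⟨h, h'⟩)
      · exact ⟨hab, by rintro w (rfl | rfl) <;> tauto⟩
      · exact ⟨hab.symm, by rintro w (rfl | rfl) <;> tauto⟩
      · exact ⟨h, fun w hw => Or.inl (h' w hw)⟩
      · exact ⟨h, fun w hw => Or.inr (h' w hw)⟩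
  have hdis : Disjoint (edgesOn G T₁) (edgesOn G T₂) := by
    rw [Set.disjoint_left]
    intro e
    induction e with | _ u v
    rintro ⟨-, h⟩ ⟨-, h'⟩
    exact Set.disjoint_left.1 hd (h u (by simp)) (h' u (by simp))
  have hnot : s(a, b) ∉ edgesOn G T₁ ∪ edgesOn G T₂ := by
    rintro (⟨-, h⟩ | ⟨-, h⟩)
    · exact Set.disjoint_left.1 hd (h b (by simp)) hb
    · exact Set.disjoint_left.1 hd ha (h a (by simp))
  rw [key, Set.ncard_insert_of_notMem hnot (Set.toFinite _),
    Set.ncard_union_eq hdis (Set.toFinite _) (Set.toFinite _),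
    Set.ncard_union_eq hd (Set.toFinite _) (Set.toFinite _)]
  omega

/-- A connected set that contains `x` and meets `F` contains an induced tree through `x` that
meets `F` in exactly one vertex. -/
lemma SConn.exists_isTree [Finite V] (h : SConn G S) {x : V} (hx : x ∈ S) (hF : (S ∩ F).Nonempty) :
    ∃ T ⊆ S, (G.induce T).IsTree ∧ x ∈ T ∧ ∃ f, T ∩ F = {f} := by
  let D := G.induce S
  have hD : D.Preconnected := sconn_iff_induce.1 h
  let x' : S := ⟨x, hx⟩
  have key : ∀ n : ℕ, ∀ v : S, D.dist x' v = n → ∃ T : Set V, T ⊆ S ∧ (G.induce T).IsTree ∧ x ∈ T ∧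
      (v : V) ∈ T ∧ ∀ u : S, (u : V) ∈ T → u = v ∨ D.dist x' u < n := by
    intro n
    induction n with
    | zero =>
      intro v hv
      have : x' = v := (hD x' v).dist_eq_zero_iff.1 hv
      subst this
      refine ⟨{x}, by simpa using hx, isTree_singleton x, rfl, rfl, fun u hu => Or.inl (Subtype.ext hu)⟩
    | succ n ih =>
      intro v hv
      obtain ⟨p, hp⟩ := (hD v x').exists_walk_length_eq_dist
      rw [SimpleGraph.dist_comm, hv] at hp
      cases p with
      | nil => simp at hp
      | @cons _ w _ hvw p =>
        simp only [SimpleGraph.Walk.length_cons, add_left_inj] at hp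
        have h1 : D.dist x' w ≤ n := by
          rw [SimpleGraph.dist_comm, ← hp]
          exact SimpleGraph.dist_le p
        have h2 : D.dist x' v ≤ D.dist x' w + 1 := by
          obtain ⟨q, hq⟩ := (hD x' w).exists_walk_length_eq_dist
          rw [← hq, ← SimpleGraph.Walk.length_concat q hvw.symm]
          exact SimpleGraph.dist_le _
        obtain ⟨T, hTS, hT, hxT, hwT, hlt⟩ := ih w (by omega)
        have hvT : (v : V) ∉ T := by
          intro hvT
          rcases hlt v hvT with rfl | h
          · exact hvw.ne rfl
          · omega
        refine ⟨T ∪ {(v : V)}, Set.union_subset hTS (by simp), ?_, Or.inl hxT, Or.inr rfl, ?_⟩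
        · refine isTree_union hT (isTree_singleton _) (by simpa using hvT) hwT rfl
            (SimpleGraph.Adj.symm hvw : G.Adj w v) ?_
          rintro u hu _ rfl huv
          refine ⟨?_, rfl⟩
          have hadj : D.Adj ⟨u, hTS hu⟩ v := huv
          rcases hlt ⟨u, hTS hu⟩ hu with h | h
          · rw [← h]
          · exfalso
            obtain ⟨q, hq⟩ := (hD x' ⟨u, hTS hu⟩).exists_walk_length_eq_dist
            have := SimpleGraph.dist_le (q.concat hadj)
            rw [SimpleGraph.Walk.length_concat] at this
            omega
        · rintro u (hu | hu)
          · right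
            rcases hlt u hu with rfl | h <;> omega
          · exact Or.inl (Subtype.ext hu)
  obtain ⟨f, hfS, hfF⟩ := hF
  obtain ⟨v, hv, hmin⟩ := Set.exists_min_image {v : S | (v : V) ∈ F} (D.dist x') (Set.toFinite _)
    ⟨⟨f, hfS⟩, hfF⟩
  obtain ⟨T, hTS, hT, hxT, hvT, hlt⟩ := key _ v rfl
  refine ⟨T, hTS, hT, hxT, v, Set.Subset.antisymm ?_ (by rintro _ rfl; exact ⟨hvT, hv⟩)⟩
  rintro u ⟨huT, huF⟩
  rcases hlt ⟨u, hTS huT⟩ huT with h | h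
  · rw [← h]; rfl
  · exact absurd (hmin ⟨u, hTS huT⟩ huF) (by omega)

end Trees

/-! ### Menger's theorem -/

section Menger

variable {α : Type*}

/-- Every walk of `G` from `A` to `B` meets `S`. -/
def Separates (G : SimpleGraph α) (A B S : Set α) : Prop :=
  ∀ a ∈ A, ∀ b ∈ B, ∀ p : G.Walk a b, ∃ v ∈ p.support, v ∈ S

/-- There are `k` pairwise disjoint paths of `G` from `A` to `B`. -/
def Linked (G : SimpleGraph α) (A B : Set α) (k : ℕ) : Prop :=
  ∃ (s t : Fin k → α) (p : ∀ i, G.Walk (s i) (t i)), (∀ i, s i ∈ A) ∧ (∀ i, t i ∈ B) ∧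
    (∀ i, (p i).IsPath) ∧ ∀ i j, i ≠ j → ∀ v ∈ (p i).support, v ∉ (p j).support

variable {G : SimpleGraph α} {A B S T : Set α} {x y : α}

lemma Separates.symm (h : Separates G A B S) : Separates G B A S := fun b hb a ha p => by
  obtain ⟨v, hv, hS⟩ := h a ha b hb p.reverse
  exact ⟨v, by simpa using hv, hS⟩

lemma separates_insert (h : Separates (G.deleteEdges {s(x, y)}) A B S) :
    Separates G A B (insert x S) := by
  intro a ha b hb p
  by_cases hx : x ∈ p.support
  · exact ⟨x, hx, Or.inl rfl⟩
  · have hp : ∀ e ∈ p.edges, e ∈ (G.deleteEdges {s(x, y)}).edgeSet := by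
      intro e he
      rw [SimpleGraph.edgeSet_deleteEdges]
      refine ⟨p.edges_subset_edgeSet he, ?_⟩
      rintro rfl
      exact hx (p.fst_mem_support_of_mem_edges he)
    obtain ⟨v, hv, hS⟩ := h a ha b hb (p.transfer _ hp)
    exact ⟨v, by simpa using hv, Or.inr hS⟩

lemma separates_of_separates_deleteEdges (hS : Separates (G.deleteEdges {s(x, y)}) A B S)
    (hy : Separates (G.deleteEdges {s(x, y)}) A {y} S)
    (hT : Separates (G.deleteEdges {s(x, y)}) A (insert x S) T) : Separates G A B T := by
  have key : ∀ (u b : α) (p : G.Walk u b), b ∈ B → (∀ v ∈ p.support, v ∉ T) →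
      ∀ a ∈ A, ∀ q : (G.deleteEdges {s(x, y)}).Walk a u, (∀ v ∈ q.support, v ∉ T) →
      (∀ v ∈ q.support, v ∉ insert x S) → False := by
    intro u b p
    induction p with
    | nil =>
      intro hb _ a ha q _ hq
      obtain ⟨v, hv, hvS⟩ := hS a ha _ hb q
      exact hq v hv (Or.inr hvS)
    | @cons u v b huv p ih =>
      intro hb hp a ha q hqT hq
      by_cases hadj : (G.deleteEdges {s(x, y)}).Adj u v
      · have hvT : v ∉ T := hp v (by simp)
        have hqv : ∀ w ∈ (q.concat hadj).support, w ∉ T := by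
          intro w hw
          rw [SimpleGraph.Walk.support_concat] at hw
          simp only [List.mem_append, List.mem_singleton] at hw
          rcases hw with hw | rfl
          · exact hqT w hw
          · exact hvT
        by_cases hv : v ∈ insert x S
        · obtain ⟨w, hw, hwT⟩ := hT a ha v hv (q.concat hadj)
          exact hqv w hw hwT
        · refine ih hb (fun w hw => hp w (by simp [hw])) a ha (q.concat hadj) hqv ?_
          intro w hw
          rw [SimpleGraph.Walk.support_concat] at hw
          simp only [List.mem_append, List.mem_singleton] at hw
          rcases hw with hw | rfl
          · exact hq w hw
          · exact hv
      · have hux : u ≠ x := fun h => hq u q.end_mem_support (Or.inl h)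
        rw [SimpleGraph.deleteEdges_adj, not_and_not_right] at hadj
        have h2 := hadj huv
        simp only [Set.mem_singleton_iff, Sym2.eq_iff] at h2
        rcases h2 with ⟨rfl, rfl⟩ | ⟨rfl, rfl⟩
        · exact hux rfl
        · obtain ⟨w, hw, hwS⟩ := hy a ha _ rfl q
          exact hq w hw (Or.inr hwS)
  intro a ha b hb p
  by_contra hcon
  push Not at hcon
  have haT : a ∉ T := hcon a p.start_mem_support
  by_cases hax : a ∈ insert x S
  · obtain ⟨v, hv, hvT⟩ := hT a ha a hax .nil
    rw [SimpleGraph.Walk.support_nil, List.mem_singleton] at hv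
    exact haT (hv ▸ hvT)
  · exact key a b p hb hcon a ha .nil (by simpa using haT) (by simpa using hax)

lemma exists_injective_fin [Finite α] {k : ℕ} (h : k ≤ S.ncard) :
    ∃ f : Fin k → α, Function.Injective f ∧ ∀ i, f i ∈ S := by
  obtain ⟨S', hS', hcard⟩ := Set.exists_subset_card_eq h
  have e : S' ≃ Fin k := Finite.equivFinOfCardEq (by rw [Nat.card_coe_set_eq]; exact hcard)
  exact ⟨fun i => (e.symm i : α), Subtype.val_injective.comp e.symm.injective,
    fun i => hS' (e.symm i).2⟩

lemma surj_of_linked [Finite α] {k : ℕ} {t : Fin k → α} (hinj : Function.Injective t)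
    (ht : ∀ i, t i ∈ S) (hS : S.ncard = k) : ∀ v ∈ S, ∃ i, t i = v := by
  have h1 : Set.range t ⊆ S := by rintro _ ⟨i, rfl⟩; exact ht i
  have h2 : (Set.range t).ncard = k := by
    rw [← Nat.card_coe_set_eq, Nat.card_range_of_injective hinj, Nat.card_fin]
  have h3 := Set.eq_of_subset_of_ncard_le h1 (by omega) (Set.toFinite _)
  intro v hv
  rw [← h3] at hv
  exact hv

/-- Menger's theorem: if every set separating `A` from `B` has at least `k` vertices, then there
are `k` pairwise disjoint paths from `A` to `B`. -/
theorem linked_of_forall_separates [Finite α] (k : ℕ) :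
    ∀ (n : ℕ) (G : SimpleGraph α) (A B : Set α), G.edgeSet.ncard = n →
      (∀ S, Separates G A B S → k ≤ S.ncard) → Linked G A B k := by
  classical
  intro n
  induction n using Nat.strong_induction_on with
  | _ n ih =>
  intro G A B hn hsep
  by_cases hE : G.edgeSet = ∅
  · have hnil : ∀ a b (p : G.Walk a b), a = b := by
      intro a b p
      cases p with
      | nil => rfl
      | cons h p => exact absurd ((SimpleGraph.mem_edgeSet G).2 h) (by simp [hE])
    obtain ⟨f, hf, hfS⟩ := exists_injective_fin (hsep (A ∩ B) (fun a ha b hb p => by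
      have := hnil a b p
      subst this
      exact ⟨a, p.start_mem_support, ha, hb⟩))
    refine ⟨f, f, fun i => .nil, fun i => (hfS i).1, fun i => (hfS i).2, by simp, ?_⟩
    intro i j hij v hv hv'
    simp only [SimpleGraph.Walk.support_nil, List.mem_singleton] at hv hv'
    exact hij (hf (hv ▸ hv'))
  obtain ⟨e, he⟩ := Set.nonempty_iff_ne_empty.2 hE
  have step : ∀ x y, G.Adj x y → ∀ S, Separates (G.deleteEdges {s(x, y)}) A B S → S.ncard < k →
      Separates (G.deleteEdges {s(x, y)}) A {y} S → Separates (G.deleteEdges {s(x, y)}) B {x} S →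
      Linked G A B k := by
    intro x y hxy S hS hSk hAy hBx
    set G' := G.deleteEdges {s(x, y)} with hG'
    have hle : G' ≤ G := G.deleteEdges_le _
    have hsymm : G.deleteEdges {s(y, x)} = G' := by rw [hG', Sym2.eq_swap]
    have hlt : G'.edgeSet.ncard < n := by
      rw [← hn]
      refine Set.ncard_lt_ncard ?_ (Set.toFinite _)
      rw [hG', SimpleGraph.edgeSet_deleteEdges]
      exact ⟨Set.sdiff_subset, fun h => (h ((SimpleGraph.mem_edgeSet G).2 hxy)).2 rfl⟩
    have hSx : (insert x S).ncard = k := by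
      have h1 := hsep _ (separates_insert hS)
      have h2 := Set.ncard_insert_le x S
      omega
    have hSy : (insert y S).ncard = k := by
      have h1 := hsep (insert y S) (separates_insert (x := y) (y := x) (by rw [hsymm]; exact hS))
      have h2 := Set.ncard_insert_le y S
      omega
    have hyS : y ∉ S := by
      intro h
      rw [Set.insert_eq_of_mem h] at hSy
      omega
    obtain ⟨s, t, p, hs, ht, hp, hdis⟩ := ih _ hlt G' A (insert x S) rfl
      (fun T hT => hsep T (separates_of_separates_deleteEdges hS hAy hT))
    obtain ⟨s', t', q, hs', ht', hq, hdis'⟩ := ih _ hlt G' B (insert y S) rfl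
      (fun T hT => hsep T (separates_of_separates_deleteEdges (x := y) (y := x)
        (by rw [hsymm]; exact hS.symm) (by rw [hsymm]; exact hBx) (by rw [hsymm]; exact hT)).symm)
    have hinj : Function.Injective t := by
      intro i j hij
      by_contra hne
      exact hdis i j hne _ (p i).end_mem_support (by rw [hij]; exact (p j).end_mem_support)
    have hinj' : Function.Injective t' := by
      intro i j hij
      by_contra hne
      exact hdis' i j hne _ (q i).end_mem_support (by rw [hij]; exact (q j).end_mem_support)
    have hsurj := surj_of_linked hinj ht hSx
    have hsurj' := surj_of_linked hinj' ht' hSy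
    have hPS : ∀ i, ∀ v ∈ (p i).support, v ∈ S → v = t i := by
      intro i v hv hvS
      obtain ⟨j, rfl⟩ := hsurj v (Or.inr hvS)
      by_contra hne
      exact hdis j i (fun h => hne (by rw [h])) _ (p j).end_mem_support hv
    have hQS : ∀ i, ∀ v ∈ (q i).support, v ∈ S → v = t' i := by
      intro i v hv hvS
      obtain ⟨j, rfl⟩ := hsurj' v (Or.inr hvS)
      by_contra hne
      exact hdis' j i (fun h => hne (by rw [h])) _ (q j).end_mem_support hv
    have hPQ : ∀ i j, ∀ v ∈ (p i).support, v ∈ (q j).support → v ∈ S := by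
      intro i j v hv hv'
      by_contra hvS
      obtain ⟨w, hw, hwS⟩ := hS _ (hs i) _ (hs' j)
        (((p i).takeUntil v hv).append ((q j).takeUntil v hv').reverse)
      rw [SimpleGraph.Walk.mem_support_append_iff, SimpleGraph.Walk.support_reverse,
        List.mem_reverse] at hw
      rcases hw with hw | hw
      · have h1 := hPS i w ((p i).support_takeUntil_subset_support hv hw) hwS
        subst h1
        exact SimpleGraph.Walk.endpoint_notMem_support_takeUntil (hp i) hv
          (fun h => hvS (h ▸ hwS)) hw
      · have h1 := hQS j w ((q j).support_takeUntil_subset_support hv' hw) hwS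
        subst h1
        exact SimpleGraph.Walk.endpoint_notMem_support_takeUntil (hq j) hv'
          (fun h => hvS (h ▸ hwS)) hw
    have hσ : ∀ i, ∃ j, (t i ∈ S ∧ t' j = t i) ∨ (t i = x ∧ t' j = y) := by
      intro i
      rcases ht i with h | h
      · obtain ⟨j, hj⟩ := hsurj' y (Or.inl rfl)
        exact ⟨j, Or.inr ⟨h, hj⟩⟩
      · obtain ⟨j, hj⟩ := hsurj' (t i) (Or.inr h)
        exact ⟨j, Or.inl ⟨h, hj⟩⟩
    choose σ hσ using hσ
    have hσinj : Function.Injective σ := by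
      intro i j hij
      rcases hσ i with ⟨h1, h2⟩ | ⟨h1, h2⟩ <;> rcases hσ j with ⟨h3, h4⟩ | ⟨h3, h4⟩ <;>
        rw [hij] at h2
      · exact hinj (h2.symm.trans h4)
      · exact absurd (h2.symm.trans h4 ▸ h1) hyS
      · exact absurd (h4.symm.trans h2 ▸ h3) hyS
      · exact hinj (h1.trans h3.symm)
    have hw : ∀ i, ∃ w : G.Walk (s i) (s' (σ i)), ∀ v ∈ w.support,
        v ∈ (p i).support ∨ v ∈ (q (σ i)).support := by
      intro i
      rcases hσ i with ⟨-, h⟩ | ⟨h1, h2⟩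
      · refine ⟨((p i).mapLe hle).append (((q (σ i)).mapLe hle).reverse.copy h rfl), ?_⟩
        intro v hv
        simpa [SimpleGraph.Walk.mem_support_append_iff] using hv
      · have hadj : G.Adj (t i) (t' (σ i)) := by rw [h1, h2]; exact hxy
        refine ⟨((p i).mapLe hle).append (.cons hadj ((q (σ i)).mapLe hle).reverse), ?_⟩
        intro v hv
        simp only [SimpleGraph.Walk.mem_support_append_iff, SimpleGraph.Walk.support_mapLe_eq_support,
          SimpleGraph.Walk.support_cons, List.mem_cons, SimpleGraph.Walk.support_reverse,
          List.mem_reverse] at hv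
        rcases hv with hv | rfl | hv
        · exact Or.inl hv
        · exact Or.inl (p i).end_mem_support
        · exact Or.inr hv
    choose w hw using hw
    have hcross : ∀ i j, i ≠ j → ∀ v ∈ (p i).support, v ∉ (q (σ j)).support := by
      intro i j hij v hv hv'
      have hvS := hPQ i (σ j) v hv hv'
      have h1 := hPS i v hv hvS
      have h2 := hQS _ v hv' hvS
      rcases hσ j with ⟨-, h⟩ | ⟨-, h⟩
      · exact hij (hinj (h1.symm.trans (h2.trans h)))
      · exact hyS (h ▸ h2 ▸ hvS)
    refine ⟨s, fun i => s' (σ i), fun i => (w i).bypass, hs, fun i => hs' _,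
      fun i => (w i).bypass_isPath, ?_⟩
    intro i j hij v hv hv'
    rcases hw i v ((w i).support_bypass_subset_support hv) with h1 | h1 <;>
      rcases hw j v ((w j).support_bypass_subset_support hv') with h2 | h2
    · exact hdis i j hij v h1 h2
    · exact hcross i j hij v h1 h2
    · exact hcross j i hij.symm v h2 h1
    · exact hdis' _ _ (fun h => hij (hσinj h)) v h1 h2
  induction e with | _ x y
  rw [SimpleGraph.mem_edgeSet] at he
  by_cases hdel : ∀ S, Separates (G.deleteEdges {s(x, y)}) A B S → k ≤ S.ncard
  · have hlt : (G.deleteEdges {s(x, y)}).edgeSet.ncard < n := by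
      rw [← hn]
      refine Set.ncard_lt_ncard ?_ (Set.toFinite _)
      rw [SimpleGraph.edgeSet_deleteEdges]
      exact ⟨Set.sdiff_subset, fun h => (h ((SimpleGraph.mem_edgeSet G).2 he)).2 rfl⟩
    obtain ⟨s, t, p, hs, ht, hp, hdis⟩ := ih _ hlt _ A B rfl hdel
    refine ⟨s, t, fun i => (p i).mapLe (G.deleteEdges_le _), hs, ht, fun i => (hp i).mapLe _, ?_⟩
    intro i j hij v hv hv'
    simp only [SimpleGraph.Walk.support_mapLe_eq_support] at hv hv'
    exact hdis i j hij v hv hv'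
  push Not at hdel
  obtain ⟨S, hS, hSk⟩ := hdel
  have hmeet : ∀ z, ¬ Separates (G.deleteEdges {s(x, y)}) A {z} S →
      Separates (G.deleteEdges {s(x, y)}) B {z} S := by
    intro z hz
    unfold Separates at hz
    push Not at hz
    obtain ⟨a, ha, _, rfl, p, hp⟩ := hz
    rintro b hb _ rfl q
    obtain ⟨v, hv, hvS⟩ := hS a ha b hb (p.append q.reverse)
    rw [SimpleGraph.Walk.mem_support_append_iff, SimpleGraph.Walk.support_reverse,
      List.mem_reverse] at hv
    rcases hv with hv | hv
    · exact absurd hvS (hp v hv)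
    · exact ⟨v, hv, hvS⟩
  by_cases hx : Separates (G.deleteEdges {s(x, y)}) A {x} S
  · by_cases hy : Separates (G.deleteEdges {s(x, y)}) A {y} S
    · exfalso
      have h1 : Separates G A B S := by
        refine separates_of_separates_deleteEdges hS hy ?_
        rintro a ha b (rfl | hb) p
        · exact hx a ha b rfl p
        · exact ⟨b, p.end_mem_support, hb⟩
      exact absurd (hsep S h1) (by omega)
    · refine step y x he.symm S (by rwa [Sym2.eq_swap]) hSk (by rwa [Sym2.eq_swap]) ?_
      rw [Sym2.eq_swap]
      exact hmeet y hy
  · refine step x y he S hS hSk ?_ (hmeet x hx)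
    by_contra hy
    have hBx := hmeet x hx
    have hBy := hmeet y hy
    exfalso
    have h1 : Separates G B A S := by
      refine separates_of_separates_deleteEdges hS.symm hBy ?_
      rintro a ha b (rfl | hb) p
      · exact hBx a ha b rfl p
      · exact ⟨b, p.end_mem_support, hb⟩
    exact absurd (hsep S h1.symm) (by omega)

end Menger

/-! ### Induced paths and rungs -/

section Paths

variable {V : Type*} {G : SimpleGraph V} {U W R : Set V}

/-- `f 0, …, f n` is an induced path of `G`. -/
structure IndPath (G : SimpleGraph V) (n : ℕ) (f : ℕ → V) : Prop where
  inj : ∀ i ≤ n, ∀ j ≤ n, f i = f j → i = j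
  adj : ∀ i ≤ n, ∀ j ≤ n, (G.Adj (f i) (f j) ↔ i + 1 = j ∨ j + 1 = i)

/-- The vertices `f l, …, f r`. -/
def seg (f : ℕ → V) (l r : ℕ) : Set V := f '' Set.Icc l r

lemma seg_subset {f : ℕ → V} {l r l' r' : ℕ} (hl : l' ≤ l) (hr : r ≤ r') :
    seg f l r ⊆ seg f l' r' := Set.image_mono (Set.Icc_subset_Icc hl hr)

lemma mem_seg {f : ℕ → V} {l r i : ℕ} (h1 : l ≤ i) (h2 : i ≤ r) : f i ∈ seg f l r :=
  ⟨i, ⟨h1, h2⟩, rfl⟩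

lemma exists_indPath {n : ℕ} (e : SimpleGraph.pathGraph (n + 1) ↪g G) :
    ∃ f : ℕ → V, IndPath G n f ∧ Set.range e = seg f 0 n ∧ f 0 = e 0 ∧ f n = e (Fin.last n) := by
  have hlt : ∀ i, min i n < n + 1 := fun i => by omega
  refine ⟨fun i => e ⟨min i n, hlt i⟩, ⟨?_, ?_⟩, ?_, ?_, ?_⟩
  · intro i hi j hj h
    have := e.injective h
    simp only [Fin.mk.injEq] at this
    omega
  · intro i hi j hj
    rw [SimpleGraph.Embedding.map_adj_iff, SimpleGraph.pathGraph_adj]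
    simp only [min_eq_left hi, min_eq_left hj]
  · ext v
    simp only [Set.mem_range, seg, Set.mem_image, Set.mem_Icc]
    constructor
    · rintro ⟨i, rfl⟩
      refine ⟨i, ⟨by omega, by omega⟩, ?_⟩
      congr 1
      ext
      simp only
      omega
    · rintro ⟨i, -, rfl⟩
      exact ⟨_, rfl⟩
  · exact congrArg e (Fin.ext (by simp))
  · exact congrArg e (Fin.ext (by simp))

namespace IndPath

variable {n : ℕ} {f : ℕ → V}

lemma exists_embedding (h : IndPath G n f) {l r : ℕ} (hlr : l ≤ r) (hr : r ≤ n) :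
    ∃ e : SimpleGraph.pathGraph (r - l + 1) ↪g G, Set.range e = seg f l r ∧ e 0 = f l ∧
      e (Fin.last _) = f r := by
  refine ⟨⟨⟨fun i => f (l + i), ?_⟩, ?_⟩, ?_, ?_, ?_⟩
  · intro i j hij
    have := h.inj _ (by omega) _ (by omega) hij
    ext
    omega
  · intro i j
    change G.Adj (f (l + i)) (f (l + j)) ↔ _
    rw [h.adj _ (by omega) _ (by omega), SimpleGraph.pathGraph_adj]
    omega
  · ext v
    simp only [Set.mem_range, seg, Set.mem_image, Set.mem_Icc]
    constructor
    · rintro ⟨i, rfl⟩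
      exact ⟨l + i, ⟨by omega, by omega⟩, rfl⟩
    · rintro ⟨i, hi, rfl⟩
      refine ⟨⟨i - l, by omega⟩, ?_⟩
      change f (l + (i - l)) = f i
      congr 1
      omega
  · change f (l + 0) = f l
    rfl
  · change f (l + (r - l)) = f r
    congr 1
    omega

lemma isPathSet (h : IndPath G n f) {l r : ℕ} (hlr : l ≤ r) (hr : r ≤ n) :
    IsPathSet G (seg f l r) := by
  obtain ⟨e, he, -⟩ := h.exists_embedding hlr hr
  exact ⟨_, e, he⟩

lemma isInducedUWPath (h : IndPath G n f) {l r : ℕ} (hlr : l ≤ r) (hr : r ≤ n) (hU : f l ∈ U)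
    (hW : f r ∈ W) : IsInducedUWPath G U W (seg f l r) := by
  obtain ⟨e, he, h0, h1⟩ := h.exists_embedding hlr hr
  exact ⟨_, e, he, h0 ▸ hU, h1 ▸ hW⟩

lemma mem_seg_iff (h : IndPath G n f) {l r i : ℕ} (hr : r ≤ n) (hi : i ≤ n) :
    f i ∈ seg f l r ↔ l ≤ i ∧ i ≤ r := by
  constructor
  · rintro ⟨j, ⟨hj1, hj2⟩, hj⟩
    have := h.inj _ (hj2.trans hr) _ hi hj
    omega
  · exact fun hi => mem_seg hi.1 hi.2

lemma isTree_seg [Finite V] (h : IndPath G n f) {l r : ℕ} (hlr : l ≤ r) (hr : r ≤ n) :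
    (G.induce (seg f l r)).IsTree := by
  obtain ⟨k, rfl⟩ := Nat.exists_eq_add_of_le hlr
  clear hlr
  induction k with
  | zero =>
    have : seg f l (l + 0) = {f l} := by simp [seg]
    rw [this]
    exact isTree_singleton _
  | succ k ih =>
    have : seg f l (l + (k + 1)) = seg f l (l + k) ∪ {f (l + (k + 1))} := by
      ext v
      constructor
      · rintro ⟨i, ⟨h1, h2⟩, rfl⟩
        rcases Nat.lt_or_ge i (l + (k + 1)) with hi | hi
        · exact Or.inl (mem_seg h1 (by omega))
        · rw [show i = l + (k + 1) by omega]
          exact Or.inr rfl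
      · rintro (hv | rfl)
        · exact seg_subset le_rfl (by omega) hv
        · exact mem_seg (by omega) le_rfl
    rw [this]
    refine isTree_union (ih (by omega)) (isTree_singleton _) ?_ (mem_seg (by omega) le_rfl) rfl
      ((h.adj (l + k) (by omega) _ (by omega)).2 (by omega)) ?_
    · rw [Set.disjoint_singleton_right, h.mem_seg_iff (by omega) (by omega)]
      omega
    · rintro _ ⟨i, ⟨h1, h2⟩, rfl⟩ _ rfl hadj
      rw [h.adj _ (by omega) _ (by omega)] at hadj
      refine ⟨?_, rfl⟩
      congr 1
      omega

end IndPath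

lemma IsRung.exists_indPath (h : IsRung G U W R) : ∃ (n : ℕ) (f : ℕ → V), IndPath G n f ∧
    R = seg f 0 n ∧ (∀ i ≤ n, f i ∈ U ↔ i = 0) ∧ (∀ i ≤ n, f i ∈ W ↔ i = n) := by
  obtain ⟨n, e, hR, hU, hW⟩ := h.prop
  obtain ⟨f, hf, hfR, h0, hn⟩ := ThreeInATree.exists_indPath e
  rw [hR] at hfR
  subst hfR
  refine ⟨n, f, hf, rfl, fun i hi => ⟨fun hiU => ?_, ?_⟩, fun i hi => ⟨fun hiW => ?_, ?_⟩⟩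
  · have := h.2 (hf.isInducedUWPath hi le_rfl hiU (hn ▸ hW)) (seg_subset (Nat.zero_le _) le_rfl)
    have := (hf.mem_seg_iff le_rfl (Nat.zero_le _)).1 (this (mem_seg le_rfl (Nat.zero_le _)))
    omega
  · rintro rfl
    exact h0 ▸ hU
  · have := h.2 (hf.isInducedUWPath (Nat.zero_le _) hi (h0 ▸ hU) hiW) (seg_subset le_rfl hi)
    have := (hf.mem_seg_iff hi le_rfl).1 (this (mem_seg (Nat.zero_le _) le_rfl))
    omega
  · rintro rfl
    exact hn ▸ hW

lemma IsRung.isTree [Finite V] (h : IsRung G U W R) : (G.induce R).IsTree := by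
  obtain ⟨n, f, hf, rfl, -, -⟩ := h.exists_indPath
  exact hf.isTree_seg (Nat.zero_le _) le_rfl

lemma IsRung.inter_left (h : IsRung G U W R) : ∃ u, R ∩ U = {u} := by
  obtain ⟨n, f, hf, rfl, hU, -⟩ := h.exists_indPath
  refine ⟨f 0, Set.Subset.antisymm ?_ ?_⟩
  · rintro _ ⟨⟨i, ⟨-, hi⟩, rfl⟩, hiU⟩
    rw [(hU i hi).1 hiU]
    rfl
  · rintro _ rfl
    exact ⟨mem_seg le_rfl (Nat.zero_le _), (hU 0 (Nat.zero_le _)).2 rfl⟩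

lemma IsRung.inter_right (h : IsRung G U W R) : ∃ w, R ∩ W = {w} := by
  obtain ⟨n, f, hf, rfl, -, hW⟩ := h.exists_indPath
  refine ⟨f n, Set.Subset.antisymm ?_ ?_⟩
  · rintro _ ⟨⟨i, ⟨-, hi⟩, rfl⟩, hiW⟩
    rw [(hW i hi).1 hiW]
    rfl
  · rintro _ rfl
    exact ⟨mem_seg (Nat.zero_le _) le_rfl, (hW n le_rfl).2 rfl⟩

/-- The part of a rung between its `U`-end and one of its vertices. -/
lemma IsRung.exists_stub [Finite V] (h : IsRung G U W R) {x : V} (hx : x ∈ R) :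
    ∃ D ⊆ R, SConn G D ∧ x ∈ D ∧ (D ∩ U).Nonempty ∧ (x ∉ W → Disjoint D W) := by
  obtain ⟨n, f, hf, rfl, hU, hW⟩ := h.exists_indPath
  obtain ⟨i, ⟨-, hi⟩, rfl⟩ := hx
  refine ⟨seg f 0 i, seg_subset le_rfl hi, isTree_sconn (hf.isTree_seg (Nat.zero_le _) hi),
    mem_seg (Nat.zero_le _) le_rfl, ⟨f 0, mem_seg le_rfl (Nat.zero_le _),
      (hU 0 (Nat.zero_le _)).2 rfl⟩, fun hiW => ?_⟩
  rw [Set.disjoint_left]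
  rintro _ ⟨j, ⟨-, hj⟩, rfl⟩ hjW
  have := (hW j (hj.trans hi)).1 hjW
  exact hiW ((hW i hi).2 (by omega))

lemma IsRung.symm (h : IsRung G U W R) : IsRung G W U R := by
  have key : ∀ U W P, IsInducedUWPath G U W P → IsInducedUWPath G W U P := by
    rintro U W P ⟨n, e, rfl, h0, h1⟩
    let r : SimpleGraph.pathGraph (n + 1) ↪g SimpleGraph.pathGraph (n + 1) :=
      ⟨⟨Fin.rev, Fin.rev_injective⟩, by
        intro a b
        change (SimpleGraph.pathGraph (n + 1)).Adj a.rev b.rev ↔ _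
        rw [SimpleGraph.pathGraph_adj, SimpleGraph.pathGraph_adj, Fin.val_rev, Fin.val_rev]
        omega⟩
    refine ⟨n, e.comp r, ?_, ?_, ?_⟩
    · ext v
      constructor
      · rintro ⟨i, rfl⟩
        exact ⟨_, rfl⟩
      · rintro ⟨i, rfl⟩
        refine ⟨i.rev, ?_⟩
        change e (i.rev.rev) = e i
        rw [Fin.rev_rev]
    · change e (Fin.rev 0) ∈ W
      rwa [Fin.rev_zero]
    · change e (Fin.rev (Fin.last n)) ∈ U
      rwa [Fin.rev_last]
  exact ⟨key _ _ _ h.1, fun P hP hPR => h.2 (key _ _ _ hP) hPR⟩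

end Paths

open Graph

/-! ### Self-aiding nets -/

section SelfAiding

variable {V : Type*} {G : SimpleGraph V} {X : Set V} {H : Graph (Set V) (Set V)}

/-- The simple graph underlying a net. -/
def netGraph (H : Graph (Set V) (Set V)) : SimpleGraph (Set V) where
  Adj U W := U ≠ W ∧ H.Adj U W
  symm := ⟨fun _ _ h => ⟨h.1.symm, h.2.symm⟩⟩

lemma netGraph_adj_mem {U W : Set V} (h : (netGraph H).Adj U W) : U ∈ H.vertexSet ∧ W ∈ H.vertexSet :=
  ⟨h.2.left_mem, h.2.right_mem⟩

lemma IsNet.exists_leaves (hN : IsNet G X H) : ∃ L₁ L₂ L₃, IsLeafNode H L₁ ∧ IsLeafNode H L₂ ∧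
    IsLeafNode H L₃ ∧ L₁ ≠ L₂ ∧ L₁ ≠ L₃ ∧ L₂ ≠ L₃ ∧
      ∀ N, IsLeafNode H N → N = L₁ ∨ N = L₂ ∨ N = L₃ := by
  obtain ⟨L₁, L₂, L₃, h12, h13, h23, h⟩ := Set.ncard_eq_three.1 hN.leaf_card
  have hm : ∀ N, IsLeafNode H N ↔ N = L₁ ∨ N = L₂ ∨ N = L₃ := fun N => by
    have : N ∈ {N | IsLeafNode H N} ↔ N ∈ ({L₁, L₂, L₃} : Set (Set V)) := by rw [h]
    simpa using this
  exact ⟨L₁, L₂, L₃, (hm _).2 (by simp), (hm _).2 (by simp), (hm _).2 (by simp), h12, h13, h23,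
    fun N hN => (hm N).1 hN⟩

lemma IsLeafNode.mem {L : Set V} (h : IsLeafNode H L) : L ∈ H.vertexSet := by
  obtain ⟨e, he, -⟩ := h
  exact he.vertex_mem

lemma IsNet.exists_leaf_ne (hN : IsNet G X H) (U W : Set V) :
    ∃ L, IsLeafNode H L ∧ L ≠ U ∧ L ≠ W := by
  obtain ⟨L₁, L₂, L₃, h1, h2, h3, h12, h13, h23, -⟩ := hN.exists_leaves
  by_cases hU : L₁ = U
  · by_cases hW : L₂ = W
    · exact ⟨L₃, h3, fun h => h13 (hU.trans h.symm), fun h => h23 (hW.trans h.symm)⟩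
    · exact ⟨L₂, h2, fun h => h12 (hU.trans h.symm), hW⟩
  · by_cases hW : L₁ = W
    · by_cases hU' : L₂ = U
      · exact ⟨L₃, h3, fun h => h23 (hU'.trans h.symm), fun h => h13 (hW.trans h.symm)⟩
      · exact ⟨L₂, h2, hU', fun h => h12 (hW.trans h.symm)⟩
    · exact ⟨L₁, h1, hU, hW⟩

/-- In a self-aiding net, the arcs of a split component lie in a single arc. -/
lemma SelfAiding.chunk_subset_arc [Finite V] (hs : SelfAiding H) {U W C : Set V}
    (hC : IsChunk H U W C) : ∃ E ∈ H.edgeSet, C ⊆ E := by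
  obtain ⟨E, hCE, hE⟩ := (Set.toFinite {C | ∃ U W, IsChunk H U W C}).exists_le_maximal
    (a := C) ⟨U, W, hC⟩
  obtain ⟨U', W', hE'⟩ := hE.prop
  exact ⟨E, ((hs.isLink_iff E U' W').2 (Or.inl ⟨hE, hE'⟩)).edge_mem, hCE⟩

lemma IsNet.arc_eq (hN : IsNet G X H) {E E' : Set V} (hE : E ∈ H.edgeSet) (hE' : E' ∈ H.edgeSet)
    {v : V} (hv : v ∈ E) (hv' : v ∈ E') : E = E' := by
  by_contra hne
  exact Set.disjoint_left.1 (hN.arc_disjoint hE hE' hne) hv hv'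

lemma IsNet.subsingleton_of_chunk [Finite V] (hN : IsNet G X H) (hs : SelfAiding H) {U W : Set V}
    {𝒜 : Set (Set (Set V))} (h𝒜 : ∀ A ∈ 𝒜, IsSplitComponentArcs H U W A)
    {E E' : Set V} (hE : E ∈ H.edgeSet) (hE' : E' ∈ H.edgeSet) (hEA : E ∈ ⋃₀ 𝒜)
    (hEA' : E' ∈ ⋃₀ 𝒜) : E = E' := by
  obtain ⟨D, hD, hsub⟩ := hs.chunk_subset_arc (C := ⋃₀ ⋃₀ 𝒜) (U := U) (W := W)
    ⟨𝒜, by obtain ⟨A, hA, -⟩ := hEA; exact ⟨A, hA⟩, h𝒜, rfl⟩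
  have key : ∀ E ∈ H.edgeSet, E ∈ ⋃₀ 𝒜 → E = D := by
    intro E hE hEA
    obtain ⟨v, hv⟩ := hN.arc_nonempty E hE
    exact hN.arc_eq hE hD hv (hsub ⟨E, hEA, hv⟩)
  rw [key E hE hEA, key E' hE' hEA']

lemma IsNet.isLink_unique [Finite V] (hN : IsNet G X H) (hs : SelfAiding H) {E E' U W : Set V}
    (h : H.IsLink E U W) (h' : H.IsLink E' U W) : E = E' :=
  hN.subsingleton_of_chunk hs (U := U) (W := W) (𝒜 := {{E}, {E'}})
    (by
      rintro A (rfl | rfl)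
      · exact Or.inl ⟨E, h, rfl⟩
      · exact Or.inl ⟨E', h', rfl⟩)
    h.edge_mem h'.edge_mem ⟨{E}, by simp, rfl⟩ ⟨{E'}, by simp, rfl⟩

lemma IsNet.exists_inc (hN : IsNet G X H) {N : Set V} (h : N ∈ H.vertexSet) : ∃ E, H.Inc E N := by
  obtain ⟨L, hL, hLN, -⟩ := hN.exists_leaf_ne N N
  obtain ⟨p⟩ := hN.connected.preconnected ⟨N, h⟩ ⟨L, hL.mem⟩
  cases p with
  | nil => exact absurd rfl hLN
  | cons h p =>
    obtain ⟨-, E, hE⟩ := h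
    exact ⟨E, hE.inc_left⟩

/-- A leafless set of nodes can be left while avoiding any two nodes, core case. -/
lemma IsNet.exists_adj_of_distinct [Finite V] (hN : IsNet G X H) (hs : SelfAiding H) {U W : Set V}
    {C : Set (Set V)} (hC : C ⊆ H.vertexSet) (hne : C.Nonempty) (hUC : U ∉ C) (hWC : W ∉ C)
    (hleaf : ∀ N ∈ C, ¬ IsLeafNode H N) (hU : U ∈ H.vertexSet) (hW : W ∈ H.vertexSet)
    (hUW : U ≠ W) :
    ∃ x ∈ C, ∃ y, y ∉ C ∧ y ≠ U ∧ y ≠ W ∧ (netGraph H).Adj x y := by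
  by_contra hcon
  push Not at hcon
  obtain ⟨c, hc⟩ := hne
  set S : Set (Set V) := H.vertexSet \ {U, W} with hSdef
  have hcS : c ∈ S := ⟨hC hc, by
    rintro (rfl | h)
    · exact hUC hc
    · exact hWC (h ▸ hc)⟩
  set C₀ := comp (netGraph H) S c with hC₀
  have hcC₀ : c ∈ C₀ := mem_comp hcS
  have hCS : C ⊆ S := fun x hx => ⟨hC hx, by
    rintro (rfl | h)
    · exact hUC hx
    · exact hWC (h ▸ hx)⟩
  have hC₀C : C₀ ⊆ C := fun x hx => hx.2 C hCS hc fun u hu v hv huv => by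
    by_contra hvC
    exact hcon u hu v hvC (fun h => hv.2 (Or.inl h)) (fun h => hv.2 (Or.inr h)) huv
  have hC₀leaf : ∀ N ∈ C₀, ¬ IsLeafNode H N := fun N hN => hleaf N (hC₀C hN)
  have hC₀S : C₀ ⊆ S := comp_subset
  -- moving along an edge of `∇(H)` avoiding `U` and `W` does not leave `C₀`
  have hstep : ∀ e x y, (nabla H).IsLink e x y → x ∈ C₀ → x ≠ y → y ≠ U → y ≠ W → y ∈ C₀ := by
    rintro e x y (⟨E, -, hE⟩ | ⟨-, -, hx, -⟩) hxC hxy hyU hyW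
    · exact comp_closed x hxC y ⟨hE.right_mem, by rintro (h | h) <;> contradiction⟩ ⟨hxy, E, hE⟩
    · exact absurd hx (hC₀leaf x hxC)
  have hreach : ∀ K' : Graph (Set V) (Set V ⊕ Sym2 (Set V)), K' ≤ nabla H →
      ∀ x y : (K'.deleteVerts {U, W}).vertexSet, (K'.deleteVerts {U, W}).toSimpleGraph.Reachable x y →
        (x : Set V) ∈ C₀ → (y : Set V) ∈ C₀ := by
    rintro K' hK' x y ⟨p⟩
    induction p with
    | nil => exact id
    | @cons u v w h p ih =>
      intro hx
      refine ih ?_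
      obtain ⟨hne, e, he⟩ := h
      rw [Graph.deleteVerts_isLink] at he
      exact hstep e u v (hK'.isLink_mono he.1) hx (fun h => hne (Subtype.ext h))
        (fun h => he.2.2 (Or.inl h)) (fun h => he.2.2 (Or.inr h))
  have hcut : IsCutPair (nabla H) U W := by
    refine ⟨hU, hW, hUW, fun hpre => ?_⟩
    obtain ⟨L, hL, hLU, hLW⟩ := hN.exists_leaf_ne U W
    have h1 : c ∈ ((nabla H).deleteVerts {U, W}).vertexSet := by
      rw [Graph.vertexSet_deleteVerts]; exact hcS
    have h2 : L ∈ ((nabla H).deleteVerts {U, W}).vertexSet := by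
      rw [Graph.vertexSet_deleteVerts]
      exact ⟨hL.mem, by rintro (h | h) <;> contradiction⟩
    exact hC₀leaf L (hreach _ le_rfl ⟨c, h1⟩ ⟨L, h2⟩ (hpre _ _) hcC₀) hL
  set VS : Set (Set V) := C₀ ∪ {U, W} with hVS
  have hVSsub : VS ⊆ (nabla H).vertexSet := by
    rintro x (hx | rfl | hx)
    · exact (hC₀S hx).1
    · exact hU
    · exact (Set.mem_singleton_iff.1 hx) ▸ hW
  set K := ((nabla H).induce VS).deleteEdges {e | (nabla H).IsLink e U W} with hK
  have hKlink : ∀ e x y, K.IsLink e x y ↔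
      (nabla H).IsLink e x y ∧ x ∈ VS ∧ y ∈ VS ∧ ¬ (nabla H).IsLink e U W := by
    intro e x y
    simp only [hK, Graph.deleteEdges_isLink, Graph.induce_isLink, Set.mem_ofPred_eq]
    tauto
  have hKV : K.vertexSet = VS := by simp [hK]
  have hKle : K ≤ nabla H := Graph.deleteEdges_le.trans (Graph.induce_le hVSsub)
  have hmax : Maximal (IsUnsplitSubgraph (nabla H) U W) K := by
    refine ⟨⟨hKle, by rw [hKV]; simp [hVS], by rw [hKV]; simp [hVS], ?_, ?_⟩, ?_⟩
    · rintro ⟨e, he⟩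
      rw [hKlink] at he
      exact he.2.2.2 he.1
    · rintro ⟨-, -, -, hnot⟩
      apply hnot
      have hmem : ∀ v, v ∈ (K.deleteVerts {U, W}).vertexSet ↔ v ∈ C₀ := by
        intro v
        rw [Graph.vertexSet_deleteVerts, hKV]
        constructor
        · rintro ⟨h | h, h'⟩
          · exact h
          · exact absurd h h'
        · exact fun h => ⟨Or.inl h, (hC₀S h).2⟩
      rintro ⟨a, ha⟩ ⟨b, hb⟩
      have hcl := comp_sconn (G := netGraph H) hcS {y | ∃ hy : y ∈ C₀,
        (K.deleteVerts {U, W}).toSimpleGraph.Reachable ⟨a, ha⟩ ⟨y, (hmem y).2 hy⟩} (fun _ h => h.1)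
        ⟨a, (hmem a).1 ha, SimpleGraph.Reachable.refl _⟩ (by
          rintro u ⟨hu, hr⟩ v hv huv
          refine ⟨hv, hr.trans (SimpleGraph.Adj.reachable ?_)⟩
          obtain ⟨hne, E, hE⟩ := huv
          refine ⟨fun h => hne (congrArg Subtype.val h), Sum.inl E, ?_⟩
          rw [Graph.deleteVerts_isLink, hKlink]
          refine ⟨⟨Or.inl ⟨E, rfl, hE⟩, Or.inl hu, Or.inl hv, ?_⟩, (hC₀S hu).2, (hC₀S hv).2⟩
          rintro (⟨E', h, hE'⟩ | ⟨h, -⟩)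
          · cases h
            rcases hE.left_eq_or_eq hE' with h | h
            · exact (hC₀S hu).2 (Or.inl h)
            · exact (hC₀S hu).2 (Or.inr h)
          · cases h)
      exact (hcl ((hmem b).1 hb)).2
    · rintro K' ⟨hK'le, hUK', hWK', hnadj, hncut⟩ hKK'
      have hpre : (K'.deleteVerts {U, W}).toSimpleGraph.Preconnected := by
        by_contra hnp
        exact hncut ⟨hUK', hWK', hUW, hnp⟩
      have hV' : K'.vertexSet ⊆ VS := by
        intro v hv
        by_cases hvUW : v ∈ ({U, W} : Set (Set V))
        · exact Or.inr hvUW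
        · left
          have h1 : c ∈ (K'.deleteVerts {U, W}).vertexSet := by
            rw [Graph.vertexSet_deleteVerts]
            exact ⟨hKK'.vertexSet_mono (by rw [hKV]; exact Or.inl hcC₀), hcS.2⟩
          have h2 : v ∈ (K'.deleteVerts {U, W}).vertexSet := by
            rw [Graph.vertexSet_deleteVerts]
            exact ⟨hv, hvUW⟩
          exact hreach K' hK'le ⟨c, h1⟩ ⟨v, h2⟩ (hpre _ _) hcC₀
      refine ⟨by rw [hKV]; exact hV', fun e x y he => ?_⟩
      rw [hKlink]
      refine ⟨hK'le.isLink_mono he, hV' he.left_mem, hV' he.right_mem, fun h => ?_⟩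
      exact hnadj ⟨e, (hK'le.isLink_iff he.edge_mem).2 h⟩
  have hinr : ∀ s, Sum.inr s ∉ K.edgeSet := by
    intro s hs'
    obtain ⟨x, y, hxy⟩ := exists_isLink_of_mem_edgeSet hs'
    rw [hKlink] at hxy
    obtain ⟨hl, hx, hy, hn⟩ := hxy
    have hl' := hl
    rcases hl with ⟨E, h, -⟩ | ⟨h, hne, hxl, hyl⟩
    · cases h
    · have hx' : x ∈ ({U, W} : Set (Set V)) := hx.resolve_left fun h => hC₀leaf x h hxl
      have hy' : y ∈ ({U, W} : Set (Set V)) := hy.resolve_left fun h => hC₀leaf y h hyl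
      simp only [Set.mem_insert_iff, Set.mem_singleton_iff] at hx' hy'
      rcases hx' with rfl | rfl <;> rcases hy' with rfl | rfl
      · exact hne rfl
      · exact hn hl'
      · exact hn hl'.symm
      · exact hne rfl
  have hsplit : IsSplitComponentArcs H U W {E | Sum.inl E ∈ K.edgeSet} :=
    Or.inr ⟨hcut, K, hmax, hinr, rfl⟩
  have harc : ∀ E, H.Inc E c → Sum.inl E ∈ K.edgeSet := by
    rintro E ⟨y, hy⟩
    have hcy : c ≠ y := hN.loopless E c y hy
    have : K.IsLink (Sum.inl E) c y := by
      rw [hKlink]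
      refine ⟨Or.inl ⟨E, rfl, hy⟩, Or.inl hcC₀, ?_, ?_⟩
      · by_cases hyUW : y ∈ ({U, W} : Set (Set V))
        · exact Or.inr hyUW
        · exact Or.inl (hstep (Sum.inl E) c y (Or.inl ⟨E, rfl, hy⟩) hcC₀ hcy
            (fun h => hyUW (Or.inl h)) (fun h => hyUW (Or.inr h)))
      · rintro (⟨E', h, hE'⟩ | ⟨h, -⟩)
        · cases h
          rcases hy.left_eq_or_eq hE' with h | h
          · exact hcS.2 (Or.inl h)
          · exact hcS.2 (Or.inr h)
        · cases h
    exact this.edge_mem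
  obtain ⟨E, hE⟩ := hN.exists_inc (hC hc)
  refine hleaf c hc ⟨E, hE, fun E' hE' => ?_⟩
  exact hN.subsingleton_of_chunk hs (𝒜 := {{E | Sum.inl E ∈ K.edgeSet}})
    (by rintro A rfl; exact hsplit) hE'.edge_mem hE.edge_mem
    ⟨_, rfl, harc E' hE'⟩ ⟨_, rfl, harc E hE⟩

/-- The properties of a self-aiding net used below: no parallel arcs, and a leafless set of nodes
can be left while avoiding any two given nodes. -/
structure TightNet (G : SimpleGraph V) (X : Set V) (H : Graph (Set V) (Set V)) : Prop
    extends IsNet G X H where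
  simple : ∀ {E E' U W : Set V}, H.IsLink E U W → H.IsLink E' U W → E = E'
  exists_adj : ∀ (U W : Set V) (C : Set (Set V)), C ⊆ H.vertexSet → C.Nonempty → U ∉ C → W ∉ C →
    (∀ N ∈ C, ¬ IsLeafNode H N) → ∃ x ∈ C, ∃ y, y ∉ C ∧ y ≠ U ∧ y ≠ W ∧ (netGraph H).Adj x y

lemma IsNet.tightNet [Finite V] (hN : IsNet G X H) (hs : SelfAiding H) : TightNet G X H where
  toIsNet := hN
  simple := hN.isLink_unique hs
  exists_adj := by
    intro U W C hC hne hUC hWC hleaf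
    have h1 : ∃ U' ∈ H.vertexSet, U' ∉ C ∧ (U ∈ H.vertexSet → U' = U) := by
      by_cases hU : U ∈ H.vertexSet
      · exact ⟨U, hU, hUC, fun _ => rfl⟩
      · obtain ⟨L, hL, -⟩ := hN.exists_leaf_ne U U
        exact ⟨L, hL.mem, fun h => hleaf L h hL, fun h => absurd h hU⟩
    obtain ⟨U', hU', hU'C, hUU'⟩ := h1
    have h2 : ∃ W' ∈ H.vertexSet, W' ∉ C ∧ U' ≠ W' ∧ (W ∈ H.vertexSet → W = U' ∨ W' = W) := by
      by_cases hW : W ∈ H.vertexSet ∧ U' ≠ W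
      · exact ⟨W, hW.1, hWC, hW.2, fun _ => Or.inr rfl⟩
      · obtain ⟨L, hL, hLU, -⟩ := hN.exists_leaf_ne U' U'
        exact ⟨L, hL.mem, fun h => hleaf L h hL, hLU.symm, fun h => by
          left; by_contra hne; exact hW ⟨h, fun h => hne h.symm⟩⟩
    obtain ⟨W', hW', hW'C, hne', hWW'⟩ := h2
    obtain ⟨x, hx, y, hyC, hyU, hyW, hxy⟩ :=
      hN.exists_adj_of_distinct hs hC hne hU'C hW'C hleaf hU' hW' hne'
    have hyN := (netGraph_adj_mem hxy).2
    refine ⟨x, hx, y, hyC, ?_, ?_, hxy⟩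
    · rintro rfl
      exact hyU (hUU' hyN).symm
    · rintro rfl
      rcases hWW' hyN with h | h
      · exact hyU h
      · exact hyW h.symm

end SelfAiding

/-! ### Footprints of vertex sets in a net -/

section Foot

variable {V : Type*} {G : SimpleGraph V} {X F : Set V} {H : Graph (Set V) (Set V)}

namespace IsNet

lemma exists_link (hN : IsNet G X H) {v : V} (hv : v ∈ X) : ∃ E p q, H.IsLink E p q ∧ v ∈ E := by
  rw [← hN.arc_cover] at hv
  obtain ⟨E, hE, hvE⟩ := hv
  obtain ⟨p, q, h⟩ := exists_isLink_of_mem_edgeSet hE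
  exact ⟨E, p, q, h, hvE⟩

lemma arc_subset (hN : IsNet G X H) {E : Set V} (hE : E ∈ H.edgeSet) : E ⊆ X := by
  rw [← hN.arc_cover]
  exact Set.subset_sUnion_of_mem hE

lemma inc_of_mem (hN : IsNet G X H) {E N : Set V} {v : V} (hE : E ∈ H.edgeSet) (hv : v ∈ E)
    (hvN : v ∈ N) (hNH : N ∈ H.vertexSet) : H.Inc E N :=
  (hN.meets_iff E hE N hNH).1 ⟨v, hv, hvN⟩

lemma end_of_mem (hN : IsNet G X H) {E p q N : Set V} {v : V} (h : H.IsLink E p q) (hv : v ∈ E)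
    (hvN : v ∈ N) (hNH : N ∈ H.vertexSet) : N = p ∨ N = q :=
  (hN.inc_of_mem h.edge_mem hv hvN hNH).eq_or_eq_of_isLink h

lemma adj_of_mem (hN : IsNet G X H) {E E' N : Set V} {u v : V} (hE : E ∈ H.edgeSet)
    (hE' : E' ∈ H.edgeSet) (hne : E ≠ E') (hu : u ∈ E) (hv : v ∈ E') (huN : u ∈ N) (hvN : v ∈ N)
    (hNH : N ∈ H.vertexSet) : G.Adj u v :=
  (hN.adj_iff E hE E' hE' hne u hu v hv).2
    ⟨N, hN.inc_of_mem hE hu huN hNH, hN.inc_of_mem hE' hv hvN hNH, huN, hvN⟩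

lemma exists_node (hN : IsNet G X H) {E E' : Set V} {u v : V} (hE : E ∈ H.edgeSet)
    (hE' : E' ∈ H.edgeSet) (hne : E ≠ E') (hu : u ∈ E) (hv : v ∈ E') (h : G.Adj u v) :
    ∃ N ∈ H.vertexSet, u ∈ N ∧ v ∈ N := by
  obtain ⟨N, h1, -, h3, h4⟩ := (hN.adj_iff E hE E' hE' hne u hu v hv).1 h
  exact ⟨N, h1.vertex_mem, h3, h4⟩

lemma exists_mem (hN : IsNet G X H) {E p q : Set V} (h : H.IsLink E p q) : ∃ v ∈ E, v ∈ p :=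
  (hN.meets_iff E h.edge_mem p h.left_mem).2 h.inc_left

end IsNet

/-- `Z ⊆ X` touches only nodes in `D`, and an arc meeting `Z` either has both ends in `D`, or
lies in `𝓔` and has an end in `D`. -/
structure Foot (H : Graph (Set V) (Set V)) (X Z : Set V) (D 𝓔 : Set (Set V)) : Prop where
  subset : Z ⊆ X
  node : ∀ N ∈ H.vertexSet, ∀ v ∈ Z, v ∈ N → N ∈ D
  arc : ∀ E ∈ H.edgeSet, ∀ v ∈ Z, v ∈ E →
    (∀ N, H.Inc E N → N ∈ D) ∨ (E ∈ 𝓔 ∧ ∃ N ∈ D, H.Inc E N)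

/-- The vertices in arcs with both ends in `M`. -/
def inArcs (H : Graph (Set V) (Set V)) (M : Set (Set V)) : Set V :=
  {v | ∃ E p q, H.IsLink E p q ∧ p ∈ M ∧ q ∈ M ∧ v ∈ E}

variable {Z Z' T T' : Set V} {D D' 𝓔 𝓔' M M' : Set (Set V)}

lemma inArcs_mono (h : M ⊆ M') : inArcs H M ⊆ inArcs H M' := by
  rintro v ⟨E, p, q, hl, hp, hq, hv⟩
  exact ⟨E, p, q, hl, h hp, h hq, hv⟩

lemma Foot.mono (h : Foot H X Z D 𝓔) (hD : D ⊆ D') (hE : 𝓔 ⊆ 𝓔') : Foot H X Z D' 𝓔' where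
  subset := h.subset
  node N hN v hv hvN := hD (h.node N hN v hv hvN)
  arc E hEH v hv hvE := by
    rcases h.arc E hEH v hv hvE with h' | ⟨h1, N, h2, h3⟩
    · exact Or.inl fun N hN => hD (h' N hN)
    · exact Or.inr ⟨hE h1, N, hD h2, h3⟩

lemma Foot.union (h : Foot H X Z D 𝓔) (h' : Foot H X Z' D 𝓔) : Foot H X (Z ∪ Z') D 𝓔 where
  subset := Set.union_subset h.subset h'.subset
  node N hN v hv hvN := hv.elim (fun hv => h.node N hN v hv hvN) (fun hv => h'.node N hN v hv hvN)
  arc E hE v hv hvE := hv.elim (fun hv => h.arc E hE v hv hvE) (fun hv => h'.arc E hE v hv hvE)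

lemma Foot.separated (hN : IsNet G X H) (h : Foot H X Z D 𝓔) (h' : Foot H X Z' D' 𝓔')
    (hD : Disjoint D D') (hE : Disjoint 𝓔 𝓔') : Separated G Z Z' := by
  rw [Set.disjoint_left] at hD hE
  have key : ∀ E ∈ H.edgeSet, ∀ u ∈ Z, ∀ v ∈ Z', u ∈ E → v ∈ E → False := by
    intro E hEH u hu v hv huE hvE
    obtain ⟨p, q, hl⟩ := exists_isLink_of_mem_edgeSet hEH
    rcases h.arc E hEH u hu huE with h1 | ⟨h1, N, h2, h3⟩
    · rcases h'.arc E hEH v hv hvE with h1' | ⟨-, N, h2, h3⟩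
      · exact hD (h1 p hl.inc_left) (h1' p hl.inc_left)
      · exact hD (h1 N h3) h2
    · rcases h'.arc E hEH v hv hvE with h1' | ⟨h1', -⟩
      · exact hD h2 (h1' N h3)
      · exact hE h1 h1'
  refine ⟨?_, ?_⟩
  · rw [Set.disjoint_left]
    intro u hu hu'
    obtain ⟨E, p, q, hl, huE⟩ := hN.exists_link (h.subset hu)
    exact key E hl.edge_mem u hu u hu' huE huE
  · intro u hu v hv huv
    obtain ⟨E, p, q, hl, huE⟩ := hN.exists_link (h.subset hu)
    obtain ⟨E', p', q', hl', hvE⟩ := hN.exists_link (h'.subset hv)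
    have hne : E ≠ E' := by
      rintro rfl
      exact key E hl.edge_mem u hu v hv huE hvE
    obtain ⟨N, hNH, huN, hvN⟩ := hN.exists_node hl.edge_mem hl'.edge_mem hne huE hvE huv
    exact hD (h.node N hNH u hu huN) (h'.node N hNH v hv hvN)

lemma Foot.of_subset_inArcs (hN : IsNet G X H) (h : Z ⊆ inArcs H M) : Foot H X Z M ∅ where
  subset v hv := by
    obtain ⟨E, p, q, hl, -, -, hvE⟩ := h hv
    exact hN.arc_subset hl.edge_mem hvE
  node N hNH v hv hvN := by
    obtain ⟨E, p, q, hl, hp, hq, hvE⟩ := h hv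
    rcases hN.end_of_mem hl hvE hvN hNH with rfl | rfl <;> assumption
  arc E hE v hv hvE := by
    obtain ⟨E', p, q, hl, hp, hq, hvE'⟩ := h hv
    obtain rfl := hN.arc_eq hE hl.edge_mem hvE hvE'
    exact Or.inl fun N hNE => by
      rcases hNE.eq_or_eq_of_isLink hl with rfl | rfl <;> assumption

lemma Foot.of_subset_arc (hN : IsNet G X H) {E p q : Set V} (hl : H.IsLink E p q) (hZ : Z ⊆ E)
    (hp : p ∈ D) (hq : ∀ v ∈ Z, v ∈ q → q ∈ D) : Foot H X Z D {E} where
  subset := hZ.trans (hN.arc_subset hl.edge_mem)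
  node N hNH v hv hvN := by
    rcases hN.end_of_mem hl (hZ hv) hvN hNH with rfl | rfl
    · exact hp
    · exact hq v hv hvN
  arc E' hE' _ hv hvE := by
    obtain rfl := hN.arc_eq hE' hl.edge_mem hvE (hZ hv)
    exact Or.inr ⟨rfl, p, hp, hl.inc_left⟩

lemma Foot.of_subset_arc_of_mem (hN : IsNet G X H) {E p q : Set V} (hl : H.IsLink E p q)
    (hZ : Z ⊆ E) (hp : p ∈ D) (hq : q ∈ D) : Foot H X Z D ∅ :=
  Foot.of_subset_inArcs hN (M := D) fun _ hv => ⟨E, p, q, hl, hp, hq, hZ hv⟩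

/-- Two trees with no common arc and one common node `x`, at which both have a single vertex. -/
lemma IsNet.isTree_join [Finite V] (hN : IsNet G X H) (hT : (G.induce T).IsTree)
    (hT' : (G.induce T').IsTree) (hTX : T ⊆ X) (hTX' : T' ⊆ X)
    (harc : ∀ E ∈ H.edgeSet, ∀ u ∈ T, ∀ v ∈ T', u ∈ E → v ∈ E → False) {x : Set V}
    (hx : x ∈ H.vertexSet)
    (hnode : ∀ N ∈ H.vertexSet, ∀ u ∈ T, ∀ v ∈ T', u ∈ N → v ∈ N → N = x)
    {a b : V} (ha : T ∩ x = {a}) (hb : T' ∩ x = {b}) : (G.induce (T ∪ T')).IsTree := by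
  have haT : a ∈ T ∩ x := ha ▸ rfl
  have hbT : b ∈ T' ∩ x := hb ▸ rfl
  have hne : ∀ E ∈ H.edgeSet, ∀ E' ∈ H.edgeSet, ∀ u ∈ T, ∀ v ∈ T', u ∈ E → v ∈ E' → E ≠ E' := by
    rintro E hE E' - u hu v hv huE hvE rfl
    exact harc E hE u hu v hv huE hvE
  refine isTree_union hT hT' ?_ haT.1 hbT.1 ?_ ?_
  · rw [Set.disjoint_left]
    intro u hu hu'
    obtain ⟨E, p, q, hl, huE⟩ := hN.exists_link (hTX hu)
    exact harc E hl.edge_mem u hu u hu' huE huE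
  · obtain ⟨E, p, q, hl, hE⟩ := hN.exists_link (hTX haT.1)
    obtain ⟨E', p', q', hl', hE'⟩ := hN.exists_link (hTX' hbT.1)
    exact hN.adj_of_mem hl.edge_mem hl'.edge_mem
      (hne _ hl.edge_mem _ hl'.edge_mem _ haT.1 _ hbT.1 hE hE') hE hE' haT.2 hbT.2 hx
  · intro u hu v hv huv
    obtain ⟨E, p, q, hl, hE⟩ := hN.exists_link (hTX hu)
    obtain ⟨E', p', q', hl', hE'⟩ := hN.exists_link (hTX' hv)
    obtain ⟨N, hNH, huN, hvN⟩ := hN.exists_node hl.edge_mem hl'.edge_mem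
      (hne _ hl.edge_mem _ hl'.edge_mem _ hu _ hv hE hE') hE hE' huv
    obtain rfl := hnode N hNH u hu v hv huN hvN
    have h1 : u ∈ T ∩ N := ⟨hu, huN⟩
    have h2 : v ∈ T' ∩ N := ⟨hv, hvN⟩
    rw [ha] at h1
    rw [hb] at h2
    exact ⟨h1, h2⟩

/-- A leaf node consists of one vertex, which is a leaf of `G` and has its neighbor in `X`. -/
lemma IsNet.leaf_spec [Finite V] (hN : IsNet G X H) {L : Set V} (hL : IsLeafNode H L) :
    ∃ v, L = {v} ∧ IsLeaf G v ∧ ∃ w ∈ X, G.Adj v w := by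
  obtain ⟨v, hv, rfl⟩ := hN.leaf_single L hL
  refine ⟨v, rfl, hv, ?_⟩
  obtain ⟨E, ⟨m, hE⟩, huniq⟩ := hL
  obtain ⟨v', hvE, rfl⟩ := hN.exists_mem hE
  obtain ⟨R, hRE, hvR, hR⟩ := hN.exists_rung _ _ _ hE _ hvE
  obtain ⟨n, f, hf, rfl, hU, hW⟩ := hR.exists_indPath
  have h0 : f 0 = v' := (hU 0 (Nat.zero_le _)).2 rfl
  rcases Nat.eq_zero_or_pos n with rfl | hn
  · have hvm : v' ∈ m := h0 ▸ (hW 0 le_rfl).2 rfl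
    have hm : ¬ IsLeafNode H m := by
      intro hm
      obtain ⟨w, -, rfl⟩ := hN.leaf_single m hm
      exact hN.loopless _ _ _ hE (by rw [Set.mem_singleton_iff.1 hvm])
    obtain ⟨E', hE', hne⟩ : ∃ E', H.Inc E' m ∧ E' ≠ E := by
      by_contra hcon
      push Not at hcon
      exact hm ⟨E, hE.inc_right, hcon⟩
    obtain ⟨w, hwE, hwm⟩ := (hN.meets_iff E' hE'.edge_mem m hE.right_mem).2 hE'
    exact ⟨w, hN.arc_subset hE'.edge_mem hwE,
      hN.adj_of_mem hE.edge_mem hE'.edge_mem hne.symm hvE hwE hvm hwm hE.right_mem⟩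
  · refine ⟨f 1, hN.arc_subset hE.edge_mem (hRE (mem_seg (by omega) hn)), ?_⟩
    rw [← h0, hf.adj 0 (by omega) 1 hn]
    omega

/-- Along a path of nodes from `u` to a leaf node `L ≠ u` runs a tree meeting `u` once. -/
lemma IsNet.exists_strand_walk [Finite V] (hN : IsNet G X H) {L : Set V} (hL : IsLeafNode H L) :
    ∀ {u : Set V} (p : (netGraph H).Walk u L), p.IsPath → u ≠ L →
      ∃ T ⊆ inArcs H {N | N ∈ p.support}, (G.induce T).IsTree ∧ L ⊆ T ∧ ∃ v, T ∩ u = {v} := by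
  intro u p
  induction p with
  | nil => exact fun _ h => absurd rfl h
  | @cons u x L h p ih =>
    intro hp huL
    rw [SimpleGraph.Walk.cons_isPath_iff] at hp
    obtain ⟨hp, hup⟩ := hp
    obtain ⟨hux, g, hg⟩ := id h
    obtain ⟨w, hw, -⟩ := hN.exists_mem hg
    obtain ⟨R, hRg, -, hR⟩ := hN.exists_rung _ _ _ hg w hw
    have hRin : R ⊆ inArcs H {N | N ∈ (SimpleGraph.Walk.cons h p).support} := fun v hv =>
      ⟨g, u, x, hg, SimpleGraph.Walk.start_mem_support _,
        List.mem_cons_of_mem _ p.start_mem_support, hRg hv⟩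
    by_cases hxL : x = L
    · subst hxL
      refine ⟨R, hRin, hR.isTree, ?_, hR.inter_left⟩
      obtain ⟨v, rfl, -⟩ := hN.leaf_spec hL
      obtain ⟨w', hw'⟩ := hR.inter_right
      have : w' ∈ R ∩ {v} := hw' ▸ rfl
      rintro _ rfl
      exact (Set.mem_singleton_iff.1 this.2) ▸ this.1
    · obtain ⟨T, hTin, hT, hLT, v, hv⟩ := ih hL hp hxL
      have hTf := Foot.of_subset_inArcs hN hTin
      obtain ⟨b, hb⟩ := hR.inter_right
      obtain ⟨a, ha⟩ := hR.inter_left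
      have hTu : ∀ w ∈ T, w ∉ u := fun w hw hwu => hup (hTf.node u hg.left_mem w hw hwu)
      refine ⟨R ∪ T, Set.union_subset hRin (hTin.trans (inArcs_mono ?_)), ?_,
        hLT.trans Set.subset_union_right, a, ?_⟩
      · exact fun N hN' => List.mem_cons_of_mem _ hN'
      · refine hN.isTree_join hR.isTree hT (hRg.trans (hN.arc_subset hg.edge_mem)) hTf.subset
          ?_ hg.right_mem ?_ hb hv
        · intro E hE r hr t ht hrE htE
          obtain rfl := hN.arc_eq hE hg.edge_mem hrE (hRg hr)
          rcases hTf.arc E hE t ht htE with h | ⟨h, -⟩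
          · exact hup (h u hg.inc_left)
          · exact h
        · intro N hNH r hr t ht hrN htN
          rcases hN.end_of_mem hg (hRg hr) hrN hNH with rfl | rfl
          · exact absurd htN (hTu t ht)
          · rfl
      · rw [Set.union_inter_distrib_right, ha]
        have : T ∩ u = ∅ := by
          ext w
          simp only [Set.mem_inter_iff, Set.mem_empty_iff_false, iff_false, not_and]
          exact hTu w
        rw [this, Set.union_empty]

/-- A leaf node `L` is joined to the node `x` by a tree in `inArcs H M` that avoids `F`. -/
def Free (G : SimpleGraph V) (H : Graph (Set V) (Set V)) (F : Set V) (M : Set (Set V))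
    (L x : Set V) : Prop :=
  x = L ∨ ∃ T ⊆ inArcs H M, (G.induce T).IsTree ∧ L ⊆ T ∧ (∃ v, T ∩ x = {v}) ∧ Disjoint T F

lemma IsNet.free [Finite V] (hN : IsNet G X H) {L x : Set V} (hL : IsLeafNode H L)
    (hM : SConn (netGraph H) M) (hLM : L ∈ M) (hxM : x ∈ M) (hF : Disjoint (inArcs H M) F) :
    Free G H F M L x := by
  by_cases hxL : x = L
  · exact Or.inl hxL
  · obtain ⟨p, hp, hpM⟩ := hM.exists_path hxM hLM
    obtain ⟨T, hT, h1, h2, h3⟩ := hN.exists_strand_walk hL p hp hxL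
    have hT' : T ⊆ inArcs H M := hT.trans (inArcs_mono fun N hN => hpM N hN)
    exact Or.inr ⟨T, hT', h1, h2, h3, hF.mono_left hT'⟩

/-- Extend a tree that meets a node `x` once to a leaf node, through `inArcs H M`. -/
lemma IsNet.attach [Finite V] (hN : IsNet G X H) {L x B : Set V} (hL : IsLeafNode H L)
    (hfree : Free G H F M L x) (hx : x ∈ H.vertexSet)
    (hB : (G.induce B).IsTree) {b : V} (hb : B ∩ x = {b}) (hBX : B ⊆ X)
    (harc : ∀ E p q, H.IsLink E p q → ∀ v ∈ B, v ∈ E → p ∈ M → q ∉ M)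
    (hnode : ∀ N ∈ H.vertexSet, ∀ v ∈ B, v ∈ N → N ∈ M → N = x) :
    ∃ B', B ⊆ B' ∧ (G.induce B').IsTree ∧ L ⊆ B' ∧ ∃ T ⊆ inArcs H M, Disjoint T F ∧ B' = B ∪ T := by
  rcases hfree with rfl | ⟨T, hTM, hT, hLT, ⟨v, hv⟩, hTF⟩
  · refine ⟨B, le_rfl, hB, ?_, ∅, Set.empty_subset _, Set.empty_disjoint _, by simp⟩
    obtain ⟨v, rfl, -⟩ := hN.leaf_spec hL
    have : b ∈ B ∩ {v} := hb ▸ rfl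
    rintro _ rfl
    exact (Set.mem_singleton_iff.1 this.2) ▸ this.1
  · refine ⟨B ∪ T, Set.subset_union_left, ?_, hLT.trans Set.subset_union_right, T, hTM, hTF, rfl⟩
    have hTf := Foot.of_subset_inArcs hN hTM
    refine hN.isTree_join hB hT hBX hTf.subset ?_ hx ?_ hb hv
    · intro E hE r hr t ht hrE htE
      obtain ⟨p, q, hl⟩ := exists_isLink_of_mem_edgeSet hE
      rcases hTf.arc E hE t ht htE with h | ⟨h, -⟩
      · exact harc E p q hl r hr hrE (h p hl.inc_left) (h q hl.inc_right)
      · exact h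
    · intro N hNH r hr t ht hrN htN
      exact hnode N hNH r hr hrN (hTf.node N hNH t ht htN)

end Foot

/-! ### Separated sets and saplings through `Y` -/

section Rules

variable {V : Type*} {G : SimpleGraph V} {X Y : Set V} {H : Graph (Set V) (Set V)}

lemma Separated.symm {P Q : Set V} (h : Separated G P Q) : Separated G Q P :=
  ⟨h.1.symm, fun q hq p hp hqp => h.2 p hp q hq hqp.symm⟩

lemma Separated.mono {P Q P' Q' : Set V} (h : Separated G P Q) (hP : P' ⊆ P) (hQ : Q' ⊆ Q) :
    Separated G P' Q' :=
  ⟨h.1.mono hP hQ, fun p hp q hq => h.2 p (hP hp) q (hQ hq)⟩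

lemma Separated.union_right {P Q R : Set V} (h : Separated G P Q) (h' : Separated G P R) :
    Separated G P (Q ∪ R) :=
  ⟨Set.disjoint_union_right.2 ⟨h.1, h'.1⟩, fun p hp q hq =>
    hq.elim (fun hq => h.2 p hp q hq) (fun hq => h'.2 p hp q hq)⟩

lemma Separated.union_left {P Q R : Set V} (h : Separated G P R) (h' : Separated G Q R) :
    Separated G (P ∪ Q) R := (h.symm.union_right h'.symm).symm

lemma separated_empty {P : Set V} : Separated G P ∅ := ⟨Set.disjoint_empty _, by simp⟩

/-- A self-aiding net with a wild set `Y` such that `G[X ∪ Y]` contains no sapling. -/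
structure Ctx (G : SimpleGraph V) (X : Set V) (H : Graph (Set V) (Set V)) (Y : Set V) : Prop where
  net : TightNet G X H
  leaf : ∀ v, IsLeaf G v → IsLeafNode H {v}
  wild : Wild G X H Y
  no_sapling : ¬ ∃ T ⊆ X ∪ Y, IsSapling G T

lemma leaf_eq [Finite V] (hN : IsNet G X H) {L : Fin 3 → Set V}
    (hL : ∀ i, IsLeafNode H (L i)) (hinj : Function.Injective L) {N : Set V}
    (hNl : IsLeafNode H N) : ∃ i, N = L i := by
  have h1 : Set.range L ⊆ {N | IsLeafNode H N} := by
    rintro _ ⟨i, rfl⟩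
    exact hL i
  have h2 : (Set.range L).ncard = 3 := by
    rw [← Nat.card_coe_set_eq, Nat.card_range_of_injective hinj, Nat.card_fin]
  have h3 := Set.eq_of_subset_of_ncard_le h1 (by rw [hN.leaf_card, h2]) (Set.toFinite _)
  have : N ∈ Set.range L := h3 ▸ hNl
  obtain ⟨i, rfl⟩ := this
  exact ⟨i, rfl⟩

lemma Ctx.not_tree [Finite V] (hc : Ctx G X H Y) {L : Fin 3 → Set V}
    (hL : ∀ i, IsLeafNode H (L i)) (hinj : Function.Injective L) {T : Set V} (hT : T ⊆ X ∪ Y)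
    (htree : (G.induce T).IsTree) (hLT : ∀ i, L i ⊆ T) : False := by
  refine hc.no_sapling ⟨T, hT, htree, fun v hv => ?_⟩
  obtain ⟨i, hi⟩ := leaf_eq hc.net.toIsNet hL hinj (hc.leaf v hv)
  exact hLT i (hi ▸ rfl)

lemma Ctx.exists_indPath (hc : Ctx G X H Y) : ∃ n f, IndPath G n f ∧ Y = seg f 0 n := by
  obtain ⟨n, e, he⟩ := hc.wild.prop.2.1
  obtain ⟨f, hf, hY, -⟩ := ThreeInATree.exists_indPath e
  exact ⟨n, f, hf, he ▸ hY⟩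

lemma Ctx.tamed_seg (hc : Ctx G X H Y) {n : ℕ} {f : ℕ → V} (hf : IndPath G n f)
    (hY : Y = seg f 0 n) {l r : ℕ} (hlr : l ≤ r) (hr : r ≤ n) (hne : 0 < l ∨ r < n) :
    Tamed H (nbrIn G X (seg f l r)) := by
  by_contra hcon
  have hsub : seg f l r ⊆ Y := hY ▸ seg_subset (Nat.zero_le _) hr
  have := hc.wild.2 ⟨hc.wild.prop.1.mono_left hsub, hf.isPathSet hlr hr, hcon⟩ hsub
  rw [hY] at this
  rcases hne with h | h
  · have := (hf.mem_seg_iff hr (Nat.zero_le _)).1 (this (mem_seg le_rfl (Nat.zero_le _)))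
    omega
  · have := (hf.mem_seg_iff hr le_rfl).1 (this (mem_seg (Nat.zero_le _) le_rfl))
    omega

/-- A shortest interval meeting each of finitely many sets. -/
lemma exists_interval {ι : Type*} {n : ℕ} {N : ι → Set ℕ} (h : ∀ i, ∃ z ≤ n, z ∈ N i) :
    ∃ l r, l ≤ r ∧ r ≤ n ∧ (∀ i, ∃ z, l ≤ z ∧ z ≤ r ∧ z ∈ N i) ∧ (l = r ∨
      ((∃ i, ∀ z, l ≤ z → z ≤ r → z ∈ N i → z = l) ∧
        ∃ i, ∀ z, l ≤ z → z ≤ r → z ∈ N i → z = r)) := by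
  classical
  let P : ℕ → Prop := fun k => ∃ l, l + k ≤ n ∧ ∀ i, ∃ z, l ≤ z ∧ z ≤ l + k ∧ z ∈ N i
  have hP : ∃ k, P k := ⟨n, 0, by omega, fun i => by
    obtain ⟨z, hz, hzN⟩ := h i
    exact ⟨z, by omega, by omega, hzN⟩⟩
  obtain ⟨l, hl, hN⟩ := Nat.find_spec hP
  set k := Nat.find hP with hk
  refine ⟨l, l + k, by omega, hl, hN, ?_⟩
  by_cases hk0 : k = 0
  · left; omega
  right
  have hmin : ¬ P (k - 1) := Nat.find_min hP (by omega)
  constructor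
  · by_contra hcon
    push Not at hcon
    refine hmin ⟨l + 1, by omega, fun i => ?_⟩
    obtain ⟨z, h1, h2, h3, h4⟩ := hcon i
    exact ⟨z, by omega, by omega, h3⟩
  · by_contra hcon
    push Not at hcon
    refine hmin ⟨l, by omega, fun i => ?_⟩
    obtain ⟨z, h1, h2, h3, h4⟩ := hcon i
    exact ⟨z, by omega, by omega, h3⟩

lemma nbrIn_mono {Y' : Set V} (h : Y' ⊆ Y) : nbrIn G X Y' ⊆ nbrIn G X Y := by
  rintro x ⟨hx, y, hy, hyx⟩
  exact ⟨hx, y, h hy, hyx⟩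

/-- Hang a tree with a single neighbor `h` of `Y` on a tree made of an interval of `Y` and of
vertices separated from the first tree. -/
lemma Ctx.isTree_hang [Finite V] (hc : Ctx G X H Y) {n : ℕ} {f : ℕ → V}
    (hY : Y = seg f 0 n) {B S T : Set V} {J : Set ℕ} {h : V}
    (hB : (G.induce B).IsTree) (hBS : B ⊆ f '' J ∪ S) (hJn : ∀ j ∈ J, j ≤ n)
    (hT : (G.induce T).IsTree) (hTX : T ⊆ X) (hTF : T ∩ nbrIn G X Y = {h})
    (hST : Separated G S T) {z : ℕ} (hzB : f z ∈ B) (hzh : G.Adj (f z) h)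
    (huniq : ∀ j ∈ J, f j ∈ B → G.Adj (f j) h → j = z) : (G.induce (B ∪ T)).IsTree := by
  have hhT : h ∈ T ∩ nbrIn G X Y := hTF ▸ rfl
  refine isTree_union hB hT ?_ hzB hhT.1 hzh ?_
  · rw [Set.disjoint_left]
    intro v hv hvT
    rcases hBS hv with ⟨j, hj, rfl⟩ | hvS
    · exact Set.disjoint_left.1 hc.wild.prop.1 (hY ▸ mem_seg (Nat.zero_le _) (hJn j hj)) (hTX hvT)
    · exact Set.disjoint_left.1 hST.1 hvS hvT
  · intro u hu v hv huv
    rcases hBS hu with ⟨j, hj, rfl⟩ | huS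
    · have : v ∈ T ∩ nbrIn G X Y :=
        ⟨hv, hTX hv, f j, hY ▸ mem_seg (Nat.zero_le _) (hJn j hj), huv⟩
      rw [hTF] at this
      obtain rfl := this
      exact ⟨by rw [huniq j hj hu huv], rfl⟩
    · exact absurd huv (hST.2 u huS v hv)

/-- A connected set containing a leaf and a vertex of an arc `E` enters `E` through an end. -/
lemma IsNet.exists_entry [Finite V] (hN : IsNet G X H) {L Z E : Set V} (hL : IsLeafNode H L)
    (hZ : SConn G Z) (hZX : Z ⊆ X) (hLZ : L ⊆ Z) (hE : E ∈ H.edgeSet) {h : V} (hh : h ∈ Z)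
    (hhE : h ∈ E) : ∃ t, H.Inc E t ∧ (∃ u ∈ Z, u ∈ E ∧ u ∈ t) ∧
      (t = L ∨ ∃ v ∈ Z, v ∉ E ∧ v ∈ t) := by
  by_cases hsub : Z ⊆ E
  · obtain ⟨v, rfl, -⟩ := hN.leaf_spec hL
    have hv : v ∈ Z := hLZ rfl
    exact ⟨{v}, hN.inc_of_mem hE (hsub hv) rfl hL.mem, ⟨v, hv, hsub hv, rfl⟩, Or.inl rfl⟩
  · obtain ⟨b, hb, hbE⟩ := Set.not_subset.1 hsub
    obtain ⟨u, hu, v, hv, hvn, huv⟩ := hZ.exists_adj (A := Z ∩ E) Set.inter_subset_left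
      ⟨hh, hhE⟩ hb (fun h => hbE h.2)
    have hvE : v ∉ E := fun h => hvn ⟨hv, h⟩
    obtain ⟨E', p, q, hl, hvE'⟩ := hN.exists_link (hZX hv)
    obtain ⟨t, ht, hut, hvt⟩ := hN.exists_node hE hl.edge_mem
      (by rintro rfl; exact hvE hvE') hu.2 hvE' huv
    exact ⟨t, hN.inc_of_mem hE hu.2 hut ht, ⟨u, hu.1, hu.2, hut⟩, Or.inr ⟨v, hv, hvE, hvt⟩⟩

/-- Three separated connected sets, each containing a leaf, do not meet a common arc. -/
lemma IsNet.not_three_in_arc [Finite V] (hN : IsNet G X H) {L Z : Fin 3 → Set V} {E : Set V}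
    (hL : ∀ i, IsLeafNode H (L i)) (hZ : ∀ i, SConn G (Z i)) (hZX : ∀ i, Z i ⊆ X)
    (hLZ : ∀ i, L i ⊆ Z i) (hsep : ∀ i j, i ≠ j → Separated G (Z i) (Z j)) (hE : E ∈ H.edgeSet)
    (hmeet : ∀ i, ∃ h ∈ Z i, h ∈ E) : False := by
  have h1 : ∀ i, ∃ t, H.Inc E t ∧ (∃ u ∈ Z i, u ∈ E ∧ u ∈ t) ∧
      (t = L i ∨ ∃ v ∈ Z i, v ∉ E ∧ v ∈ t) := fun i => by
    obtain ⟨h, hh, hhE⟩ := hmeet i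
    exact hN.exists_entry (hL i) (hZ i) (hZX i) (hLZ i) hE hh hhE
  choose t ht hu hv using h1
  obtain ⟨p, q, hl⟩ := exists_isLink_of_mem_edgeSet hE
  have hpq : ∀ i, t i = p ∨ t i = q := fun i => (ht i).eq_or_eq_of_isLink hl
  have key : ∀ i j, i ≠ j → t i = t j → False := by
    intro i j hij htt
    obtain ⟨u, huZ, huE, hut⟩ := hu i
    rcases hv j with h | ⟨v, hvZ, hvE, hvt⟩
    · rw [htt, h] at hut
      exact Set.disjoint_left.1 (hsep i j hij).1 huZ (hLZ j hut)
    · obtain ⟨E', p', q', hl', hvE'⟩ := hN.exists_link (hZX j hvZ)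
      exact (hsep i j hij).2 u huZ v hvZ (hN.adj_of_mem hE hl'.edge_mem
        (by rintro rfl; exact hvE hvE') huE hvE' hut (htt ▸ hvt) (ht i).vertex_mem)
  rcases hpq 0 with h0 | h0 <;> rcases hpq 1 with h1 | h1 <;> rcases hpq 2 with h2 | h2
  all_goals first
    | exact key 0 1 (by decide) (h0.trans h1.symm)
    | exact key 0 2 (by decide) (h0.trans h2.symm)
    | exact key 1 2 (by decide) (h1.trans h2.symm)

lemma Ctx.arc_of_tamed (hc : Ctx G X H Y) {S : Set V} (hS : Tamed H S) (hSX : S ⊆ X) {u v : V}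
    (hu : u ∈ S) (hv : v ∈ S) (huv : ¬ G.Adj u v) : ∃ E ∈ H.edgeSet, u ∈ E ∧ v ∈ E := by
  rcases hS u hu v hv with h | ⟨N, hNH, huN, hvN⟩
  · exact h
  · obtain ⟨E, _, _, hl, hE⟩ := hc.net.exists_link (hSX hu)
    obtain ⟨E', _, _, hl', hE'⟩ := hc.net.exists_link (hSX hv)
    by_cases hne : E = E'
    · subst hne
      exact ⟨E, hl.edge_mem, hE, hE'⟩
    · exact absurd (hc.net.adj_of_mem hl.edge_mem hl'.edge_mem hne hE hE' huN hvN hNH) huv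

/-- There are no three separated connected sets in `X`, each containing a leaf node and a neighbor
of `Y`. -/
lemma Ctx.not_three [Finite V] (hc : Ctx G X H Y) {L Z : Fin 3 → Set V}
    (hL : ∀ i, IsLeafNode H (L i)) (hinj : Function.Injective L) (hZ : ∀ i, SConn G (Z i))
    (hZX : ∀ i, Z i ⊆ X) (hLZ : ∀ i, L i ⊆ Z i)
    (hsep : ∀ i j, i ≠ j → Separated G (Z i) (Z j))
    (hF : ∀ i, (Z i ∩ nbrIn G X Y).Nonempty) : False := by
  obtain ⟨n, f, hf, hY⟩ := hc.exists_indPath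
  have h1 : ∀ i, ∃ T ⊆ Z i, (G.induce T).IsTree ∧ L i ⊆ T ∧ ∃ h, T ∩ nbrIn G X Y = {h} := by
    intro i
    obtain ⟨v, hv, -⟩ := hc.net.leaf_spec (hL i)
    have hvL : v ∈ L i := hv ▸ rfl
    obtain ⟨T, h1, h2, h3, h4⟩ := (hZ i).exists_isTree (hLZ i hvL) (hF i)
    exact ⟨T, h1, h2, by rw [hv]; rintro _ rfl; exact h3, h4⟩
  choose T hTZ hT hLT h hTF using h1
  have hhT : ∀ i, h i ∈ T i ∩ nbrIn G X Y := fun i => hTF i ▸ rfl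
  have hTX : ∀ i, T i ⊆ X := fun i => (hTZ i).trans (hZX i)
  have hTsep : ∀ i j, i ≠ j → Separated G (T i) (T j) := fun i j hij =>
    (hsep i j hij).mono (hTZ i) (hTZ j)
  have hnb : ∀ i, ∃ z ≤ n, z ∈ {z | G.Adj (f z) (h i)} := by
    intro i
    obtain ⟨-, y, hy, hyh⟩ := (hhT i).2
    rw [hY] at hy
    obtain ⟨z, hz, rfl⟩ := hy
    exact ⟨z, hz.2, hyh⟩
  obtain ⟨l, r, hlr, hrn, hmeet, hends⟩ := exists_interval hnb
  have hsegY : ∀ l r, r ≤ n → seg f l r ⊆ Y := fun l r hr => hY ▸ seg_subset (Nat.zero_le _) hr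
  by_cases huniq : ∀ i, ∃ z, l ≤ z ∧ z ≤ r ∧ G.Adj (f z) (h i) ∧
      ∀ z', l ≤ z' → z' ≤ r → G.Adj (f z') (h i) → z' = z
  · choose z hz1 hz2 hz3 hz4 using huniq
    have hJ : ∀ j ∈ Set.Icc l r, j ≤ n := fun j hj => hj.2.trans hrn
    have t0 := hc.isTree_hang hY (J := Set.Icc l r) (S := ∅) (hf.isTree_seg hlr hrn)
      (by rw [Set.union_empty]; exact le_rfl) hJ (hT 0) (hTX 0) (hTF 0)
      separated_empty.symm (mem_seg (hz1 0) (hz2 0)) (hz3 0) (fun j hj _ => hz4 0 j hj.1 hj.2)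
    have t1 := hc.isTree_hang hY (J := Set.Icc l r) (S := T 0) t0 le_rfl hJ (hT 1) (hTX 1) (hTF 1)
      (hTsep 0 1 (by decide)) (Or.inl (mem_seg (hz1 1) (hz2 1))) (hz3 1)
      (fun j hj _ => hz4 1 j hj.1 hj.2)
    have t2 := hc.isTree_hang hY (J := Set.Icc l r) (S := T 0 ∪ T 1) t1
      (by rw [Set.union_assoc]; exact le_rfl) hJ (hT 2) (hTX 2) (hTF 2)
      ((hTsep 0 2 (by decide)).union_left (hTsep 1 2 (by decide)))
      (Or.inl (Or.inl (mem_seg (hz1 2) (hz2 2)))) (hz3 2) (fun j hj _ => hz4 2 j hj.1 hj.2)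
    refine hc.not_tree hL hinj (Set.union_subset (Set.union_subset (Set.union_subset
      ((hsegY l r hrn).trans Set.subset_union_right) ((hTX 0).trans Set.subset_union_left))
      ((hTX 1).trans Set.subset_union_left)) ((hTX 2).trans Set.subset_union_left)) t2 ?_
    intro i
    fin_cases i
    · exact fun v hv => Or.inl (Or.inl (Or.inr (hLT 0 hv)))
    · exact fun v hv => Or.inl (Or.inr (hLT 1 hv))
    · exact fun v hv => Or.inr (hLT 2 hv)
  · push Not at huniq
    obtain ⟨γ, hγ⟩ := huniq
    have hlr' : l ≠ r := by
      rintro rfl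
      obtain ⟨z, hz1, hz2, hz⟩ := hmeet γ
      obtain ⟨z', h1, h2, -, h3⟩ := hγ z hz1 hz2 hz
      omega
    obtain ⟨⟨α, hα⟩, ⟨β, hβ⟩⟩ := hends.resolve_left hlr'
    have hαl : G.Adj (f l) (h α) := by
      obtain ⟨z, hz1, hz2, hz⟩ := hmeet α
      exact hα z hz1 hz2 hz ▸ hz
    have hβr : G.Adj (f r) (h β) := by
      obtain ⟨z, hz1, hz2, hz⟩ := hmeet β
      exact hβ z hz1 hz2 hz ▸ hz
    have hαβ : α ≠ β := by
      rintro rfl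
      exact hlr' (hβ l le_rfl hlr hαl)
    have hγα : γ ≠ α := by
      rintro rfl
      obtain ⟨z', h1, h2, h3, h4⟩ := hγ l le_rfl hlr hαl
      exact h4 (hα z' h1 h2 h3)
    have hγβ : γ ≠ β := by
      rintro rfl
      obtain ⟨z', h1, h2, h3, h4⟩ := hγ r hlr le_rfl hβr
      exact h4 (hβ z' h1 h2 h3)
    have hall : ∀ i, i = α ∨ i = β ∨ i = γ := by
      clear * - hαβ hγα hγβ
      revert α β γ
      decide
    classical
    -- the extreme neighbors of `h γ` in the interval
    obtain ⟨z₁, hz₁, hz₁min⟩ : ∃ z, (l ≤ z ∧ z ≤ r ∧ G.Adj (f z) (h γ)) ∧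
        ∀ z', (l ≤ z' ∧ z' ≤ r ∧ G.Adj (f z') (h γ)) → z ≤ z' :=
      ⟨Nat.find (hmeet γ), Nat.find_spec (hmeet γ), fun z' hz' => Nat.find_min' (hmeet γ) hz'⟩
    obtain ⟨z₂, hz₂, hz₂max⟩ : ∃ z, (l ≤ z ∧ z ≤ r ∧ G.Adj (f z) (h γ)) ∧
        ∀ z', (l ≤ z' ∧ z' ≤ r ∧ G.Adj (f z') (h γ)) → z' ≤ z := by
      have hfin : {z | l ≤ z ∧ z ≤ r ∧ G.Adj (f z) (h γ)}.Finite :=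
        (Set.finite_Icc l r).subset fun z hz => ⟨hz.1, hz.2.1⟩
      obtain ⟨z, hz, hmax⟩ := hfin.exists_maximal ⟨z₁, hz₁⟩
      exact ⟨z, hz, fun z' hz' => by
        rcases le_total z' z with h | h
        · exact h
        · exact hmax hz' h⟩
    have hz12 : z₁ < z₂ := by
      obtain ⟨z', h1, h2, h3, h4⟩ := hγ z₁ hz₁.1 hz₁.2.1 hz₁.2.2
      have a1 := hz₁min z' ⟨h1, h2, h3⟩
      have a2 := hz₂max z' ⟨h1, h2, h3⟩
      omega
    have hnadj : ∀ i j, i ≠ j → ¬ G.Adj (h i) (h j) := fun i j hij =>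
      (hTsep i j hij).2 _ (hhT i).1 _ (hhT j).1
    by_cases hgap : z₂ = z₁ + 1
    · have hα' : h α ∈ nbrIn G X (seg f l z₁) :=
        ⟨(hhT α).2.1, f l, mem_seg le_rfl hz₁.1, hαl⟩
      have hγ₁ : h γ ∈ nbrIn G X (seg f l z₁) :=
        ⟨(hhT γ).2.1, f z₁, mem_seg hz₁.1 le_rfl, hz₁.2.2⟩
      have hβ' : h β ∈ nbrIn G X (seg f z₂ r) :=
        ⟨(hhT β).2.1, f r, mem_seg hz₂.2.1 le_rfl, hβr⟩
      have hγ₂ : h γ ∈ nbrIn G X (seg f z₂ r) :=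
        ⟨(hhT γ).2.1, f z₂, mem_seg le_rfl hz₂.2.1, hz₂.2.2⟩
      have a1 := hz₁.1
      have a2 := hz₂.2.1
      obtain ⟨E, hE, hαE, hγE⟩ := hc.arc_of_tamed
        (hc.tamed_seg hf hY (l := l) (r := z₁) hz₁.1 (by omega) (by omega))
        (fun _ h => h.1) hα' hγ₁ (hnadj _ _ hγα.symm)
      obtain ⟨E', hE', hβE, hγE'⟩ := hc.arc_of_tamed
        (hc.tamed_seg hf hY (l := z₂) (r := r) hz₂.2.1 (by omega) (by omega))
        (fun _ h => h.1) hβ' hγ₂ (hnadj _ _ hγβ.symm)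
      obtain rfl := hc.net.arc_eq hE hE' hγE hγE'
      refine hc.net.not_three_in_arc hL (fun i => isTree_sconn (hT i)) hTX hLT hTsep hE ?_
      intro i
      rcases hall i with rfl | rfl | rfl
      · exact ⟨_, (hhT _).1, hαE⟩
      · exact ⟨_, (hhT _).1, hβE⟩
      · exact ⟨_, (hhT _).1, hγE⟩
    · -- use `h γ` instead of the interior of the interval `[z₁, z₂]`
      obtain ⟨a1, a2, a3⟩ := hz₁
      obtain ⟨b1, b2, b3⟩ := hz₂
      have hJ₁ : ∀ j ∈ Set.Icc l z₁, j ≤ n := fun j hj => by have := hj.2; omega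
      have t0 := hc.isTree_hang hY (J := Set.Icc l z₁) (S := ∅) (hf.isTree_seg a1 (by omega))
        (by rw [Set.union_empty]; exact le_rfl) hJ₁ (hT α) (hTX α) (hTF α)
        separated_empty.symm (mem_seg le_rfl a1) hαl
        (fun j hj _ => hα j hj.1 (hj.2.trans a2))
      have t1 := hc.isTree_hang hY (J := Set.Icc l z₁) (S := T α) t0 le_rfl hJ₁ (hT γ) (hTX γ)
        (hTF γ) (hTsep _ _ hγα.symm) (Or.inl (mem_seg a1 le_rfl)) a3
        (fun j hj _ hadj => le_antisymm hj.2 (hz₁min j ⟨hj.1, hj.2.trans a2, hadj⟩))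
      have t2 := hc.isTree_hang hY (J := Set.Icc z₂ r) (S := ∅) (hf.isTree_seg b2 hrn)
        (by rw [Set.union_empty]; exact le_rfl) (fun j hj => hj.2.trans hrn) (hT β) (hTX β) (hTF β)
        separated_empty.symm (mem_seg b2 le_rfl) hβr
        (fun j hj _ => hβ j (b1.trans hj.1) hj.2)
      have hYX := Set.disjoint_left.1 hc.wild.prop.1
      have hseg1 : ∀ v ∈ seg f l z₁, v ∈ Y := fun v hv => hsegY l z₁ (by omega) hv
      have hseg2 : ∀ v ∈ seg f z₂ r, v ∈ Y := fun v hv => hsegY z₂ r hrn hv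
      have hF : ∀ i, ∀ v ∈ T i, ∀ y ∈ Y, G.Adj y v → v = h i := fun i v hv y hy hyv => by
        have : v ∈ T i ∩ nbrIn G X Y := ⟨hv, hTX i hv, y, hy, hyv⟩
        rw [hTF i] at this
        exact this
      have t3 := isTree_union (a := h γ) (b := f z₂) t1 t2 (by
          rw [Set.disjoint_left]
          rintro v ((hv | hv) | hv) (hv' | hv')
          · obtain ⟨i, hi, rfl⟩ := hv
            have a4 := hi.2
            have := (hf.mem_seg_iff hrn (by omega)).1 hv'
            omega
          · exact hYX (hseg1 v hv) (hTX β hv')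
          · exact hYX (hseg2 v hv') (hTX α hv)
          · exact Set.disjoint_left.1 (hTsep α β hαβ).1 hv hv'
          · exact hYX (hseg2 v hv') (hTX γ hv)
          · exact Set.disjoint_left.1 (hTsep γ β hγβ).1 hv hv')
        (Or.inr (hhT γ).1) (Or.inl (mem_seg le_rfl b2)) b3.symm (by
          rintro u ((hu | hu) | hu) v (hv | hv) huv
          · obtain ⟨i, hi, rfl⟩ := hu
            obtain ⟨j, hj, rfl⟩ := hv
            have a4 := hi.2
            have a5 := hj.1
            have a6 := hj.2
            rw [hf.adj i (by omega) j (by omega)] at huv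
            omega
          · obtain ⟨i, hi, rfl⟩ := hu
            have := hF β v hv _ (hseg1 _ (mem_seg hi.1 hi.2)) huv
            subst this
            have := hβ i hi.1 (hi.2.trans a2) huv
            have := hi.2
            omega
          · obtain ⟨j, hj, rfl⟩ := hv
            have := hF α u hu _ (hseg2 _ (mem_seg hj.1 hj.2)) huv.symm
            subst this
            have := hα j (b1.trans hj.1) hj.2 huv.symm
            have := hj.1
            omega
          · exact absurd huv ((hTsep α β hαβ).2 u hu v hv)
          · obtain ⟨j, hj, rfl⟩ := hv
            have := hF γ u hu _ (hseg2 _ (mem_seg hj.1 hj.2)) huv.symm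
            subst this
            have := hz₂max j ⟨b1.trans hj.1, hj.2, huv.symm⟩
            exact ⟨rfl, by rw [le_antisymm this hj.1]⟩
          · exact absurd huv ((hTsep γ β hγβ).2 u hu v hv))
      refine hc.not_tree hL hinj ?_ t3 ?_
      · rintro v (((hv | hv) | hv) | (hv | hv))
        · exact Or.inr (hseg1 v hv)
        · exact Or.inl (hTX α hv)
        · exact Or.inl (hTX γ hv)
        · exact Or.inr (hseg2 v hv)
        · exact Or.inl (hTX β hv)
      · intro i
        rcases hall i with rfl | rfl | rfl
        · exact fun v hv => Or.inl (Or.inl (Or.inr (hLT _ hv)))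
        · exact fun v hv => Or.inr (Or.inr (hLT _ hv))
        · exact fun v hv => Or.inl (Or.inr (hLT _ hv))

/-- There is no tree in `X` containing two leaf nodes and a single neighbor of `Y` that is separated
from a connected set containing the third leaf node and a neighbor of `Y`. -/
lemma Ctx.not_two [Finite V] (hc : Ctx G X H Y) {L : Fin 3 → Set V}
    (hL : ∀ i, IsLeafNode H (L i)) (hinj : Function.Injective L) {P Z : Set V}
    (hP : (G.induce P).IsTree) (hPX : P ⊆ X) (hP0 : L 0 ⊆ P) (hP1 : L 1 ⊆ P) {s : V}
    (hs : P ∩ nbrIn G X Y = {s}) (hZ : SConn G Z) (hZX : Z ⊆ X) (hLZ : L 2 ⊆ Z)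
    (hsep : Separated G P Z) (hF : (Z ∩ nbrIn G X Y).Nonempty) : False := by
  obtain ⟨n, f, hf, hY⟩ := hc.exists_indPath
  obtain ⟨T, hTZ, hT, hLT, t, ht⟩ : ∃ T ⊆ Z, (G.induce T).IsTree ∧ L 2 ⊆ T ∧
      ∃ h, T ∩ nbrIn G X Y = {h} := by
    obtain ⟨v, hv, -⟩ := hc.net.leaf_spec (hL 2)
    have hvL : v ∈ L 2 := hv ▸ rfl
    obtain ⟨T, h1, h2, h3, h4⟩ := hZ.exists_isTree (hLZ hvL) hF
    exact ⟨T, h1, h2, by rw [hv]; rintro _ rfl; exact h3, h4⟩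
  have hnb : ∀ x ∈ nbrIn G X Y, ∃ z ≤ n, G.Adj (f z) x := by
    rintro x ⟨-, y, hy, hyh⟩
    rw [hY] at hy
    obtain ⟨z, hz, rfl⟩ := hy
    exact ⟨z, hz.2, hyh⟩
  have hsP : s ∈ P ∩ nbrIn G X Y := hs ▸ rfl
  have htT : t ∈ T ∩ nbrIn G X Y := ht ▸ rfl
  obtain ⟨l, r, hlr, hrn, hmeet, hends⟩ := exists_interval (ι := Bool) (n := n)
    (N := fun b => {z | G.Adj (f z) (bif b then s else t)}) (by
      rintro (_ | _)
      · exact hnb t htT.2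
      · exact hnb s hsP.2)
  have huniq : ∀ b : Bool, ∃ z, l ≤ z ∧ z ≤ r ∧ G.Adj (f z) (bif b then s else t) ∧
      ∀ z', l ≤ z' → z' ≤ r → G.Adj (f z') (bif b then s else t) → z' = z := by
    intro b
    rcases hends with rfl | ⟨⟨i, hi⟩, ⟨j, hj⟩⟩
    · obtain ⟨z, h1, h2, h3⟩ := hmeet b
      exact ⟨z, h1, h2, h3, fun z' _ _ _ => by omega⟩
    · by_cases hij : i = j
      · subst hij
        obtain ⟨z, h1, h2, h3⟩ := hmeet i
        have := hi z h1 h2 h3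
        have := hj z h1 h2 h3
        obtain ⟨z, h1, h2, h3⟩ := hmeet b
        exact ⟨z, h1, h2, h3, fun z' _ _ _ => by omega⟩
      · obtain ⟨z, h1, h2, h3⟩ := hmeet b
        have hb : b = i ∨ b = j := by
          clear * - hij
          revert b i j
          decide
        refine ⟨z, h1, h2, h3, fun z' h1' h2' h3' => ?_⟩
        rcases hb with rfl | rfl
        · rw [hi z h1 h2 h3, hi z' h1' h2' h3']
        · rw [hj z h1 h2 h3, hj z' h1' h2' h3']
  obtain ⟨z, hz1, hz2, hz3, hz4⟩ := huniq true
  obtain ⟨w, hw1, hw2, hw3, hw4⟩ := huniq false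
  have hJ : ∀ j ∈ Set.Icc l r, j ≤ n := fun j hj => hj.2.trans hrn
  have hTX := hTZ.trans hZX
  have t0 := hc.isTree_hang hY (J := Set.Icc l r) (S := ∅) (hf.isTree_seg hlr hrn)
    (by rw [Set.union_empty]; exact le_rfl) hJ hP hPX hs
    separated_empty.symm (mem_seg hz1 hz2) hz3 (fun j hj _ => hz4 j hj.1 hj.2)
  have t1 := hc.isTree_hang hY (J := Set.Icc l r) (S := P) t0 le_rfl hJ hT hTX ht
    (hsep.mono le_rfl hTZ) (Or.inl (mem_seg hw1 hw2)) hw3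
    (fun j hj _ => hw4 j hj.1 hj.2)
  have hsegY : seg f l r ⊆ Y := hY ▸ seg_subset (Nat.zero_le _) hrn
  refine hc.not_tree hL hinj (Set.union_subset (Set.union_subset
      (hsegY.trans Set.subset_union_right) (hPX.trans Set.subset_union_left))
      (hTX.trans Set.subset_union_left)) t1 ?_
  intro i
  fin_cases i
  · exact fun v hv => Or.inl (Or.inr (hP0 hv))
  · exact fun v hv => Or.inl (Or.inr (hP1 hv))
  · exact fun v hv => Or.inr (hLT hv)

/-- Leaves of `G` are not adjacent to `Y`. -/
lemma Ctx.leaf_disjoint [Finite V] (hc : Ctx G X H Y) {L : Set V} (hL : IsLeafNode H L) {v : V}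
    (hv : v ∈ L) : v ∉ nbrIn G X Y := by
  rintro ⟨-, y, hy, hyv⟩
  obtain ⟨w, rfl, ⟨u, -, huniq⟩, x, hx, hwx⟩ := hc.net.leaf_spec hL
  obtain rfl := Set.mem_singleton_iff.1 hv
  have : y = x := (huniq y hyv.symm).trans (huniq x hwx).symm
  exact Set.disjoint_left.1 hc.wild.prop.1 hy (this ▸ hx)

end Rules

/-! ### Legs and prongs -/

section Legs

variable {V : Type*} {G : SimpleGraph V} {X Y F F' : Set V} {H : Graph (Set V) (Set V)}
  {L₁ L₂ L₃ : Set V}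

/-- The three leaf nodes of a net. -/
structure Triple (H : Graph (Set V) (Set V)) (L₁ L₂ L₃ : Set V) : Prop where
  leaf₁ : IsLeafNode H L₁
  leaf₂ : IsLeafNode H L₂
  leaf₃ : IsLeafNode H L₃
  ne₁₂ : L₁ ≠ L₂
  ne₁₃ : L₁ ≠ L₃
  ne₂₃ : L₂ ≠ L₃

namespace Triple

lemma swap₁₂ (h : Triple H L₁ L₂ L₃) : Triple H L₂ L₁ L₃ :=
  ⟨h.leaf₂, h.leaf₁, h.leaf₃, h.ne₁₂.symm, h.ne₂₃, h.ne₁₃⟩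

lemma swap₂₃ (h : Triple H L₁ L₂ L₃) : Triple H L₁ L₃ L₂ :=
  ⟨h.leaf₁, h.leaf₃, h.leaf₂, h.ne₁₃, h.ne₁₂, h.ne₂₃.symm⟩

lemma swap₁₃ (h : Triple H L₁ L₂ L₃) : Triple H L₃ L₂ L₁ :=
  ⟨h.leaf₃, h.leaf₂, h.leaf₁, h.ne₂₃.symm, h.ne₁₃.symm, h.ne₁₂.symm⟩

lemma leaf (h : Triple H L₁ L₂ L₃) : ∀ i, IsLeafNode H (![L₁, L₂, L₃] i) := by
  intro i
  fin_cases i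
  exacts [h.leaf₁, h.leaf₂, h.leaf₃]

lemma injective (h : Triple H L₁ L₂ L₃) : Function.Injective ![L₁, L₂, L₃] := by
  obtain ⟨-, -, -, h1, h2, h3⟩ := h
  intro i j hij
  fin_cases i <;> fin_cases j <;> simp_all

lemma eq (h : Triple H L₁ L₂ L₃) [Finite V] (hN : IsNet G X H) {N : Set V} (hNl : IsLeafNode H N) :
    N = L₁ ∨ N = L₂ ∨ N = L₃ := by
  obtain ⟨i, hi⟩ := leaf_eq hN h.leaf h.injective hNl
  fin_cases i
  exacts [Or.inl hi, Or.inr (Or.inl hi), Or.inr (Or.inr hi)]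

end Triple

/-- A vertex of `F` in the arc `g` can be reached from the leaf node `L`, using only nodes in `D`. -/
def Leg (H : Graph (Set V) (Set V)) (F L : Set V) (D : Set (Set V)) (g : Set V) : Prop :=
  ∃ M ⊆ D, SConn (netGraph H) M ∧ L ∈ M ∧ ∃ c ∈ M, ∃ d, H.IsLink g c d ∧
    ∃ h ∈ g, h ∈ F ∧ (h ∈ d → d ∈ D)

variable {M M₁ M₂ D D₁ D₂ D₃ Q : Set (Set V)}

lemma Leg.mono {L g : Set V} (h : Leg H F L D g) (hF : F ⊆ F') (hD : D ⊆ D₁) : Leg H F' L D₁ g := by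
  obtain ⟨M, hMD, hM, hLM, c, hc, d, hl, v, hv, hvF, hd⟩ := h
  exact ⟨M, hMD.trans hD, hM, hLM, c, hc, d, hl, v, hv, hF hvF, fun h => hD (hd h)⟩

lemma Leg.exists_end {L g : Set V} (h : Leg H F L D g) : ∃ N ∈ D, H.Inc g N := by
  obtain ⟨M, hMD, -, -, c, hc, d, hl, -⟩ := h
  exact ⟨c, hMD hc, hl.inc_left⟩

lemma Leg.exists_sconn {L g : Set V} (hN : IsNet G X H) (h : Leg H F L D g) :
    ∃ M ⊆ D, SConn (netGraph H) M ∧ L ∈ M ∧ Leg H F L M g := by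
  obtain ⟨M, hMD, hM, hLM, c, hc, d, hl, v, hv, hvF, hd⟩ := h
  by_cases hvd : v ∈ d
  · refine ⟨insert d M, Set.insert_subset (hd hvd) hMD,
      hM.insert_of_adj hc ⟨hN.loopless _ _ _ hl, g, hl⟩, Or.inr hLM, M, Set.subset_insert _ _, hM,
      hLM, c, hc, d, hl, v, hv, hvF, fun _ => Or.inl rfl⟩
  · exact ⟨M, hMD, hM, hLM, M, le_rfl, hM, hLM, c, hc, d, hl, v, hv, hvF, fun h => absurd h hvd⟩

/-- Extend a connected part of an arc to a leaf node. -/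
lemma IsNet.exists_conn [Finite V] (hN : IsNet G X H) {L c d g S : Set V} (hL : IsLeafNode H L)
    (hM : SConn (netGraph H) M) (hLM : L ∈ M) (hcM : c ∈ M) (hl : H.IsLink g c d) (hd : d ∉ M)
    (hS : SConn G S) (hSg : S ⊆ g) (hSc : (S ∩ c).Nonempty) :
    ∃ T ⊆ inArcs H M, SConn G (S ∪ T) ∧ L ⊆ S ∪ T := by
  obtain ⟨w, hwS, hwc⟩ := hSc
  rcases hN.free (F := ∅) hL hM hLM hcM (Set.disjoint_empty _) with
    rfl | ⟨T, hTM, hT, hLT, ⟨v, hv⟩, -⟩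
  · refine ⟨∅, Set.empty_subset _, by simpa using hS, ?_⟩
    obtain ⟨v, rfl, -⟩ := hN.leaf_spec hL
    rintro _ rfl
    exact Or.inl ((Set.mem_singleton_iff.1 hwc) ▸ hwS)
  · refine ⟨T, hTM, ?_, hLT.trans Set.subset_union_right⟩
    have hvT : v ∈ T ∩ c := hv ▸ rfl
    obtain ⟨E, p, q, hE, hp, hq, hvE⟩ := hTM hvT.1
    refine hS.union_of_adj (isTree_sconn hT) hwS hvT.1
      (hN.adj_of_mem hl.edge_mem hE.edge_mem ?_ (hSg hwS) hvE hwc hvT.2 hl.left_mem)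
    rintro rfl
    rcases hl.inc_right.eq_or_eq_of_isLink hE with rfl | rfl <;> contradiction

lemma Leg.realize [Finite V] (hN : IsNet G X H) {L g : Set V} (hL : IsLeafNode H L)
    (h : Leg H F L D g) : ∃ Z, SConn G Z ∧ L ⊆ Z ∧ (Z ∩ F).Nonempty ∧ Foot H X Z D {g} := by
  have key : ∀ M c d, M ⊆ D → SConn (netGraph H) M → L ∈ M → c ∈ M → d ∉ M → H.IsLink g c d →
      ∀ v ∈ g, v ∈ F → (v ∈ d → d ∈ D) →
      ∃ Z, SConn G Z ∧ L ⊆ Z ∧ (Z ∩ F).Nonempty ∧ Foot H X Z D {g} := by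
    intro M c d hMD hM hLM hc hd hl v hv hvF hvd
    obtain ⟨R, hRg, hvR, hR⟩ := hN.exists_rung _ _ _ hl v hv
    obtain ⟨S, hSR, hS, hvS, hSc, hSd⟩ := hR.exists_stub hvR
    obtain ⟨T, hTM, hST, hLST⟩ := hN.exists_conn hL hM hLM hc hl hd hS (hSR.trans hRg) hSc
    refine ⟨S ∪ T, hST, hLST, ⟨v, Or.inl hvS, hvF⟩, Foot.union ?_ ?_⟩
    · refine Foot.of_subset_arc hN hl (hSR.trans hRg) (hMD hc) fun w hw hwd => ?_
      by_cases h : v ∈ d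
      · exact hvd h
      · exact absurd hwd (Set.disjoint_left.1 (hSd h) hw)
    · exact (Foot.of_subset_inArcs hN hTM).mono hMD (Set.empty_subset _)
  obtain ⟨M, hMD, hM, hLM, c, hc, d, hl, v, hv, hvF, hvd⟩ := h
  by_cases hd : d ∈ M
  · have hcd : c ≠ d := hN.loopless _ _ _ hl
    by_cases hcomp : L ≠ d ∧ c ∈ comp (netGraph H) (M \ {d}) L
    · exact key _ c d ((comp_subset.trans Set.sdiff_subset).trans hMD)
        (comp_sconn ⟨hLM, hcomp.1⟩) (mem_comp ⟨hLM, hcomp.1⟩) hcomp.2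
        (fun h => (comp_subset h).2 rfl) hl v hv hvF (fun _ => hMD hd)
    · have h1 : L ≠ c ∧ d ∈ comp (netGraph H) (M \ {c}) L := by
        by_cases hLd : L = d
        · subst hLd
          exact ⟨hcd.symm, mem_comp ⟨hLM, hcd.symm⟩⟩
        · have h2 : c ∉ comp (netGraph H) (M \ {d}) L := fun h => hcomp ⟨hLd, h⟩
          refine ⟨?_, hM.comp_diff_or hLM hd hLd h2 hcd.symm⟩
          rintro rfl
          exact h2 (mem_comp ⟨hLM, hLd⟩)
      exact key _ d c ((comp_subset.trans Set.sdiff_subset).trans hMD)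
        (comp_sconn ⟨hLM, h1.1⟩) (mem_comp ⟨hLM, h1.1⟩) h1.2
        (fun h => (comp_subset h).2 rfl) hl.symm v hv hvF (fun _ => hMD hc)
  · exact key M c d hMD hM hLM hc hd hl v hv hvF hvd

lemma Ctx.not_three_sets [Finite V] (hc : Ctx G X H Y) (ht : Triple H L₁ L₂ L₃) {Z₁ Z₂ Z₃ : Set V}
    (h₁ : SConn G Z₁) (h₂ : SConn G Z₂) (h₃ : SConn G Z₃) (hX₁ : Z₁ ⊆ X) (hX₂ : Z₂ ⊆ X)
    (hX₃ : Z₃ ⊆ X) (hL₁ : L₁ ⊆ Z₁) (hL₂ : L₂ ⊆ Z₂) (hL₃ : L₃ ⊆ Z₃)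
    (hF₁ : (Z₁ ∩ nbrIn G X Y).Nonempty) (hF₂ : (Z₂ ∩ nbrIn G X Y).Nonempty)
    (hF₃ : (Z₃ ∩ nbrIn G X Y).Nonempty) (h12 : Separated G Z₁ Z₂) (h13 : Separated G Z₁ Z₃)
    (h23 : Separated G Z₂ Z₃) : False := by
  refine hc.not_three (Z := ![Z₁, Z₂, Z₃]) ht.leaf ht.injective ?_ ?_ ?_ ?_ ?_
  · intro i; fin_cases i; exacts [h₁, h₂, h₃]
  · intro i; fin_cases i; exacts [hX₁, hX₂, hX₃]
  · intro i; fin_cases i; exacts [hL₁, hL₂, hL₃]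
  · intro i j hij
    fin_cases i <;> fin_cases j
    exacts [absurd rfl hij, h12, h13, h12.symm, absurd rfl hij, h23, h13.symm, h23.symm,
      absurd rfl hij]
  · intro i; fin_cases i; exacts [hF₁, hF₂, hF₃]

lemma Ctx.not_three_legs [Finite V] (hc : Ctx G X H Y) (ht : Triple H L₁ L₂ L₃) {g₁ g₂ g₃ : Set V}
    (h₁ : Leg H (nbrIn G X Y) L₁ D₁ g₁) (h₂ : Leg H (nbrIn G X Y) L₂ D₂ g₂)
    (h₃ : Leg H (nbrIn G X Y) L₃ D₃ g₃) (h12 : Disjoint D₁ D₂) (h13 : Disjoint D₁ D₃)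
    (h23 : Disjoint D₂ D₃) (g12 : g₁ ≠ g₂) (g13 : g₁ ≠ g₃) (g23 : g₂ ≠ g₃) : False := by
  obtain ⟨Z₁, a1, a2, a3, a4⟩ := h₁.realize hc.net.toIsNet ht.leaf₁
  obtain ⟨Z₂, b1, b2, b3, b4⟩ := h₂.realize hc.net.toIsNet ht.leaf₂
  obtain ⟨Z₃, c1, c2, c3, c4⟩ := h₃.realize hc.net.toIsNet ht.leaf₃
  exact hc.not_three_sets ht a1 b1 c1 a4.subset b4.subset c4.subset a2 b2 c2 a3 b3 c3
    (a4.separated hc.net.toIsNet b4 h12 (by simpa using g12))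
    (a4.separated hc.net.toIsNet c4 h13 (by simpa using g13))
    (b4.separated hc.net.toIsNet c4 h23 (by simpa using g23))

lemma Ctx.not_tree_leg [Finite V] (hc : Ctx G X H Y) (ht : Triple H L₁ L₂ L₃) {P g : Set V}
    (hP : (G.induce P).IsTree) (hL₁ : L₁ ⊆ P) (hL₂ : L₂ ⊆ P) {s : V}
    (hs : P ∩ nbrIn G X Y = {s}) (hfoot : Foot H X P D ∅) (h₃ : Leg H (nbrIn G X Y) L₃ D₃ g)
    (hD : Disjoint D D₃) : False := by
  obtain ⟨Z₃, c1, c2, c3, c4⟩ := h₃.realize hc.net.toIsNet ht.leaf₃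
  exact hc.not_two ht.leaf ht.injective hP hfoot.subset hL₁ hL₂ hs c1 c4.subset c2
    (hfoot.separated hc.net.toIsNet c4 hD (Set.empty_disjoint _)) c3

/-- There is no tree `B` that can be extended to two leaf nodes while the third one has a leg. -/
lemma Ctx.not_prong [Finite V] (hc : Ctx G X H Y) (ht : Triple H L₁ L₂ L₃) {x y B g : Set V}
    (hx : x ∈ M₁) (hy : y ∈ M₂) (h₁ : Free G H (nbrIn G X Y) M₁ L₁ x)
    (h₂ : Free G H (nbrIn G X Y) M₂ L₂ y) (h12 : Disjoint M₁ M₂)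
    (hQ₁ : Disjoint Q M₁) (hQ₂ : Disjoint Q M₂)
    (hxH : x ∈ H.vertexSet) (hyH : y ∈ H.vertexSet)
    (hB : (G.induce B).IsTree) (hfoot : Foot H X B ({x, y} ∪ Q) ∅)
    (hBx : ∃ v, B ∩ x = {v}) (hBy : ∃ v, B ∩ y = {v}) (hs : ∃ s, B ∩ nbrIn G X Y = {s})
    (h₃ : Leg H (nbrIn G X Y) L₃ D₃ g) (hD₁ : Disjoint M₁ D₃) (hD₂ : Disjoint M₂ D₃)
    (hDQ : Disjoint Q D₃) : False := by
  have hN := hc.net.toIsNet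
  obtain ⟨u, hu⟩ := hBx
  obtain ⟨w, hw⟩ := hBy
  obtain ⟨s, hs⟩ := hs
  rw [Set.disjoint_left] at h12 hQ₁ hQ₂
  have hm₁ : ∀ N ∈ ({x, y} ∪ Q : Set (Set V)), N ∈ M₁ → N = x := by
    rintro N ((rfl | rfl) | hN) hNM
    · rfl
    · exact absurd hy (h12 hNM)
    · exact absurd hNM (hQ₁ hN)
  have hm₂ : ∀ N ∈ ({x, y} ∪ Q : Set (Set V)), N ∈ M₂ → N = y := by
    rintro N ((rfl | rfl) | hN) hNM
    · exact absurd hNM (h12 hx)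
    · rfl
    · exact absurd hNM (hQ₂ hN)
  have harc : ∀ E p q, H.IsLink E p q → ∀ v ∈ B, v ∈ E →
      p ∈ ({x, y} ∪ Q : Set (Set V)) ∧ q ∈ ({x, y} ∪ Q : Set (Set V)) := by
    intro E p q hl v hv hvE
    rcases hfoot.arc E hl.edge_mem v hv hvE with h | ⟨h, -⟩
    · exact ⟨h p hl.inc_left, h q hl.inc_right⟩
    · exact absurd h (Set.notMem_empty _)
  obtain ⟨B₁, -, hB₁, hLB₁, T₁, hT₁, hT₁F, rfl⟩ := hN.attach ht.leaf₁ h₁ hxH hB hu hfoot.subset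
    (fun E p q hl v hv hvE hp hq => hN.loopless _ _ _ hl <|
      (hm₁ p (harc E p q hl v hv hvE).1 hp).trans (hm₁ q (harc E p q hl v hv hvE).2 hq).symm)
    (fun N hNH v hv hvN hNM => hm₁ N (hfoot.node N hNH v hv hvN) hNM)
  have hf₁ := Foot.of_subset_inArcs hN hT₁
  have hTy : T₁ ∩ y = ∅ := by
    ext v
    simp only [Set.mem_inter_iff, Set.mem_empty_iff_false, iff_false, not_and]
    exact fun hv hvy => h12 (hf₁.node y hyH v hv hvy) hy
  obtain ⟨P, -, hP, hLP, T₂, hT₂, hT₂F, rfl⟩ := hN.attach ht.leaf₂ h₂ hyH hB₁ (b := w)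
    (by rw [Set.union_inter_distrib_right, hTy, hw, Set.union_empty])
    (Set.union_subset hfoot.subset hf₁.subset)
    (fun E p q hl v hv hvE hp hq => by
      rcases hv with hv | hv
      · exact hN.loopless _ _ _ hl <|
          (hm₂ p (harc E p q hl v hv hvE).1 hp).trans (hm₂ q (harc E p q hl v hv hvE).2 hq).symm
      · rcases hf₁.arc E hl.edge_mem v hv hvE with h | ⟨h, -⟩
        · exact h12 (h p hl.inc_left) hp
        · exact h)
    (fun N hNH v hv hvN hNM => by
      rcases hv with hv | hv
      · exact hm₂ N (hfoot.node N hNH v hv hvN) hNM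
      · exact absurd hNM (h12 (hf₁.node N hNH v hv hvN)))
  have hf₂ := Foot.of_subset_inArcs hN hT₂
  refine hc.not_tree_leg ht (D := M₁ ∪ M₂ ∪ Q) hP (hLB₁.trans Set.subset_union_left) hLP (s := s)
    ?_ (Foot.union (Foot.union (hfoot.mono ?_ le_rfl) (hf₁.mono ?_ le_rfl)) (hf₂.mono ?_ le_rfl))
    h₃ ?_
  · rw [Set.union_inter_distrib_right, Set.union_inter_distrib_right, hT₁F.inter_eq,
      hT₂F.inter_eq, hs]
    simp
  · rintro N ((rfl | rfl) | hN)
    · exact Or.inl (Or.inl hx)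
    · exact Or.inl (Or.inr hy)
    · exact Or.inr hN
  · exact fun N hN => Or.inl (Or.inl hN)
  · exact fun N hN => Or.inl (Or.inr hN)
  · exact Set.disjoint_union_left.2 ⟨Set.disjoint_union_left.2 ⟨hD₁, hD₂⟩, hDQ⟩

/-- The middle tree of a prong lies in one arc. -/
lemma Ctx.not_prong_arc [Finite V] (hc : Ctx G X H Y) (ht : Triple H L₁ L₂ L₃) {x y B e g : Set V}
    (hx : x ∈ M₁) (hy : y ∈ M₂) (h₁ : Free G H (nbrIn G X Y) M₁ L₁ x)
    (h₂ : Free G H (nbrIn G X Y) M₂ L₂ y) (h12 : Disjoint M₁ M₂) (he : H.IsLink e x y)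
    (hB : (G.induce B).IsTree) (hBe : B ⊆ e)
    (hBx : ∃ v, B ∩ x = {v}) (hBy : ∃ v, B ∩ y = {v}) (hs : ∃ s, B ∩ nbrIn G X Y = {s})
    (h₃ : Leg H (nbrIn G X Y) L₃ D₃ g) (hD₁ : Disjoint M₁ D₃) (hD₂ : Disjoint M₂ D₃) : False :=
  hc.not_prong ht (Q := ∅) hx hy h₁ h₂ h12 (Set.empty_disjoint _) (Set.empty_disjoint _)
    he.left_mem he.right_mem hB
    (Foot.of_subset_arc_of_mem hc.net.toIsNet he hBe (by simp) (by simp)) hBx hBy hs h₃ hD₁ hD₂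
    (Set.empty_disjoint _)

lemma inter_singleton_of_mem {A B : Set V} {a v : V} (h : A ∩ B = {a}) (hv : v ∈ A) (hv' : v ∈ B) :
    A ∩ B = {v} := by
  have : v ∈ A ∩ B := ⟨hv, hv'⟩
  rw [h] at this ⊢
  rw [Set.mem_singleton_iff.1 this]

/-- The middle tree of a prong consists of two rungs joined at a node `c`. -/
lemma Ctx.not_prong_node [Finite V] (hc : Ctx G X H Y) (ht : Triple H L₁ L₂ L₃)
    {x y c e₁ e₂ g : Set V} {m n : V} (hx : x ∈ M₁) (hy : y ∈ M₂)
    (h₁ : Free G H (nbrIn G X Y) M₁ L₁ x) (h₂ : Free G H (nbrIn G X Y) M₂ L₂ y)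
    (h12 : Disjoint M₁ M₂) (hc₁ : c ∉ M₁) (hc₂ : c ∉ M₂)
    (he₁ : H.IsLink e₁ x c) (he₂ : H.IsLink e₂ y c) (hm : m ∈ e₁) (hmc : m ∈ c)
    (hmF : m ∈ nbrIn G X Y) (hF₁ : ∀ v ∈ e₁, v ∈ nbrIn G X Y → v ∈ c)
    (hn : n ∈ e₂) (hnc : n ∈ c) (hnF : n ∉ nbrIn G X Y)
    (hF₂ : ∀ v ∈ e₂, v ∈ nbrIn G X Y → v ∈ c)
    (h₃ : Leg H (nbrIn G X Y) L₃ D₃ g) (hD₁ : Disjoint M₁ D₃) (hD₂ : Disjoint M₂ D₃)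
    (hcD : c ∉ D₃) : False := by
  have hN := hc.net.toIsNet
  obtain ⟨R, hRe, hmR, hR⟩ := hN.exists_rung _ _ _ he₁ m hm
  obtain ⟨S, hSe, hnS, hS⟩ := hN.exists_rung _ _ _ he₂ n hn
  obtain ⟨r, hr⟩ := hR.inter_right
  obtain ⟨s, hs⟩ := hS.inter_right
  have hr' := inter_singleton_of_mem hr hmR hmc
  have hs' := inter_singleton_of_mem hs hnS hnc
  have hxy : x ≠ y := by
    rintro rfl
    exact Set.disjoint_left.1 h12 hx hy
  have hxc : x ≠ c := fun h => hc₁ (h ▸ hx)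
  have hyc : y ≠ c := fun h => hc₂ (h ▸ hy)
  have hnx : ∀ v ∈ e₂, v ∉ x := fun v hv hvx => by
    rcases hN.end_of_mem he₂ hv hvx he₁.left_mem with h | h
    · exact hxy h
    · exact hxc h
  have hny : ∀ v ∈ e₁, v ∉ y := fun v hv hvy => by
    rcases hN.end_of_mem he₁ hv hvy he₂.left_mem with h | h
    · exact hxy h.symm
    · exact hyc h
  obtain ⟨a, ha⟩ := hR.inter_left
  obtain ⟨b, hb⟩ := hS.inter_left
  refine hc.not_prong ht (Q := {c}) (B := R ∪ S) hx hy h₁ h₂ h12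
    (Set.disjoint_singleton_left.2 hc₁) (Set.disjoint_singleton_left.2 hc₂)
    he₁.left_mem he₂.left_mem ?_ ?_ ⟨a, ?_⟩ ⟨b, ?_⟩ ⟨m, ?_⟩ h₃ hD₁ hD₂
    (Set.disjoint_singleton_left.2 hcD)
  · refine hN.isTree_join hR.isTree hS.isTree (hRe.trans (hN.arc_subset he₁.edge_mem))
      (hSe.trans (hN.arc_subset he₂.edge_mem)) ?_ he₁.right_mem ?_ hr' hs'
    · intro E hE u hu v hv huE hvE
      obtain rfl := hN.arc_eq hE he₁.edge_mem huE (hRe hu)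
      obtain rfl := hN.arc_eq hE he₂.edge_mem hvE (hSe hv)
      rcases he₁.inc_left.eq_or_eq_of_isLink he₂ with h | h
      · exact hxy h
      · exact hxc h
    · intro N hNH u hu v hv huN hvN
      rcases hN.end_of_mem he₁ (hRe hu) huN hNH with h | h
      · subst h
        exact absurd hvN (hnx v (hSe hv))
      · exact h
  · exact (Foot.of_subset_arc_of_mem hN he₁ hRe (by simp) (by simp)).union
      (Foot.of_subset_arc_of_mem hN he₂ hSe (by simp) (by simp))
  · rw [Set.union_inter_distrib_right, ha]
    have : S ∩ x = ∅ := by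
      ext v
      simp only [Set.mem_inter_iff, Set.mem_empty_iff_false, iff_false, not_and]
      exact fun hv => hnx v (hSe hv)
    rw [this, Set.union_empty]
  · rw [Set.union_inter_distrib_right, hb]
    have : R ∩ y = ∅ := by
      ext v
      simp only [Set.mem_inter_iff, Set.mem_empty_iff_false, iff_false, not_and]
      exact fun hv => hny v (hRe hv)
    rw [this, Set.empty_union]
  · refine Set.Subset.antisymm ?_ ?_
    · rintro v ⟨hv | hv, hvF⟩
      · exact hr' ▸ ⟨hv, hF₁ v (hRe hv) hvF⟩
      · have : v ∈ S ∩ c := ⟨hv, hF₂ v (hSe hv) hvF⟩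
        rw [hs'] at this
        exact absurd (Set.mem_singleton_iff.1 this ▸ hvF) hnF
    · rintro _ rfl
      exact ⟨Or.inl hmR, hmF⟩

end Legs

/-! ### Sprouts and linkages -/

section Sprouts

variable {V : Type*} {G : SimpleGraph V} {X Y F : Set V} {H : Graph (Set V) (Set V)}
  {L₁ L₂ L₃ : Set V} {M₁ M₂ D₃ : Set (Set V)}

lemma Ctx.not_hanging [Finite V] (hc : Ctx G X H Y) (ht : Triple H L₁ L₂ L₃) {x y e g P Q : Set V}
    (hM₁ : SConn (netGraph H) M₁) (hM₂ : SConn (netGraph H) M₂) (hL₁ : L₁ ∈ M₁) (hL₂ : L₂ ∈ M₂)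
    (hx : x ∈ M₁) (hy : y ∈ M₂) (h12 : Disjoint M₁ M₂)
    (hF₁ : Disjoint (inArcs H M₁) (nbrIn G X Y)) (hF₂ : Disjoint (inArcs H M₂) (nbrIn G X Y))
    (he : H.IsLink e x y) (h₃ : Leg H (nbrIn G X Y) L₃ D₃ g) (hD₁ : Disjoint M₁ D₃)
    (hD₂ : Disjoint M₂ D₃) (hPe : P ⊆ e) (hQe : Q ⊆ e) (hsep : Separated G P Q)
    (hP : IsRung G x y P) (hPF : Disjoint P (nbrIn G X Y)) (hQ : (G.induce Q).IsTree)
    (hQF : ∃ s, Q ∩ nbrIn G X Y = {s}) {w : V} (hQxy : Q ∩ (x ∪ y) = {w}) (hwx : w ∈ x) :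
    False := by
  have hN := hc.net.toIsNet
  have hwQ : w ∈ Q := (hQxy ▸ rfl : w ∈ Q ∩ (x ∪ y)).1
  have hQx : Q ∩ x = {w} := by
    refine Set.Subset.antisymm (fun v hv => ?_) (by rintro _ rfl; exact ⟨hwQ, hwx⟩)
    rw [← hQxy]
    exact ⟨hv.1, Or.inl hv.2⟩
  have hfr₁ := hN.free ht.leaf₁ hM₁ hL₁ hx hF₁
  have hfr₂ := hN.free ht.leaf₂ hM₂ hL₂ hy hF₂
  by_cases hwy : w ∈ y
  · refine hc.not_prong_arc ht hx hy hfr₁ hfr₂ h12 he hQ hQe ⟨w, hQx⟩ ⟨w, ?_⟩ hQF h₃ hD₁ hD₂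
    refine Set.Subset.antisymm (fun v hv => ?_) (by rintro _ rfl; exact ⟨hwQ, hwy⟩)
    rw [← hQxy]
    exact ⟨hv.1, Or.inr hv.2⟩
  have hQy : ∀ v ∈ Q, v ∉ y := fun v hv hvy => by
    have : v ∈ Q ∩ (x ∪ y) := ⟨hv, Or.inr hvy⟩
    rw [hQxy] at this
    exact hwy (Set.mem_singleton_iff.1 this ▸ hvy)
  obtain ⟨r, hr⟩ := hP.inter_left
  have hrP : r ∈ P ∩ x := hr ▸ rfl
  obtain ⟨s, hs⟩ := hQF
  rw [Set.disjoint_left] at h12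
  rcases hfr₁ with rfl | ⟨T, hTM, hT, hLT, ⟨v, hv⟩, hTF⟩
  · obtain ⟨z, rfl, -⟩ := hN.leaf_spec ht.leaf₁
    rw [Set.mem_singleton_iff] at hwx
    have := Set.mem_singleton_iff.1 hrP.2
    exact Set.disjoint_left.1 hsep.1 hrP.1 (by rw [this, ← hwx]; exact hwQ)
  have hTf := Foot.of_subset_inArcs hN hTM
  have hvT : v ∈ T ∩ x := hv ▸ rfl
  have hTe : ∀ E ∈ H.edgeSet, ∀ u ∈ T, u ∈ E → E ≠ e := by
    rintro E hE u hu huE rfl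
    rcases hTf.arc E hE u hu huE with h | ⟨h, -⟩
    · exact h12 (h y he.inc_right) hy
    · exact h
  have hTnode : ∀ N ∈ H.vertexSet, ∀ u ∈ T, ∀ z ∈ e, u ∈ N → z ∈ N → N = x := by
    intro N hNH u hu z hz huN hzN
    rcases hN.end_of_mem he hz hzN hNH with rfl | rfl
    · rfl
    · exact absurd hy (h12 (hTf.node N hNH u hu huN))
  have hK : (G.induce (T ∪ P)).IsTree :=
    hN.isTree_join hT hP.isTree hTf.subset (hPe.trans (hN.arc_subset he.edge_mem))
      (fun E hE u hu z hz huE hzE => hTe E hE u hu huE (hN.arc_eq hE he.edge_mem hzE (hPe hz)))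
      he.left_mem (fun N hNH u hu z hz => hTnode N hNH u hu z (hPe hz)) hv hr
  have hTX : ∀ u ∈ T, ∃ E ∈ H.edgeSet, u ∈ E ∧ E ≠ e := fun u hu => by
    obtain ⟨E, p, q, hl, huE⟩ := hN.exists_link (hTf.subset hu)
    exact ⟨E, hl.edge_mem, huE, hTe E hl.edge_mem u hu huE⟩
  have hB : (G.induce (T ∪ P ∪ Q)).IsTree := by
    refine isTree_union (a := v) (b := w) hK hQ ?_ (Or.inl hvT.1) hwQ ?_ ?_
    · rw [Set.disjoint_left]
      rintro u (hu | hu) huQ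
      · obtain ⟨E, hE, huE, hne⟩ := hTX u hu
        exact hne (hN.arc_eq hE he.edge_mem huE (hQe huQ))
      · exact Set.disjoint_left.1 hsep.1 hu huQ
    · obtain ⟨E, hE, huE, hne⟩ := hTX v hvT.1
      exact hN.adj_of_mem hE he.edge_mem hne huE (hQe hwQ) hvT.2 hwx he.left_mem
    · rintro u (hu | hu) z hz huz
      · obtain ⟨E, hE, huE, hne⟩ := hTX u hu
        obtain ⟨N, hNH, huN, hzN⟩ := hN.exists_node hE he.edge_mem hne huE (hQe hz) huz
        obtain rfl := hTnode N hNH u hu z (hQe hz) huN hzN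
        have h1 : u ∈ T ∩ N := ⟨hu, huN⟩
        have h2 : z ∈ Q ∩ N := ⟨hz, hzN⟩
        rw [hv] at h1
        rw [hQx] at h2
        exact ⟨h1, h2⟩
      · exact absurd huz (hsep.2 u hu z hz)
  obtain ⟨b, hb⟩ := hP.inter_right
  have hBe : ∀ u ∈ T ∪ P ∪ Q, u ∈ T ∨ (u ∈ e ∧ (u ∈ y → u ∈ P)) := by
    rintro u ((hu | hu) | hu)
    · exact Or.inl hu
    · exact Or.inr ⟨hPe hu, fun _ => hu⟩
    · exact Or.inr ⟨hQe hu, fun h => absurd h (hQy u hu)⟩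
  have hTy : ∀ u ∈ T, u ∉ y := fun u hu huy => h12 (hTf.node y he.right_mem u hu huy) hy
  obtain ⟨B', -, hB', hLB', T₂, hT₂, hT₂F, rfl⟩ := hN.attach ht.leaf₂ hfr₂ he.right_mem hB (b := b)
    (by
      rw [← hb]
      ext u
      constructor
      · rintro ⟨hu, huy⟩
        rcases hBe u hu with h | h
        · exact absurd huy (hTy u h)
        · exact ⟨h.2 huy, huy⟩
      · exact fun hu => ⟨Or.inl (Or.inr hu.1), hu.2⟩)
    (by
      intro u hu
      rcases hBe u hu with h | h
      · exact hTf.subset h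
      · exact hN.arc_subset he.edge_mem h.1)
    (by
      intro E p q hl u hu huE hp hq
      rcases hBe u hu with h | h
      · rcases hTf.arc E hl.edge_mem u h huE with h' | ⟨h', -⟩
        · exact h12 (h' p hl.inc_left) hp
        · exact h'
      · obtain rfl := hN.arc_eq hl.edge_mem he.edge_mem huE h.1
        rcases he.inc_left.eq_or_eq_of_isLink hl with rfl | rfl
        · exact h12 hx hp
        · exact h12 hx hq)
    (by
      intro N hNH u hu huN hNM
      rcases hBe u hu with h | h
      · exact absurd hNM (h12 (hTf.node N hNH u h huN))
      · rcases hN.end_of_mem he h.1 huN hNH with rfl | rfl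
        · exact absurd hNM (h12 hx)
        · rfl)
  refine hc.not_tree_leg ht (D := M₁ ∪ M₂) hB' ?_ hLB' (s := s) ?_ ?_ h₃
    (Set.disjoint_union_left.2 ⟨hD₁, hD₂⟩)
  · exact fun u hu => Or.inl (Or.inl (Or.inl (hLT hu)))
  · simp only [Set.union_inter_distrib_right]
    rw [hTF.inter_eq, hT₂F.inter_eq, hPF.inter_eq, hs]
    simp
  · have h1 : ∀ S ⊆ e, Foot H X S (M₁ ∪ M₂) ∅ := fun S hS =>
      Foot.of_subset_arc_of_mem hN he hS (Or.inl hx) (Or.inr hy)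
    exact (((hTf.mono Set.subset_union_left le_rfl).union (h1 P hPe)).union (h1 Q hQe)).union
      ((Foot.of_subset_inArcs hN hT₂).mono Set.subset_union_right le_rfl)

/-- An arc between `M₁` and `M₂` contains no sprout. -/
lemma Ctx.not_sprout [Finite V] (hc : Ctx G X H Y) (ht : Triple H L₁ L₂ L₃) {x y e g : Set V}
    (hM₁ : SConn (netGraph H) M₁) (hM₂ : SConn (netGraph H) M₂) (hL₁ : L₁ ∈ M₁) (hL₂ : L₂ ∈ M₂)
    (hx : x ∈ M₁) (hy : y ∈ M₂) (h12 : Disjoint M₁ M₂)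
    (hF₁ : Disjoint (inArcs H M₁) (nbrIn G X Y)) (hF₂ : Disjoint (inArcs H M₂) (nbrIn G X Y))
    (he : H.IsLink e x y) (h₃ : Leg H (nbrIn G X Y) L₃ D₃ g) (hD₁ : Disjoint M₁ D₃)
    (hD₂ : Disjoint M₂ D₃) : ¬ ∃ T ⊆ e, IsSprout G (nbrIn G X Y ∩ e) x y T := by
  have hN := hc.net.toIsNet
  have hinter : ∀ {S : Set V}, S ⊆ e → S ∩ (nbrIn G X Y ∩ e) = S ∩ nbrIn G X Y := by
    intro S hS
    ext v
    exact ⟨fun h => ⟨h.1, h.2.1⟩, fun h => ⟨h.1, h.2, hS h.1⟩⟩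
  have hdisj := Set.disjoint_left.1 h12
  rintro ⟨T, hTe, ⟨hT, hS, hTx, hTy⟩ | ⟨P, Q, rfl, hsep, hP, hPy, hQ, hQx⟩ |
    ⟨P, Q, rfl, hsep, hP, hPS, hQ⟩⟩
  · rw [hinter hTe] at hS
    exact hc.not_prong_arc ht hx hy (hN.free ht.leaf₁ hM₁ hL₁ hx hF₁)
      (hN.free ht.leaf₂ hM₂ hL₂ hy hF₂) h12 he hT hTe hTx hTy hS h₃ hD₁ hD₂
  · have hPe : P ⊆ e := Set.subset_union_left.trans hTe
    have hQe : Q ⊆ e := Set.subset_union_right.trans hTe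
    have hne : ∀ {U W R : Set V}, IsRung G U W R → (R ∩ U).Nonempty ∧ (R ∩ W).Nonempty := by
      intro U W R h
      obtain ⟨u, hu⟩ := h.inter_left
      obtain ⟨w, hw⟩ := h.inter_right
      exact ⟨hu ▸ Set.singleton_nonempty _, hw ▸ Set.singleton_nonempty _⟩
    obtain ⟨T₁, hT₁, hc₁, hl₁⟩ := hN.exists_conn ht.leaf₁ hM₁ hL₁ hx he (fun h => hdisj h hy)
      (isTree_sconn hP.isTree) hPe (hne hP).2
    obtain ⟨T₂, hT₂, hc₂, hl₂⟩ := hN.exists_conn ht.leaf₂ hM₂ hL₂ hy he.symm (hdisj hx)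
      (isTree_sconn hQ.isTree) hQe (hne hQ).2
    obtain ⟨Z, z1, z2, z3, z4⟩ := h₃.realize hN ht.leaf₃
    have f₁ := Foot.of_subset_inArcs hN hT₁
    have f₂ := Foot.of_subset_inArcs hN hT₂
    have fe : ∀ S ⊆ e, Foot H X S (M₁ ∪ M₂) ∅ := fun S hS =>
      Foot.of_subset_arc_of_mem hN he hS (Or.inl hx) (Or.inr hy)
    have fP : Foot H X P M₁ {e} := Foot.of_subset_arc hN he hPe hx
      fun v hv hvy => absurd hvy (Set.disjoint_left.1 hPy hv)
    have fQ : Foot H X Q M₂ {e} := Foot.of_subset_arc hN he.symm hQe hy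
      fun v hv hvx => absurd hvx (Set.disjoint_left.1 hQx hv)
    have hd := Set.disjoint_union_left.2 ⟨hD₁, hD₂⟩
    have g₁ := (fe P hPe).union (f₁.mono Set.subset_union_left le_rfl)
    have g₂ := (fe Q hQe).union (f₂.mono Set.subset_union_right le_rfl)
    obtain ⟨p, hp⟩ := (hne hP).1
    obtain ⟨q, hq⟩ := (hne hQ).1
    refine hc.not_three_sets ht hc₁ hc₂ z1 g₁.subset g₂.subset z4.subset hl₁ hl₂ z2
      ⟨p, Or.inl hp.1, hp.2.1⟩ ⟨q, Or.inl hq.1, hq.2.1⟩ z3 ?_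
      (g₁.separated hN z4 hd (Set.empty_disjoint _)) (g₂.separated hN z4 hd (Set.empty_disjoint _))
    refine Separated.union_left (hsep.union_right ?_) (Separated.union_right ?_ ?_)
    · exact fP.separated hN f₂ h12 (Set.disjoint_empty _)
    · exact f₁.separated hN fQ h12 (Set.empty_disjoint _)
    · exact f₁.separated hN f₂ h12 (Set.empty_disjoint _)
  · have hPe : P ⊆ e := Set.subset_union_left.trans hTe
    have hQe : Q ⊆ e := Set.subset_union_right.trans hTe
    have hPF : Disjoint P (nbrIn G X Y) := Set.disjoint_left.2 fun v hv hvF =>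
      Set.disjoint_left.1 hPS hv ⟨hvF, hPe hv⟩
    have hQF := hQ.inter_left
    rw [hinter hQe] at hQF
    obtain ⟨w, hw⟩ := hQ.inter_right
    have hwQ : w ∈ Q ∩ (x ∪ y) := hw ▸ rfl
    rcases hwQ.2 with hwx | hwy
    · exact hc.not_hanging ht hM₁ hM₂ hL₁ hL₂ hx hy h12 hF₁ hF₂ he h₃ hD₁ hD₂ hPe hQe hsep hP hPF
        hQ.isTree hQF hw hwx
    · rw [Set.union_comm] at hw
      exact hc.not_hanging ht.swap₁₂ hM₂ hM₁ hL₂ hL₁ hy hx h12.symm hF₂ hF₁ he.symm h₃ hD₂ hD₁ hPe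
        hQe hsep hP.symm hPF hQ.isTree hQF hw hwy

/-- Three nodes can be linked to the three leaf nodes. -/
lemma TightNet.exists_linkage [Finite V] (hT : TightNet G X H) {a b c : Set V}
    (ha : a ∈ H.vertexSet) (hb : b ∈ H.vertexSet) (hc : c ∈ H.vertexSet) (hab : a ≠ b)
    (hac : a ≠ c) (hbc : b ≠ c) : ∃ L₁ L₂ L₃ M₁ M₂ M₃, Triple H L₁ L₂ L₃ ∧
      SConn (netGraph H) M₁ ∧ SConn (netGraph H) M₂ ∧ SConn (netGraph H) M₃ ∧
      L₁ ∈ M₁ ∧ L₂ ∈ M₂ ∧ L₃ ∈ M₃ ∧ a ∈ M₁ ∧ b ∈ M₂ ∧ c ∈ M₃ ∧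
      Disjoint M₁ M₂ ∧ Disjoint M₁ M₃ ∧ Disjoint M₂ M₃ := by
  have hlink : Linked (netGraph H) {N | IsLeafNode H N} {a, b, c} 3 := by
    refine linked_of_forall_separates 3 _ _ _ _ rfl fun S hS => ?_
    by_contra hcard
    have hS2 : S.ncard ≤ 2 := by omega
    obtain ⟨z, hz, hzS⟩ : ∃ z ∈ ({a, b, c} : Set (Set V)), z ∉ S := by
      by_contra hcon
      push Not at hcon
      have h3 : ({a, b, c} : Set (Set V)).ncard = 3 :=
        Set.ncard_eq_three.2 ⟨a, b, c, hab, hac, hbc, rfl⟩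
      have := Set.ncard_le_ncard (show ({a, b, c} : Set (Set V)) ⊆ S from hcon) (Set.toFinite S)
      omega
    have hzH : z ∈ H.vertexSet := by
      rcases hz with rfl | rfl | hz
      exacts [ha, hb, (Set.mem_singleton_iff.1 hz) ▸ hc]
    have hzS' : z ∈ H.vertexSet \ S := ⟨hzH, hzS⟩
    set C := comp (netGraph H) (H.vertexSet \ S) z with hC
    have hleaf : ∀ N ∈ C, ¬ IsLeafNode H N := fun N hN hNl => by
      obtain ⟨p, hp⟩ := (comp_sconn hzS').exists_walk hN (mem_comp hzS')
      obtain ⟨v, hv, hvS⟩ := hS N hNl z hz p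
      exact (comp_subset (hp v hv)).2 hvS
    have hCS : ∀ N ∈ S, N ∉ C := fun N hN h => (comp_subset h).2 hN
    obtain ⟨U, W, hUW, hU, hW⟩ : ∃ U W, S ⊆ {U, W} ∧ U ∉ C ∧ W ∉ C := by
      rcases Nat.lt_or_ge S.ncard 2 with h | h
      · obtain rfl | ⟨U, rfl⟩ := (Set.ncard_le_one_iff_eq (Set.toFinite S)).1 (by omega)
        · obtain ⟨L, hL, -⟩ := hT.exists_leaf_ne z z
          exact ⟨L, L, Set.empty_subset _, fun h => hleaf L h hL, fun h => hleaf L h hL⟩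
        · exact ⟨U, U, by simp, hCS U rfl, hCS U rfl⟩
      · obtain ⟨U, W, -, rfl⟩ := Set.ncard_eq_two.1 (le_antisymm hS2 h)
        exact ⟨U, W, le_rfl, hCS U (by simp), hCS W (by simp)⟩
    obtain ⟨x, hx, y, hy, hyU, hyW, hxy⟩ := hT.exists_adj U W C
      (comp_subset.trans Set.sdiff_subset) ⟨z, mem_comp hzS'⟩ hU hW hleaf
    refine hy (comp_closed x hx y ⟨(netGraph_adj_mem hxy).2, fun h => ?_⟩ hxy)
    rcases hUW h with h | h
    · exact hyU h
    · exact hyW h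
  obtain ⟨s, t, p, hs, ht, -, hdisj⟩ := hlink
  have hinj : Function.Injective t := by
    intro i j hij
    by_contra hne
    exact hdisj i j hne (t i) (p i).end_mem_support (by rw [hij]; exact (p j).end_mem_support)
  have hsurj : ∀ v ∈ ({a, b, c} : Set (Set V)), ∃ i, t i = v :=
    surj_of_linked hinj ht (Set.ncard_eq_three.2 ⟨a, b, c, hab, hac, hbc, rfl⟩)
  obtain ⟨i, hi⟩ := hsurj a (by simp)
  obtain ⟨j, hj⟩ := hsurj b (by simp)
  obtain ⟨k, hk⟩ := hsurj c (by simp)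
  have hij : i ≠ j := by rintro rfl; exact hab (hi.symm.trans hj)
  have hik : i ≠ k := by rintro rfl; exact hac (hi.symm.trans hk)
  have hjk : j ≠ k := by rintro rfl; exact hbc (hj.symm.trans hk)
  have hsne : ∀ i j, i ≠ j → s i ≠ s j := fun i j hne h =>
    hdisj i j hne (s i) (p i).start_mem_support (by rw [h]; exact (p j).start_mem_support)
  refine ⟨s i, s j, s k, {N | N ∈ (p i).support}, {N | N ∈ (p j).support},
    {N | N ∈ (p k).support}, ⟨hs i, hs j, hs k, hsne i j hij, hsne i k hik, hsne j k hjk⟩,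
    sconn_support _, sconn_support _, sconn_support _, (p i).start_mem_support,
    (p j).start_mem_support, (p k).start_mem_support, ?_, ?_, ?_,
    Set.disjoint_left.2 (hdisj i j hij), Set.disjoint_left.2 (hdisj i k hik),
    Set.disjoint_left.2 (hdisj j k hjk)⟩
  · exact hi ▸ (p i).end_mem_support
  · exact hj ▸ (p j).end_mem_support
  · exact hk ▸ (p k).end_mem_support

end Sprouts

/-! ### Configurations -/

section Config

variable {V : Type*} {G : SimpleGraph V} {X Y F : Set V} {H : Graph (Set V) (Set V)}
  {L₁ L₂ L₃ : Set V} {M M₁ M₂ M₃ : Set (Set V)}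

lemma comp_diff_subset {a L : Set V} : comp (netGraph H) (M \ {a}) L ⊆ M :=
  comp_subset.trans Set.sdiff_subset

lemma notMem_comp_diff {a L : Set V} : a ∉ comp (netGraph H) (M \ {a}) L :=
  fun h => (comp_subset h).2 rfl

/-- An arc `e` between `M₁` and `M₂` with a vertex of `F`, and a leg for the third leaf node. -/
structure Start (H : Graph (Set V) (Set V)) (F L₁ L₂ L₃ : Set V) (M₁ M₂ M₃ : Set (Set V))
    (u w e g : Set V) : Prop where
  triple : Triple H L₁ L₂ L₃
  sconn₁ : SConn (netGraph H) M₁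
  sconn₂ : SConn (netGraph H) M₂
  mem₁ : L₁ ∈ M₁
  mem₂ : L₂ ∈ M₂
  disj₁₂ : Disjoint M₁ M₂
  disj₁₃ : Disjoint M₁ M₃
  disj₂₃ : Disjoint M₂ M₃
  left : u ∈ M₁
  right : w ∈ M₂
  link : H.IsLink e u w
  meets : ∃ s ∈ e, s ∈ F
  leg : Leg H F L₃ M₃ g

lemma Start.swap {u w e g : Set V} (h : Start H F L₁ L₂ L₃ M₁ M₂ M₃ u w e g) :
    Start H F L₂ L₁ L₃ M₂ M₁ M₃ w u e g :=
  ⟨h.triple.swap₁₂, h.sconn₂, h.sconn₁, h.mem₂, h.mem₁, h.disj₁₂.symm, h.disj₂₃, h.disj₁₃, h.right,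
    h.left, h.link.symm, h.meets, h.leg⟩

lemma start_of_avoid {a b c d e f : Set V} {s t : V} (ht : Triple H L₁ L₂ L₃)
    (h₁ : SConn (netGraph H) M₁) (h₂ : SConn (netGraph H) M₂) (h₃ : SConn (netGraph H) M₃)
    (m₁ : L₁ ∈ M₁) (m₂ : L₂ ∈ M₂) (m₃ : L₃ ∈ M₃) (d₁₂ : Disjoint M₁ M₂) (d₁₃ : Disjoint M₁ M₃)
    (d₂₃ : Disjoint M₂ M₃) (ha : a ∈ M₁) (hb : b ∈ M₂) (hc : c ∈ M₃) (he : H.IsLink e a b)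
    (hf : H.IsLink f c d) (hs : s ∈ e) (hsF : s ∈ F) (htf : t ∈ f) (htF : t ∈ F)
    (hd : t ∈ d → d ∉ M₁ ∧ d ∉ M₂) : ∃ M₃', Start H F L₁ L₂ L₃ M₁ M₂ M₃' a b e f := by
  by_cases htd : t ∈ d
  · refine ⟨insert d M₃, ht, h₁, h₂, m₁, m₂, d₁₂, ?_, ?_, ha, hb, he, ⟨s, hs, hsF⟩,
      M₃, Set.subset_insert _ _, h₃, m₃, c, hc, d, hf, t, htf, htF, fun _ => Or.inl rfl⟩
    · exact Set.disjoint_insert_right.2 ⟨(hd htd).1, d₁₃⟩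
    · exact Set.disjoint_insert_right.2 ⟨(hd htd).2, d₂₃⟩
  · exact ⟨M₃, ht, h₁, h₂, m₁, m₂, d₁₂, d₁₃, d₂₃, ha, hb, he, ⟨s, hs, hsF⟩,
      M₃, le_rfl, h₃, m₃, c, hc, d, hf, t, htf, htF, fun h => absurd h htd⟩

lemma start_of_mem {a b c d e f : Set V} {s t : V}
    (ht : Triple H L₁ L₂ L₃)
    (h₁ : SConn (netGraph H) M₁) (h₂ : SConn (netGraph H) M₂) (h₃ : SConn (netGraph H) M₃)
    (m₁ : L₁ ∈ M₁) (m₂ : L₂ ∈ M₂) (m₃ : L₃ ∈ M₃) (d₁₂ : Disjoint M₁ M₂) (d₁₃ : Disjoint M₁ M₃)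
    (d₂₃ : Disjoint M₂ M₃) (ha : a ∈ M₁) (hb : b ∈ M₂) (hc : c ∈ M₃) (he : H.IsLink e a b)
    (hf : H.IsLink f c d) (hs : s ∈ e) (hsF : s ∈ F) (htf : t ∈ f) (htF : t ∈ F)
    (hst : ∀ N ∈ H.vertexSet, s ∈ N → t ∉ N) (htd : t ∈ d) (hd : d ∈ M₁) :
    ∃ L₁ L₂ L₃ M₁ M₂ M₃ u w e g, Start H F L₁ L₂ L₃ M₁ M₂ M₃ u w e g := by
  by_cases hda : d = a
  · subst hda
    exact ⟨_, _, _, _, _, _, _, _, _, _, ht.swap₁₃.swap₂₃, h₃, h₁, m₃, m₁, d₁₃.symm, d₂₃.symm, d₁₂,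
      hc, hd, hf, ⟨t, htf, htF⟩, M₂, le_rfl, h₂, m₂, b, hb, d, he.symm, s, hs, hsF,
      fun h => absurd htd (hst d hf.right_mem h)⟩
  by_cases hcomp : L₁ ≠ a ∧ d ∈ comp (netGraph H) (M₁ \ {a}) L₁
  · have hLa : L₁ ∈ M₁ \ {a} := ⟨m₁, hcomp.1⟩
    exact ⟨_, _, _, _, _, insert a M₂, _, _, _, _, ht.swap₁₃.swap₂₃, h₃,
      comp_sconn hLa, m₃, mem_comp hLa, (d₁₃.mono_left comp_diff_subset).symm,
      Set.disjoint_insert_right.2 ⟨fun h => Set.disjoint_left.1 d₁₃ ha h, d₂₃.symm⟩,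
      Set.disjoint_insert_right.2 ⟨notMem_comp_diff, d₁₂.mono_left comp_diff_subset⟩, hc, hcomp.2, hf, ⟨t, htf, htF⟩,
      M₂, Set.subset_insert _ _, h₂, m₂, b, hb, a, he.symm, s, hs, hsF, fun _ => Or.inl rfl⟩
  · have h1 : L₁ ≠ d ∧ a ∈ comp (netGraph H) (M₁ \ {d}) L₁ := by
      by_cases hLa : L₁ = a
      · subst hLa
        exact ⟨fun h => hda h.symm, mem_comp ⟨m₁, fun h => hda h.symm⟩⟩
      · have h2 : d ∉ comp (netGraph H) (M₁ \ {a}) L₁ := fun h => hcomp ⟨hLa, h⟩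
        refine ⟨?_, h₁.comp_diff_or m₁ ha hLa h2 (fun h => hda h.symm)⟩
        rintro rfl
        exact h2 (mem_comp ⟨m₁, hLa⟩)
    have hLd : L₁ ∈ M₁ \ {d} := ⟨m₁, h1.1⟩
    obtain ⟨M₃', h⟩ := start_of_avoid ht (comp_sconn hLd) h₂ h₃ (mem_comp hLd) m₂ m₃
      (d₁₂.mono_left comp_diff_subset) (d₁₃.mono_left comp_diff_subset) d₂₃ h1.2 hb hc he hf hs hsF htf htF
      (fun _ => ⟨notMem_comp_diff, Set.disjoint_left.1 d₁₂ hd⟩)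
    exact ⟨_, _, _, _, _, _, _, _, _, _, h⟩

lemma Ctx.exists_start [Finite V] (hc : Ctx G X H Y) : ∃ L₁ L₂ L₃ M₁ M₂ M₃ u w e g,
    Start H (nbrIn G X Y) L₁ L₂ L₃ M₁ M₂ M₃ u w e g := by
  have hN := hc.net.toIsNet
  have hun := hc.wild.prop.2.2
  unfold Tamed at hun
  push Not at hun
  obtain ⟨s, hs, t, htF, harc, hnode⟩ := hun
  obtain ⟨e, a, b, he, hse⟩ := hN.exists_link hs.1
  obtain ⟨f, c, d, hf, htf⟩ := hN.exists_link htF.1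
  have hef : e ≠ f := by
    rintro rfl
    exact harc e he.edge_mem hse htf
  have hab := hN.loopless _ _ _ he
  have hcd := hN.loopless _ _ _ hf
  have key : ∀ c d, H.IsLink f c d → c ≠ a → c ≠ b → ∃ L₁ L₂ L₃ M₁ M₂ M₃ u w e g,
      Start H (nbrIn G X Y) L₁ L₂ L₃ M₁ M₂ M₃ u w e g := by
    intro c d hf hca hcb
    obtain ⟨L₁, L₂, L₃, M₁, M₂, M₃, ht, h₁, h₂, h₃, m₁, m₂, m₃, ha, hb, hc', d₁₂, d₁₃, d₂₃⟩ :=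
      hc.net.exists_linkage he.left_mem he.right_mem hf.left_mem hab hca.symm hcb.symm
    by_cases hd₁ : t ∈ d ∧ d ∈ M₁
    · exact start_of_mem ht h₁ h₂ h₃ m₁ m₂ m₃ d₁₂ d₁₃ d₂₃ ha hb hc' he hf hse hs htf htF hnode
        hd₁.1 hd₁.2
    by_cases hd₂ : t ∈ d ∧ d ∈ M₂
    · exact start_of_mem ht.swap₁₂ h₂ h₁ h₃ m₂ m₁ m₃ d₁₂.symm d₂₃ d₁₃ hb ha hc' he.symm hf hse
        hs htf htF hnode hd₂.1 hd₂.2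
    obtain ⟨M₃', h⟩ := start_of_avoid ht h₁ h₂ h₃ m₁ m₂ m₃ d₁₂ d₁₃ d₂₃ ha hb hc' he hf hse hs htf htF
      (fun h => ⟨fun h' => hd₁ ⟨h, h'⟩, fun h' => hd₂ ⟨h, h'⟩⟩)
    exact ⟨_, _, _, _, _, _, _, _, _, _, h⟩
  by_cases h1 : c = a ∨ c = b
  · by_cases h2 : d = a ∨ d = b
    · exfalso
      rcases h1 with rfl | rfl <;> rcases h2 with rfl | rfl
      · exact hcd rfl
      · exact hef (hc.net.simple he hf)
      · exact hef (hc.net.simple he hf.symm)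
      · exact hcd rfl
    · push Not at h2
      exact key d c hf.symm h2.1 h2.2
  · push Not at h1
    exact key c d hf h1.1 h1.2

/-- A node `u` can be joined to a leaf node avoiding `F`, unless a vertex of `F` gets in the way. -/
lemma IsNet.free_or_leg [Finite V] (hN : IsNet G X H) {L u : Set V} (hL : IsLeafNode H L)
    (hM : SConn (netGraph H) M) (hLM : L ∈ M) (hu : u ∈ M) (huL : u ≠ L) :
    Free G H F M L u ∨
    (∃ g, Leg H F L (comp (netGraph H) (M \ {u}) L) g ∧ ∀ N, H.Inc g N → N ∈ M) ∨
    ∃ x ∈ comp (netGraph H) (M \ {u}) L, ∃ g p, H.IsLink g x u ∧ p ∈ g ∧ p ∈ u ∧ p ∈ F := by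
  have hLM' : L ∈ M \ {u} := ⟨hLM, huL.symm⟩
  set M' := comp (netGraph H) (M \ {u}) L with hM'
  have hsub : M' ⊆ M := comp_subset.trans Set.sdiff_subset
  have huM' : u ∉ M' := fun h => (comp_subset h).2 rfl
  obtain ⟨x, hx, -, g, hg⟩ := hM.exists_comp_diff_adj hLM hu huL.symm
  by_cases h1 : Disjoint (inArcs H M') F
  · by_cases h2 : ∃ p ∈ g, p ∈ F
    · obtain ⟨p, hp, hpF⟩ := h2
      by_cases hpu : p ∈ u
      · exact Or.inr (Or.inr ⟨x, hx, g, p, hg, hp, hpu, hpF⟩)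
      · refine Or.inr (Or.inl ⟨g, ⟨M', le_rfl, comp_sconn hLM', mem_comp hLM', x, hx, u, hg, p, hp,
          hpF, fun h => absurd h hpu⟩, fun N hNg => ?_⟩)
        rcases hNg.eq_or_eq_of_isLink hg with rfl | rfl
        · exact hsub hx
        · exact hu
    · left
      push Not at h2
      obtain ⟨w, hw, -⟩ := hN.exists_mem hg
      obtain ⟨R, hRg, -, hR⟩ := hN.exists_rung _ _ _ hg w hw
      obtain ⟨b, hb⟩ := hR.inter_left
      obtain ⟨B, hRB, hB, hLB, T, hT, hTF, rfl⟩ := hN.attach (M := M') (F := F) (B := R) (x := x)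
        hL (hN.free hL (comp_sconn hLM') (mem_comp hLM') hx h1) hg.left_mem hR.isTree hb
        (hRg.trans (hN.arc_subset hg.edge_mem))
        (fun E p q hl v hv hvE hp hq => by
          obtain rfl := hN.arc_eq hl.edge_mem hg.edge_mem hvE (hRg hv)
          rcases hg.inc_right.eq_or_eq_of_isLink hl with rfl | rfl <;> contradiction)
        (fun N hNH v hv hvN hNM => by
          rcases hN.end_of_mem hg (hRg hv) hvN hNH with rfl | rfl
          · rfl
          · exact absurd hNM huM')
      obtain ⟨c, hc⟩ := hR.inter_right
      refine Or.inr ⟨R ∪ T, Set.union_subset (fun v hv => ⟨g, x, u, hg, hsub hx, hu, hRg hv⟩)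
        (hT.trans (inArcs_mono hsub)), hB, hLB, ⟨c, ?_⟩, ?_⟩
      · rw [Set.union_inter_distrib_right, hc]
        have : T ∩ u = ∅ := by
          ext v
          simp only [Set.mem_inter_iff, Set.mem_empty_iff_false, iff_false, not_and]
          exact fun hv hvu => huM' ((Foot.of_subset_inArcs hN hT).node u hg.right_mem v hv hvu)
        rw [this, Set.union_empty]
      · exact Set.disjoint_union_left.2 ⟨Set.disjoint_left.2 fun v hv => h2 v (hRg hv), hTF⟩
  · right; left
    obtain ⟨v, ⟨E, p, q, hl, hp, hq, hv⟩, hvF⟩ := Set.not_disjoint_iff.1 h1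
    refine ⟨E, ⟨M', le_rfl, comp_sconn hLM', mem_comp hLM', p, hp, q, hl, v, hv, hvF, fun _ => hq⟩,
      fun N hNE => ?_⟩
    rcases hNE.eq_or_eq_of_isLink hl with rfl | rfl
    · exact hsub hp
    · exact hsub hq

/-- A vertex `p` of the arc `e` with end-nodes `x` and `o`. -/
structure Port (V : Type*) where
  x : Set V
  e : Set V
  o : Set V
  p : V

/-- The port `P` belongs to the node set `M` and provides a vertex of `F`. -/
structure IsPort (H : Graph (Set V) (Set V)) (F : Set V) (M : Set (Set V)) (P : Port V) :
    Prop where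
  mem : P.x ∈ M
  link : H.IsLink P.e P.x P.o
  p_mem : P.p ∈ P.e
  p_mem' : P.p ∈ F

/-- Disjoint connected node sets for the three leaf nodes, where `M₁` and `M₂` have ports at a
common node `α` outside of them (`A = {α}`), or in a common arc `α` between them (`A = ∅`), and
`M₃` has a leg that avoids `α`. -/
structure Cfg (H : Graph (Set V) (Set V)) (F L₁ L₂ L₃ : Set V) (A : Set (Set V)) (α : Set V)
    (P₁ P₂ : Port V) (M₁ M₂ M₃ : Set (Set V)) : Prop where
  triple : Triple H L₁ L₂ L₃
  sconn₁ : SConn (netGraph H) M₁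
  sconn₂ : SConn (netGraph H) M₂
  sconn₃ : SConn (netGraph H) M₃
  mem₁ : L₁ ∈ M₁
  mem₂ : L₂ ∈ M₂
  mem₃ : L₃ ∈ M₃
  disj₁₂ : Disjoint M₁ M₂
  disj₁₃ : Disjoint M₁ M₃
  disj₂₃ : Disjoint M₂ M₃
  disjA₁ : Disjoint M₁ A
  disjA₂ : Disjoint M₂ A
  disjA₃ : Disjoint M₃ A
  port₁ : IsPort H F M₁ P₁
  port₂ : IsPort H F M₂ P₂
  kind : (A = {α} ∧ P₁.o = α ∧ P₂.o = α ∧ P₁.p ∈ α ∧ P₂.p ∈ α) ∨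
    (A = ∅ ∧ P₁.e = α ∧ P₂.e = α ∧ P₁.o = P₂.x ∧ P₂.o = P₁.x ∧ P₁.p ∉ P₂.x ∧ P₂.p ∉ P₁.x)
  leg : ∃ g, Leg H (F \ α) L₃ M₃ g

lemma Leg.diff_node {a L g : Set V} (hN : IsNet G X H) (h : Leg H F L M g) (ha : a ∈ H.vertexSet)
    (haM : a ∉ M) : Leg H (F \ a) L M g := by
  obtain ⟨M', hM'M, hM', hLM', c, hc, d, hl, v, hv, hvF, hd⟩ := h
  refine ⟨M', hM'M, hM', hLM', c, hc, d, hl, v, hv, ⟨hvF, fun hva => ?_⟩, hd⟩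
  rcases hN.end_of_mem hl hv hva ha with rfl | rfl
  · exact haM (hM'M hc)
  · exact haM (hd hva)

lemma Leg.diff_arc {e u w L g : Set V} (hN : IsNet G X H) (h : Leg H F L M g) (he : H.IsLink e u w)
    (hu : u ∉ M) (hw : w ∉ M) : Leg H (F \ e) L M g := by
  obtain ⟨M', hM'M, hM', hLM', c, hc, d, hl, v, hv, hvF, hd⟩ := h
  refine ⟨M', hM'M, hM', hLM', c, hc, d, hl, v, hv, ⟨hvF, fun hve => ?_⟩, hd⟩
  obtain rfl := hN.arc_eq hl.edge_mem he.edge_mem hv hve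
  rcases hl.inc_left.eq_or_eq_of_isLink he with rfl | rfl
  · exact hu (hM'M hc)
  · exact hw (hM'M hc)

lemma Leg.ne_of_ends {L g : Set V} (h : Leg H F L M g) {g' p q : Set V} (hl : H.IsLink g' p q)
    (hp : p ∉ M) (hq : q ∉ M) : g' ≠ g := by
  rintro rfl
  obtain ⟨N, hN, hinc⟩ := h.exists_end
  rcases hinc.eq_or_eq_of_isLink hl with rfl | rfl <;> contradiction

lemma Ctx.exists_cfg_of_subset [Finite V] (hc : Ctx G X H Y) {u w e g : Set V}
    (h : Start H (nbrIn G X Y) L₁ L₂ L₃ M₁ M₂ M₃ u w e g)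
    (hu : ∀ v ∈ e, v ∈ nbrIn G X Y → v ∈ u) : ∃ L₁ L₂ L₃ A α P₁ P₂ M₁ M₂ M₃,
      Cfg H (nbrIn G X Y) L₁ L₂ L₃ A α P₁ P₂ M₁ M₂ M₃ := by
  have hN := hc.net.toIsNet
  obtain ⟨N₃, hN₃M, hN₃, hL₃, hleg⟩ := h.leg.exists_sconn hN
  have d₁₃ := h.disj₁₃.mono_right hN₃M
  have d₂₃ := h.disj₂₃.mono_right hN₃M
  obtain ⟨ht, s₁, s₂, m₁, m₂, d₁₂, -, -, huM, hwM, he, ⟨s, hse, hsF⟩, -⟩ := h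
  have huL : u ≠ L₁ := by
    rintro rfl
    exact hc.leaf_disjoint ht.leaf₁ (hu s hse hsF) hsF
  have hu₂ := Set.disjoint_left.1 d₁₂ huM
  have hw₁ := Set.disjoint_right.1 d₁₂ hwM
  have hu₃ := Set.disjoint_left.1 d₁₃ huM
  have hw₃ := Set.disjoint_left.1 d₂₃ hwM
  rcases hN.free_or_leg (F := nbrIn G X Y) ht.leaf₁ s₁ m₁ huM huL with
    hfree | ⟨g', hg', hgM⟩ | ⟨x, hx, g', p, hl, hp, hpu, hpF⟩
  · have hM₂ : Free G H (nbrIn G X Y) M₂ L₂ w ∨ w ≠ L₂ := (eq_or_ne w L₂).imp_left Or.inl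
    rcases hM₂.elim Or.inl (fun hwL => (hN.free_or_leg (F := nbrIn G X Y) ht.leaf₂ s₂ m₂ hwM hwL).imp_right
        (And.intro hwL)) with
      hfree' | ⟨hwL, ⟨g', hg', hgM⟩ | ⟨x, hx, g', p, hl, hp, hpw, hpF⟩⟩
    · exfalso
      obtain ⟨R, hRe, hsR, hR⟩ := hN.exists_rung _ _ _ he s hse
      obtain ⟨r, hr⟩ := hR.inter_left
      refine hc.not_prong_arc ht huM hwM hfree hfree' d₁₂ he hR.isTree hRe hR.inter_left
        hR.inter_right ⟨s, ?_⟩ hleg d₁₃ d₂₃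
      refine Set.Subset.antisymm (fun v hv => ?_) (by rintro _ rfl; exact ⟨hsR, hsF⟩)
      rw [← inter_singleton_of_mem hr hsR (hu s hse hsF)]
      exact ⟨hv.1, hu v (hRe hv.1) hv.2⟩
    · exfalso
      refine hc.not_three_legs ht (D₁ := insert w M₁) (g₁ := e) ⟨M₁, Set.subset_insert _ _, s₁, m₁, u,
        huM, w, he, s, hse, hsF, fun _ => Or.inl rfl⟩ hg' hleg ?_ ?_ (d₂₃.mono_left comp_diff_subset)
        (hg'.ne_of_ends he (fun h => hu₂ (comp_diff_subset h)) notMem_comp_diff) (hleg.ne_of_ends he hu₃ hw₃) ?_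
      · exact Set.disjoint_insert_left.2 ⟨notMem_comp_diff, d₁₂.mono_right comp_diff_subset⟩
      · exact Set.disjoint_insert_left.2 ⟨hw₃, d₁₃⟩
      · rintro rfl
        obtain ⟨N, hN', hinc⟩ := hleg.exists_end
        exact Set.disjoint_left.1 d₂₃ (hgM N hinc) hN'
    · by_cases hsw : s ∈ w
      · refine ⟨L₁, L₂, L₃, {w}, w, ⟨u, e, w, s⟩, ⟨x, g', w, p⟩, M₁, comp (netGraph H) (M₂ \ {w}) L₂,
          N₃, ht, s₁, comp_sconn ⟨m₂, fun h => hwL h.symm⟩, hN₃, m₁,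
          mem_comp ⟨m₂, fun h => hwL h.symm⟩, hL₃, d₁₂.mono_right comp_diff_subset, d₁₃, d₂₃.mono_left comp_diff_subset,
          Set.disjoint_singleton_right.2 hw₁, Set.disjoint_singleton_right.2 notMem_comp_diff,
          Set.disjoint_singleton_right.2 hw₃, ⟨huM, he, hse, hsF⟩, ⟨hx, hl, hp, hpF⟩,
          Or.inl ⟨rfl, rfl, rfl, hsw, hpw⟩, g, hleg.diff_node hN he.right_mem hw₃⟩
      · exfalso
        refine hc.not_three_legs ht (D₁ := M₁) (g₁ := e) (D₂ := M₂) (g₂ := g')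
          ⟨M₁, le_rfl, s₁, m₁, u, huM, w, he, s, hse, hsF, fun h => absurd h hsw⟩
          ⟨M₂, le_rfl, s₂, m₂, x, comp_diff_subset hx, w, hl, p, hp, hpF, fun _ => hwM⟩ hleg d₁₂ d₁₃ d₂₃ ?_
          (hleg.ne_of_ends he hu₃ hw₃)
          (hleg.ne_of_ends hl (Set.disjoint_left.1 d₂₃ (comp_diff_subset hx)) hw₃)
        rintro rfl
        rcases he.inc_left.eq_or_eq_of_isLink hl with rfl | rfl
        · exact hu₂ (comp_diff_subset hx)
        · exact hu₂ hwM
  · exfalso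
    refine hc.not_three_legs ht (D₂ := insert u M₂) (g₂ := e) hg' ⟨M₂, Set.subset_insert _ _, s₂, m₂,
      w, hwM, u, he.symm, s, hse, hsF, fun _ => Or.inl rfl⟩ hleg ?_ (d₁₃.mono_left comp_diff_subset) ?_
      (hg'.ne_of_ends he notMem_comp_diff (fun h => hw₁ (comp_diff_subset h))).symm ?_ (hleg.ne_of_ends he hu₃ hw₃)
    · exact Set.disjoint_insert_right.2 ⟨notMem_comp_diff, d₁₂.mono_left comp_diff_subset⟩
    · exact Set.disjoint_insert_left.2 ⟨hu₃, d₂₃⟩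
    · rintro rfl
      obtain ⟨N, hN', hinc⟩ := hleg.exists_end
      exact Set.disjoint_left.1 d₁₃ (hgM N hinc) hN'
  · exact ⟨L₁, L₂, L₃, {u}, u, ⟨x, g', u, p⟩, ⟨w, e, u, s⟩, comp (netGraph H) (M₁ \ {u}) L₁, M₂, N₃,
      ht, comp_sconn ⟨m₁, fun h => huL h.symm⟩, s₂, hN₃, mem_comp ⟨m₁, fun h => huL h.symm⟩, m₂, hL₃,
      d₁₂.mono_left comp_diff_subset, d₁₃.mono_left comp_diff_subset, d₂₃, Set.disjoint_singleton_right.2 notMem_comp_diff,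
      Set.disjoint_singleton_right.2 hu₂, Set.disjoint_singleton_right.2 hu₃, ⟨hx, hl, hp, hpF⟩,
      ⟨hwM, he.symm, hse, hsF⟩, Or.inl ⟨rfl, rfl, rfl, hpu, hu s hse hsF⟩, g,
      hleg.diff_node hN he.left_mem hu₃⟩

lemma Ctx.exists_cfg [Finite V] (hc : Ctx G X H Y) : ∃ L₁ L₂ L₃ A α P₁ P₂ M₁ M₂ M₃,
    Cfg H (nbrIn G X Y) L₁ L₂ L₃ A α P₁ P₂ M₁ M₂ M₃ := by
  obtain ⟨L₁, L₂, L₃, M₁, M₂, M₃, u, w, e, g, h⟩ := hc.exists_start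
  by_cases hu : ∀ v ∈ e, v ∈ nbrIn G X Y → v ∈ u
  · exact hc.exists_cfg_of_subset h hu
  by_cases hw : ∀ v ∈ e, v ∈ nbrIn G X Y → v ∈ w
  · exact hc.exists_cfg_of_subset h.swap hw
  push Not at hu hw
  obtain ⟨p₂, hp₂, hp₂F, hp₂u⟩ := hu
  obtain ⟨p₁, hp₁, hp₁F, hp₁w⟩ := hw
  have hN := hc.net.toIsNet
  obtain ⟨N₃, hN₃M, hN₃, hL₃, hleg⟩ := h.leg.exists_sconn hN
  have d₁₃ := h.disj₁₃.mono_right hN₃M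
  have d₂₃ := h.disj₂₃.mono_right hN₃M
  exact ⟨L₁, L₂, L₃, ∅, e, ⟨u, e, w, p₁⟩, ⟨w, e, u, p₂⟩, M₁, M₂, N₃, h.triple, h.sconn₁, h.sconn₂, hN₃,
    h.mem₁, h.mem₂, hL₃, h.disj₁₂, d₁₃, d₂₃, Set.disjoint_empty _, Set.disjoint_empty _,
    Set.disjoint_empty _, ⟨h.left, h.link, hp₁, hp₁F⟩, ⟨h.right, h.link.symm, hp₂, hp₂F⟩,
    Or.inr ⟨rfl, rfl, rfl, rfl, rfl, hp₁w, hp₂u⟩, g, hleg.diff_arc hN h.link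
      (Set.disjoint_left.1 d₁₃ h.left) (Set.disjoint_left.1 d₂₃ h.right)⟩

end Config

/-! ### Analysis of configurations -/

section Analysis

variable {V : Type*} {G : SimpleGraph V} {X Y F : Set V} {H : Graph (Set V) (Set V)}
  {L₁ L₂ L₃ α : Set V} {A M M₁ M₂ M₃ N₃ : Set (Set V)} {P₁ P₂ : Port V}

/-- The arc `g` has an end in `M`, and if the other end is not in `M`, then it does not contain the
vertex `v` of `g`. -/
def Serves (H : Graph (Set V) (Set V)) (M : Set (Set V)) (g : Set V) (v : V) : Prop :=
  v ∈ g ∧ ∃ c ∈ M, ∃ d, H.IsLink g c d ∧ (v ∈ d → d ∈ M)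

lemma Serves.leg {L g : Set V} {v : V} (h : Serves H M g v) (hv : v ∈ F)
    (hM : SConn (netGraph H) M) (hL : L ∈ M) : Leg H F L M g := by
  obtain ⟨hvg, c, hc, d, hl, hd⟩ := h
  exact ⟨M, le_rfl, hM, hL, c, hc, d, hl, v, hvg, hv, hd⟩

lemma Leg.exists_serves {L g : Set V} (h : Leg H F L M g) : ∃ v ∈ F, Serves H M g v := by
  obtain ⟨M', hM', -, -, c, hc, d, hl, v, hv, hvF, hd⟩ := h
  exact ⟨v, hvF, hv, c, hM' hc, d, hl, hd⟩

lemma Serves.exists_end {g p q : Set V} {v : V} (h : Serves H M g v) (hl : H.IsLink g p q) :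
    p ∈ M ∨ q ∈ M := by
  obtain ⟨-, c, hc, d, hl', -⟩ := h
  rcases hl'.inc_left.eq_or_eq_of_isLink hl with rfl | rfl
  · exact Or.inl hc
  · exact Or.inr hc

namespace Cfg

lemma swap (c : Cfg H F L₁ L₂ L₃ A α P₁ P₂ M₁ M₂ M₃) : Cfg H F L₂ L₁ L₃ A α P₂ P₁ M₂ M₁ M₃ where
  triple := c.triple.swap₁₂
  sconn₁ := c.sconn₂
  sconn₂ := c.sconn₁
  sconn₃ := c.sconn₃
  mem₁ := c.mem₂
  mem₂ := c.mem₁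
  mem₃ := c.mem₃
  disj₁₂ := c.disj₁₂.symm
  disj₁₃ := c.disj₂₃
  disj₂₃ := c.disj₁₃
  disjA₁ := c.disjA₂
  disjA₂ := c.disjA₁
  disjA₃ := c.disjA₃
  port₁ := c.port₂
  port₂ := c.port₁
  kind := by
    rcases c.kind with ⟨h1, h2, h3, h4, h5⟩ | ⟨h1, h2, h3, h4, h5, h6, h7⟩
    · exact Or.inl ⟨h1, h3, h2, h5, h4⟩
    · exact Or.inr ⟨h1, h3, h2, h5, h4, h7, h6⟩
  leg := c.leg

lemma insert₁ (c : Cfg H F L₁ L₂ L₃ A α P₁ P₂ M₁ M₂ M₃) {x y : Set V} (hy : y ∈ M₁)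
    (hyx : (netGraph H).Adj y x) (h₂ : x ∉ M₂) (h₃ : x ∉ M₃) (hA : x ∉ A) :
    Cfg H F L₁ L₂ L₃ A α P₁ P₂ (insert x M₁) M₂ M₃ :=
  { c with
    sconn₁ := c.sconn₁.insert_of_adj hy hyx
    mem₁ := Or.inr c.mem₁
    disj₁₂ := Set.disjoint_insert_left.2 ⟨h₂, c.disj₁₂⟩
    disj₁₃ := Set.disjoint_insert_left.2 ⟨h₃, c.disj₁₃⟩
    disjA₁ := Set.disjoint_insert_left.2 ⟨hA, c.disjA₁⟩
    port₁ := { c.port₁ with mem := Or.inr c.port₁.mem } }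

lemma insert₃ (c : Cfg H F L₁ L₂ L₃ A α P₁ P₂ M₁ M₂ M₃) {x y : Set V} (hy : y ∈ M₃)
    (hyx : (netGraph H).Adj y x) (h₁ : x ∉ M₁) (h₂ : x ∉ M₂) (hA : x ∉ A) :
    Cfg H F L₁ L₂ L₃ A α P₁ P₂ M₁ M₂ (insert x M₃) :=
  { c with
    sconn₃ := c.sconn₃.insert_of_adj hy hyx
    mem₃ := Or.inr c.mem₃
    disj₁₃ := Set.disjoint_insert_right.2 ⟨h₁, c.disj₁₃⟩
    disj₂₃ := Set.disjoint_insert_right.2 ⟨h₂, c.disj₂₃⟩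
    disjA₃ := Set.disjoint_insert_left.2 ⟨hA, c.disjA₃⟩
    leg := by
      obtain ⟨g, hg⟩ := c.leg
      exact ⟨g, hg.mono le_rfl (Set.subset_insert _ _)⟩ }

lemma restrict₃ (c : Cfg H F L₁ L₂ L₃ A α P₁ P₂ M₁ M₂ M₃) (hN : N₃ ⊆ M₃)
    (hs : SConn (netGraph H) N₃) (hL : L₃ ∈ N₃) {g : Set V} (hleg : Leg H (F \ α) L₃ N₃ g) :
    Cfg H F L₁ L₂ L₃ A α P₁ P₂ M₁ M₂ N₃ :=
  { c with
    sconn₃ := hs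
    mem₃ := hL
    disj₁₃ := c.disj₁₃.mono_right hN
    disj₂₃ := c.disj₂₃.mono_right hN
    disjA₃ := c.disjA₃.mono_left hN
    leg := ⟨g, hleg⟩ }

lemma exists_leg (c : Cfg H F L₁ L₂ L₃ A α P₁ P₂ M₁ M₂ M₃) : ∃ g, Leg H F L₃ M₃ g := by
  obtain ⟨g, hg⟩ := c.leg
  exact ⟨g, hg.mono Set.sdiff_subset le_rfl⟩

lemma port_leg (c : Cfg H F L₁ L₂ L₃ A α P₁ P₂ M₁ M₂ M₃) : Leg H F L₂ (M₂ ∪ A) P₂.e := by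
  refine ⟨M₂, Set.subset_union_left, c.sconn₂, c.mem₂, P₂.x, c.port₂.mem, P₂.o, c.port₂.link, P₂.p,
    c.port₂.p_mem, c.port₂.p_mem', fun h => ?_⟩
  rcases c.kind with ⟨h1, -, h3, -, -⟩ | ⟨-, -, -, -, h5, -, h7⟩
  · right
    rw [h1, h3]
    rfl
  · rw [h5] at h
    exact absurd h h7

lemma eq_of_mem (c : Cfg H F L₁ L₂ L₃ A α P₁ P₂ M₁ M₂ M₃) {a : Set V} (ha : a ∈ A) :
    a = α ∧ A = {α} ∧ P₁.o = α ∧ P₂.o = α ∧ P₁.p ∈ α ∧ P₂.p ∈ α := by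
  rcases c.kind with ⟨h1, h⟩ | ⟨h1, -⟩
  · rw [h1] at ha
    exact ⟨ha, h1, h⟩
  · rw [h1] at ha
    exact absurd ha (Set.notMem_empty _)

lemma exists_avoid (c : Cfg H F L₁ L₂ L₃ A α P₁ P₂ M₁ M₂ M₃) :
    ∃ U, (∀ a ∈ A, a = U) ∧ (U ∈ A ∨ U ∈ M₁) := by
  rcases c.kind with ⟨h1, -⟩ | ⟨h1, -⟩
  · exact ⟨α, fun a ha => by rw [h1] at ha; exact ha, Or.inl (h1 ▸ rfl)⟩
  · exact ⟨L₁, fun a ha => by rw [h1] at ha; exact absurd ha (Set.notMem_empty _), Or.inr c.mem₁⟩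

lemma arc_of_mem (c : Cfg H F L₁ L₂ L₃ A α P₁ P₂ M₁ M₂ M₃) (hN : IsNet G X H) {E p q : Set V}
    {v : V} (hl : H.IsLink E p q) (hv : v ∈ E) (hvα : v ∈ α) :
    p ∈ A ∨ q ∈ A ∨ (p ∈ M₁ ∧ q ∈ M₂) ∨ (p ∈ M₂ ∧ q ∈ M₁) := by
  rcases c.kind with ⟨h1, h2, -⟩ | ⟨-, h2, -, h4, -⟩
  · have := hN.end_of_mem hl hv hvα (h2 ▸ c.port₁.link.right_mem)
    rw [h1]
    rcases this with h | h
    · exact Or.inl h.symm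
    · exact Or.inr (Or.inl h.symm)
  · have hl₁ := c.port₁.link
    rw [h2, h4] at hl₁
    obtain rfl := hN.arc_eq hl.edge_mem hl₁.edge_mem hv hvα
    right; right
    rcases hl.eq_and_eq_or_eq_and_eq hl₁ with ⟨rfl, rfl⟩ | ⟨rfl, rfl⟩
    · exact Or.inl ⟨c.port₁.mem, c.port₂.mem⟩
    · exact Or.inr ⟨c.port₂.mem, c.port₁.mem⟩

lemma not_serves_port (c : Cfg H F L₁ L₂ L₃ A α P₁ P₂ M₁ M₂ M₃) {v : V} (h : Serves H M₃ P₂.e v) :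
    False := by
  rcases h.exists_end c.port₂.link with h | h
  · exact Set.disjoint_left.1 c.disj₂₃ c.port₂.mem h
  · rcases c.kind with ⟨h1, -, h3, -⟩ | ⟨-, -, -, -, h5, -⟩
    · exact Set.disjoint_left.1 c.disjA₃ h (h3 ▸ h1 ▸ rfl)
    · rw [h5] at h
      exact Set.disjoint_left.1 c.disj₁₃ c.port₁.mem h

lemma not_serves_port' (c : Cfg H F L₁ L₂ L₃ A α P₁ P₂ M₁ M₂ M₃) {v : V} (h : Serves H M₁ P₂.e v)
    (hv : v ∉ α) : False := by
  rcases c.kind with ⟨h1, -, h3, -⟩ | ⟨-, -, h3, -⟩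
  · rcases h.exists_end c.port₂.link with h | h
    · exact Set.disjoint_left.1 c.disj₁₂ h c.port₂.mem
    · exact Set.disjoint_left.1 c.disjA₁ h (h3 ▸ h1 ▸ rfl)
  · rw [h3] at h
    exact hv h.1

end Cfg

/-- Every node lies in `M₁`, `M₂`, `M₃` or `A`. -/
def Covers (H : Graph (Set V) (Set V)) (A M₁ M₂ M₃ : Set (Set V)) : Prop :=
  ∀ N ∈ H.vertexSet, N ∈ M₁ ∨ N ∈ M₂ ∨ N ∈ M₃ ∨ N ∈ A

lemma Covers.swap (h : Covers H A M₁ M₂ M₃) : Covers H A M₂ M₁ M₃ := fun N hN => by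
  rcases h N hN with h | h | h | h
  exacts [Or.inr (Or.inl h), Or.inl h, Or.inr (Or.inr (Or.inl h)), Or.inr (Or.inr (Or.inr h))]

/-- There is a configuration that covers all nodes and minimizes `M₃`. -/
lemma Ctx.exists_min_cfg [Finite V] (hc : Ctx G X H Y) : ∃ L₁ L₂ L₃ A α P₁ P₂ M₁ M₂ M₃,
    Cfg H (nbrIn G X Y) L₁ L₂ L₃ A α P₁ P₂ M₁ M₂ M₃ ∧ Covers H A M₁ M₂ M₃ ∧
    ∀ M₁' M₂' M₃', Cfg H (nbrIn G X Y) L₁ L₂ L₃ A α P₁ P₂ M₁' M₂' M₃' → Covers H A M₁' M₂' M₃' →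
      M₃.ncard ≤ M₃'.ncard := by
  obtain ⟨L₁, L₂, L₃, A, α, P₁, P₂, M₁, M₂, M₃, c⟩ := hc.exists_cfg
  refine ⟨L₁, L₂, L₃, A, α, P₁, P₂, ?_⟩
  have hcov : ∃ M₁ M₂ M₃, Cfg H (nbrIn G X Y) L₁ L₂ L₃ A α P₁ P₂ M₁ M₂ M₃ ∧
      Covers H A M₁ M₂ M₃ := by
    obtain ⟨⟨N₁, N₂, N₃⟩, hN, hmax⟩ := Set.exists_max_image
      {M : Set (Set V) × Set (Set V) × Set (Set V) |
        Cfg H (nbrIn G X Y) L₁ L₂ L₃ A α P₁ P₂ M.1 M.2.1 M.2.2}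
      (fun M => (M.1 ∪ M.2.1 ∪ M.2.2).ncard) (Set.toFinite _) ⟨⟨M₁, M₂, M₃⟩, c⟩
    refine ⟨N₁, N₂, N₃, hN, ?_⟩
    change Cfg H (nbrIn G X Y) L₁ L₂ L₃ A α P₁ P₂ N₁ N₂ N₃ at hN
    by_contra hcon
    set C : Set (Set V) := {N ∈ H.vertexSet | N ∉ N₁ ∧ N ∉ N₂ ∧ N ∉ N₃ ∧ N ∉ A} with hC
    have hCne : C.Nonempty := by
      unfold Covers at hcon
      push Not at hcon
      exact hcon
    obtain ⟨U, hUA, hU⟩ := hN.exists_avoid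
    have hUC : U ∉ C := fun h => hU.elim h.2.2.2.2 h.2.1
    obtain ⟨x, hx, y, hyC, hyU, -, hxy⟩ := hc.net.exists_adj U U C (fun _ h => h.1) hCne hUC hUC
      (fun N hNC hNl => by
        rcases hN.triple.eq hc.net.toIsNet hNl with rfl | rfl | rfl
        exacts [hNC.2.1 hN.mem₁, hNC.2.2.1 hN.mem₂, hNC.2.2.2.1 hN.mem₃])
    have hy : y ∈ N₁ ∨ y ∈ N₂ ∨ y ∈ N₃ := by
      by_contra hcon
      push Not at hcon
      exact hyC ⟨(netGraph_adj_mem hxy).2, hcon.1, hcon.2.1, hcon.2.2, fun h => hyU (hUA y h)⟩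
    have hbig : ∀ S : Set (Set V), S = insert x (N₁ ∪ N₂ ∪ N₃) → ¬ S.ncard ≤ (N₁ ∪ N₂ ∪ N₃).ncard := by
      rintro S rfl
      rw [Set.ncard_insert_of_notMem (by
        rintro ((h | h) | h)
        exacts [hx.2.1 h, hx.2.2.1 h, hx.2.2.2.1 h]) (Set.toFinite _)]
      omega
    rcases hy with hy | hy | hy
    · exact hbig _ (by ext; simp only [Set.mem_insert_iff, Set.mem_union]; tauto)
        (hmax ⟨insert x N₁, N₂, N₃⟩ (hN.insert₁ hy hxy.symm hx.2.2.1 hx.2.2.2.1 hx.2.2.2.2))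
    · exact hbig _ (by ext; simp only [Set.mem_insert_iff, Set.mem_union]; tauto)
        (hmax ⟨N₁, insert x N₂, N₃⟩
          (hN.swap.insert₁ hy hxy.symm hx.2.1 hx.2.2.2.1 hx.2.2.2.2).swap)
    · exact hbig _ (by ext; simp only [Set.mem_insert_iff, Set.mem_union]; tauto)
        (hmax ⟨N₁, N₂, insert x N₃⟩ (hN.insert₃ hy hxy.symm hx.2.1 hx.2.2.1 hx.2.2.2.2))
  obtain ⟨M₁, M₂, M₃, c, hcov⟩ := hcov
  obtain ⟨⟨N₁, N₂, N₃⟩, hN, hmin⟩ := Set.exists_min_image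
    {M : Set (Set V) × Set (Set V) × Set (Set V) |
      Cfg H (nbrIn G X Y) L₁ L₂ L₃ A α P₁ P₂ M.1 M.2.1 M.2.2 ∧ Covers H A M.1 M.2.1 M.2.2}
    (fun M => M.2.2.ncard) (Set.toFinite _) ⟨⟨M₁, M₂, M₃⟩, c, hcov⟩
  exact ⟨N₁, N₂, N₃, hN.1, hN.2, fun M₁' M₂' M₃' h h' => hmin ⟨M₁', M₂', M₃'⟩ ⟨h, h'⟩⟩

namespace Ctx

variable [Finite V]

/-- Vertices serving `M₁` and `M₃` lie in a common arc. -/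
lemma eq_of_serves (hc : Ctx G X H Y) (c : Cfg H (nbrIn G X Y) L₁ L₂ L₃ A α P₁ P₂ M₁ M₂ M₃)
    {g f : Set V} {h t : V} (hh : h ∈ nbrIn G X Y \ α) (hg : Serves H M₁ g h)
    (ht : t ∈ nbrIn G X Y) (hf : Serves H M₃ f t) : g = f := by
  by_contra hne
  refine hc.not_three_legs c.triple (hg.leg hh.1 c.sconn₁ c.mem₁) c.port_leg
    (hf.leg ht c.sconn₃ c.mem₃) (Set.disjoint_union_right.2 ⟨c.disj₁₂, c.disjA₁⟩) c.disj₁₃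
    (Set.disjoint_union_left.2 ⟨c.disj₂₃, c.disjA₃.symm⟩) ?_ hne ?_
  · rintro rfl
    exact c.not_serves_port' hg hh.2
  · rintro rfl
    exact c.not_serves_port hf

lemma serves_both (hc : Ctx G X H Y) (c : Cfg H (nbrIn G X Y) L₁ L₂ L₃ A α P₁ P₂ M₁ M₂ M₃)
    {g : Set V} {h : V} (hh : h ∈ nbrIn G X Y \ α) (hg : Serves H M₁ g h) :
    ∃ t ∈ nbrIn G X Y \ α, Serves H M₃ g t := by
  obtain ⟨f, hf⟩ := c.leg
  obtain ⟨t, ht, hft⟩ := hf.exists_serves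
  exact ⟨t, ht, hc.eq_of_serves c hh hg ht.1 hft ▸ hft⟩

lemma inArcs_disjoint (hc : Ctx G X H Y) (c : Cfg H (nbrIn G X Y) L₁ L₂ L₃ A α P₁ P₂ M₁ M₂ M₃) :
    Disjoint (inArcs H M₁) (nbrIn G X Y) := by
  rw [Set.disjoint_left]
  rintro v ⟨E, p, q, hl, hp, hq, hv⟩ hvF
  have d₁₂ := Set.disjoint_left.1 c.disj₁₂
  have dA₁ := Set.disjoint_left.1 c.disjA₁
  have d₁₃ := Set.disjoint_left.1 c.disj₁₃
  have hvα : v ∉ α := fun h => by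
    rcases c.arc_of_mem hc.net.toIsNet hl hv h with h | h | h | h
    exacts [dA₁ hp h, dA₁ hq h, d₁₂ hq h.2, d₁₂ hp h.1]
  obtain ⟨t, -, ht⟩ := hc.serves_both c ⟨hvF, hvα⟩ (g := E) ⟨hv, p, hp, q, hl, fun _ => hq⟩
  rcases ht.exists_end hl with h | h
  exacts [d₁₃ hp h, d₁₃ hq h]

lemma end_of_mem₁ (hc : Ctx G X H Y) (c : Cfg H (nbrIn G X Y) L₁ L₂ L₃ A α P₁ P₂ M₁ M₂ M₃)
    (hcov : Covers H A M₁ M₂ M₃) {E p q : Set V} {v : V} (hl : H.IsLink E p q) (hv : v ∈ E)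
    (hvF : v ∈ nbrIn G X Y \ α) (hp : p ∈ M₁) : q ∈ M₃ := by
  have hserve : (v ∈ q → q ∈ M₁) → q ∈ M₃ := fun h => by
    obtain ⟨t, -, ht⟩ := hc.serves_both c hvF (g := E) ⟨hv, p, hp, q, hl, h⟩
    rcases ht.exists_end hl with h | h
    · exact absurd h (Set.disjoint_left.1 c.disj₁₃ hp)
    · exact h
  rcases hcov q hl.right_mem with hq | hq | hq | hq
  · exact hserve fun _ => hq
  · by_cases hvq : v ∈ q
    · exfalso
      by_cases hvp : v ∈ p
      · obtain ⟨g, hg⟩ := c.exists_leg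
        have hs : ∀ S : Set V, v ∈ S → ({v} : Set V) ∩ S = {v} := fun S hS =>
          Set.inter_eq_left.2 (Set.singleton_subset_iff.2 hS)
        exact hc.not_prong_arc c.triple hp hq
          (hc.net.free c.triple.leaf₁ c.sconn₁ c.mem₁ hp (hc.inArcs_disjoint c))
          (hc.net.free c.triple.leaf₂ c.sconn₂ c.mem₂ hq (hc.inArcs_disjoint c.swap))
          c.disj₁₂ hl (isTree_singleton v) (Set.singleton_subset_iff.2 hv) ⟨v, hs p hvp⟩
          ⟨v, hs q hvq⟩ ⟨v, hs _ hvF.1⟩ hg c.disj₁₃ c.disj₂₃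
      · obtain ⟨t, -, ht⟩ := hc.serves_both c.swap hvF (g := E)
          ⟨hv, q, hq, p, hl.symm, fun h => absurd h hvp⟩
        rcases ht.exists_end hl with h | h
        · exact Set.disjoint_left.1 c.disj₁₃ hp h
        · exact Set.disjoint_left.1 c.disj₂₃ hq h
    · exact hserve fun h => absurd h hvq
  · exact hq
  · exact hserve fun h => absurd ((c.eq_of_mem hq).1 ▸ h) hvF.2

/-- An arc containing a vertex of `F` outside `α` has an end in `M₃`. -/
lemma exists_end (hc : Ctx G X H Y) (c : Cfg H (nbrIn G X Y) L₁ L₂ L₃ A α P₁ P₂ M₁ M₂ M₃)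
    (hcov : Covers H A M₁ M₂ M₃) {v : V} (hvF : v ∈ nbrIn G X Y \ α) :
    ∃ E p q, H.IsLink E p q ∧ v ∈ E ∧ q ∈ M₃ := by
  obtain ⟨E, p, q, hl, hv⟩ := hc.net.exists_link hvF.1.1
  rcases hcov p hl.left_mem with hp | hp | hp | hp
  · exact ⟨E, p, q, hl, hv, hc.end_of_mem₁ c hcov hl hv hvF hp⟩
  · exact ⟨E, p, q, hl, hv, hc.end_of_mem₁ c.swap hcov.swap hl hv hvF hp⟩
  · exact ⟨E, q, p, hl.symm, hv, hp⟩
  · rcases hcov q hl.right_mem with hq | hq | hq | hq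
    · exact ⟨E, q, p, hl.symm, hv, hc.end_of_mem₁ c hcov hl.symm hv hvF hq⟩
    · exact ⟨E, q, p, hl.symm, hv, hc.end_of_mem₁ c.swap hcov.swap hl.symm hv hvF hq⟩
    · exact ⟨E, p, q, hl, hv, hq⟩
    · exact absurd ((c.eq_of_mem hp).1.trans (c.eq_of_mem hq).1.symm) (hc.net.loopless _ _ _ hl)

lemma not_chord (hc : Ctx G X H Y) (c : Cfg H (nbrIn G X Y) L₁ L₂ L₃ A α P₁ P₂ M₁ M₂ M₃)
    (hN₃ : N₃ ⊆ M₃) (hs : SConn (netGraph H) N₃) (hL : L₃ ∈ N₃)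
    (hF : Disjoint (inArcs H N₃) (nbrIn G X Y)) {E p q : Set V} {v : V} (hl : H.IsLink E p q)
    (hv : v ∈ E) (hvF : v ∈ nbrIn G X Y) (hp : p ∈ M₁) (hq : q ∈ N₃) (hvp : v ∈ p) : v ∉ q := by
  intro hvq
  have hs' : ∀ S : Set V, v ∈ S → ({v} : Set V) ∩ S = {v} := fun S hS =>
    Set.inter_eq_left.2 (Set.singleton_subset_iff.2 hS)
  exact hc.not_prong_arc c.triple.swap₂₃ hp hq
    (hc.net.free c.triple.leaf₁ c.sconn₁ c.mem₁ hp (hc.inArcs_disjoint c))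
    (hc.net.free c.triple.leaf₃ hs hL hq hF) (c.disj₁₃.mono_right hN₃) hl (isTree_singleton v)
    (Set.singleton_subset_iff.2 hv) ⟨v, hs' p hvp⟩ ⟨v, hs' q hvq⟩ ⟨v, hs' _ hvF⟩ c.port_leg
    (Set.disjoint_union_right.2 ⟨c.disj₁₂, c.disjA₁⟩)
    ((Set.disjoint_union_right.2 ⟨c.disj₂₃.symm, c.disjA₃⟩).mono_left hN₃)

end Ctx

end Analysis

/-! ### The shape of the neighborhood of `Y` -/

section Shape

variable {V : Type*} {G : SimpleGraph V} {X Y F : Set V} {H : Graph (Set V) (Set V)}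
  {L₁ L₂ L₃ α : Set V} {A D M M₁ M₂ M₃ N₃ : Set (Set V)} {P₁ P₂ : Port V}

/-- The four possible shapes of `F = N(Y) ∩ X` in the absence of saplings. -/
inductive Shape (G : SimpleGraph V) (H : Graph (Set V) (Set V)) (F : Set V) : Prop
  | two_nodes (a q : Set V) (ha : a ∈ H.vertexSet) (hq : q ∈ H.vertexSet) (hal : ¬ IsLeafNode H a)
      (hql : ¬ IsLeafNode H q) (haq : a ≠ q)
      (hF : ∀ v ∈ F, v ∈ a ∨ v ∈ q ∨ ∃ E, H.IsLink E a q ∧ v ∈ E)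
      (haF : ∀ v ∈ a, (∀ E, H.IsLink E a q → v ∉ E) → v ∈ F)
      (hqF : ∀ v ∈ q, (∀ E, H.IsLink E a q → v ∉ E) → v ∈ F) : Shape G H F
  | node_arc (a b g : Set V) (hl : H.IsLink g a b) (hF : F ⊆ a ∪ g) (haF : a \ g ⊆ F) :
      Shape G H F
  | node_solid (a p q g : Set V) (ha : a ∈ H.vertexSet) (hal : ¬ IsLeafNode H a)
      (hl : H.IsLink g p q) (hap : a ≠ p) (haq : a ≠ q)
      (haF : a ⊆ F) (hF : F ⊆ a ∪ g) (hs : ¬ ∃ T ⊆ g, IsSprout G (F ∩ g) p q T)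
      (hp : ∃ v ∈ F ∩ g, v ∉ p) (hq : ∃ v ∈ F ∩ g, v ∉ q) : Shape G H F
  | two_arcs (e g x y p q : Set V) (he : H.IsLink e x y) (hg : H.IsLink g p q) (heg : e ≠ g)
      (hF : F ⊆ e ∪ g) (hse : ¬ ∃ T ⊆ e, IsSprout G (F ∩ e) x y T)
      (hsg : ¬ ∃ T ⊆ g, IsSprout G (F ∩ g) p q T)
      (hx : ∃ v ∈ F ∩ e, v ∉ x) (hy : ∃ v ∈ F ∩ e, v ∉ y)
      (hp : ∃ v ∈ F ∩ g, v ∉ p) (hq : ∃ v ∈ F ∩ g, v ∉ q) : Shape G H F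

namespace Ctx

variable [Finite V]

lemma subset_arc_of_conflict (hc : Ctx G X H Y)
    (c : Cfg H (nbrIn G X Y) L₁ L₂ L₃ A α P₁ P₂ M₁ M₂ M₃) (hcov : Covers H A M₁ M₂ M₃)
    {g p q : Set V} {h : V} (hl : H.IsLink g p q) (hhg : h ∈ g) (hh : h ∈ nbrIn G X Y \ α)
    (hp : p ∈ M₁) (hhq : h ∉ q) :
    (∀ v ∈ nbrIn G X Y \ α, v ∈ g) ∧ Disjoint (inArcs H M₃) (nbrIn G X Y) ∧
      ∃ t ∈ nbrIn G X Y \ α, t ∈ g ∧ t ∉ p := by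
  have hN := hc.net.toIsNet
  have d₁₃ := Set.disjoint_left.1 c.disj₁₃
  have hserve : Serves H M₁ g h := ⟨hhg, p, hp, q, hl, fun h => absurd h hhq⟩
  obtain ⟨t, ht, htg⟩ := hc.serves_both c hh hserve
  have h3 : ∀ v ∈ nbrIn G X Y, ∀ f, Serves H M₃ f v → v ∈ g := fun v hv f hf =>
    hc.eq_of_serves c hh hserve hv hf ▸ hf.1
  have hfree : Disjoint (inArcs H M₃) (nbrIn G X Y) := by
    rw [Set.disjoint_left]
    rintro v ⟨E, x, y, hE, hx, hy, hv⟩ hvF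
    have hvg := h3 v hvF E ⟨hv, x, hx, y, hE, fun _ => hy⟩
    obtain rfl := hN.arc_eq hE.edge_mem hl.edge_mem hv hvg
    rcases hl.inc_left.eq_or_eq_of_isLink hE with rfl | rfl
    exacts [d₁₃ hp hx, d₁₃ hp hy]
  refine ⟨fun v hv => ?_, hfree, t, ht, htg.1, ?_⟩
  · obtain ⟨E, x, y, hE, hvE, hy⟩ := hc.exists_end c hcov hv
    have hs3 : (v ∈ x → x ∈ M₃) → v ∈ g := fun h => h3 v hv.1 E ⟨hvE, y, hy, x, hE.symm, h⟩
    rcases hcov x hE.left_mem with hx | hx | hx | hx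
    · by_cases hvx : v ∈ x
      · have hvy := hc.not_chord c le_rfl c.sconn₃ c.mem₃ hfree hE hvE hv.1 hx hy hvx
        have := hc.eq_of_serves c hv (g := E) ⟨hvE, x, hx, y, hE, fun h => absurd h hvy⟩ ht.1 htg
        exact this ▸ hvE
      · exact hs3 fun h => absurd h hvx
    · by_cases hvx : v ∈ x
      · have hvy := hc.not_chord c.swap le_rfl c.sconn₃ c.mem₃ hfree hE hvE hv.1 hx hy hvx
        have := hc.eq_of_serves c.swap hv (g := E) ⟨hvE, x, hx, y, hE, fun h => absurd h hvy⟩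
          ht.1 htg
        exact this ▸ hvE
      · exact hs3 fun h => absurd h hvx
    · exact hs3 fun _ => hx
    · exact hs3 fun h => absurd ((c.eq_of_mem hx).1 ▸ h) hv.2
  · obtain ⟨-, x, hx, y, hxy, hty⟩ := htg
    rcases hxy.eq_and_eq_or_eq_and_eq hl with ⟨rfl, rfl⟩ | ⟨rfl, rfl⟩
    · exact absurd hx (d₁₃ hp)
    · exact fun h => d₁₃ hp (hty h)

/-- Vertices of the node `α` in arcs to `M₁` are neighbors of `Y`. -/
lemma mem_of_end_mem₁ (hc : Ctx G X H Y)
    (c : Cfg H (nbrIn G X Y) L₁ L₂ L₃ A α P₁ P₂ M₁ M₂ M₃) (hcov : Covers H A M₁ M₂ M₃)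
    (hA : α ∈ A) {E x : Set V} {n : V} (hE : H.IsLink E x α) (hx : x ∈ M₁) (hn : n ∈ E)
    (hnα : n ∈ α) : n ∈ nbrIn G X Y := by
  by_contra hnF
  obtain ⟨-, -, -, ho₂, -, hp₂⟩ := c.eq_of_mem hA
  obtain ⟨g, hg⟩ := c.exists_leg
  have hα₃ : α ∉ M₃ := fun h => Set.disjoint_left.1 c.disjA₃ h hA
  have hl₂ := c.port₂.link
  rw [ho₂] at hl₂
  refine hc.not_prong_node c.triple.swap₁₂ c.port₂.mem hx
    (hc.net.free c.triple.leaf₂ c.sconn₂ c.mem₂ c.port₂.mem (hc.inArcs_disjoint c.swap))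
    (hc.net.free c.triple.leaf₁ c.sconn₁ c.mem₁ hx (hc.inArcs_disjoint c)) c.disj₁₂.symm
    (fun h => Set.disjoint_left.1 c.disjA₂ h hA) (fun h => Set.disjoint_left.1 c.disjA₁ h hA)
    hl₂ hE c.port₂.p_mem hp₂ c.port₂.p_mem' ?_ hn hnα hnF ?_ hg c.disj₂₃ c.disj₁₃ hα₃
  · intro v hv hvF
    by_contra hvα
    exact hα₃ (hc.end_of_mem₁ c.swap hcov.swap hl₂ hv ⟨hvF, hvα⟩ c.port₂.mem)
  · intro v hv hvF
    by_contra hvα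
    exact hα₃ (hc.end_of_mem₁ c hcov hE hv ⟨hvF, hvα⟩ hx)

/-- Vertices of the node `α` in arcs to part of `M₃` are neighbors of `Y`. -/
lemma mem_of_end_mem₃ (hc : Ctx G X H Y)
    (c : Cfg H (nbrIn G X Y) L₁ L₂ L₃ A α P₁ P₂ M₁ M₂ M₃) (hcov : Covers H A M₁ M₂ M₃)
    (hA : α ∈ A) (hN₃ : N₃ ⊆ M₃) (hs : SConn (netGraph H) N₃) (hL : L₃ ∈ N₃)
    (hfree : Disjoint (inArcs H N₃) (nbrIn G X Y)) {g : Set V}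
    (hleg : Leg H (nbrIn G X Y) L₁ D g) (hD₂ : Disjoint M₂ D) (hD₃ : Disjoint N₃ D) (hαD : α ∉ D)
    {E x : Set V} {n : V} (hE : H.IsLink E x α) (hx : x ∈ N₃)
    (hEα : ∀ v ∈ E, v ∈ nbrIn G X Y → v ∈ α) (hn : n ∈ E) (hnα : n ∈ α) : n ∈ nbrIn G X Y := by
  by_contra hnF
  obtain ⟨-, -, -, ho₂, -, hp₂⟩ := c.eq_of_mem hA
  have hα₃ : α ∉ M₃ := fun h => Set.disjoint_left.1 c.disjA₃ h hA
  have hl₂ := c.port₂.link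
  rw [ho₂] at hl₂
  refine hc.not_prong_node c.triple.swap₁₂.swap₂₃ c.port₂.mem hx
    (hc.net.free c.triple.leaf₂ c.sconn₂ c.mem₂ c.port₂.mem (hc.inArcs_disjoint c.swap))
    (hc.net.free c.triple.leaf₃ hs hL hx hfree) (c.disj₂₃.mono_right hN₃)
    (fun h => Set.disjoint_left.1 c.disjA₂ h hA) (fun h => hα₃ (hN₃ h))
    hl₂ hE c.port₂.p_mem hp₂ c.port₂.p_mem' ?_ hn hnα hnF hEα hleg hD₂ hD₃ hαD
  intro v hv hvF
  by_contra hvα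
  exact hα₃ (hc.end_of_mem₁ c.swap hcov.swap hl₂ hv ⟨hvF, hvα⟩ c.port₂.mem)

lemma node_subset (hc : Ctx G X H Y)
    (c : Cfg H (nbrIn G X Y) L₁ L₂ L₃ A α P₁ P₂ M₁ M₂ M₃) (hcov : Covers H A M₁ M₂ M₃)
    (hA : α ∈ A) {n : V} (hnα : n ∈ α)
    (h₃ : ∀ E x, H.IsLink E x α → x ∈ M₃ → n ∈ E → n ∈ nbrIn G X Y) : n ∈ nbrIn G X Y := by
  have hN := hc.net.toIsNet
  have hα : α ∈ H.vertexSet := by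
    obtain ⟨-, -, h, -⟩ := c.eq_of_mem hA
    exact h ▸ c.port₁.link.right_mem
  obtain ⟨E, p, q, hl, hn⟩ := hN.exists_link (hN.node_subset α hα hnα)
  obtain ⟨x, hE⟩ := hN.inc_of_mem hl.edge_mem hn hnα hα
  rcases hcov x hE.right_mem with hx | hx | hx | hx
  · exact hc.mem_of_end_mem₁ c hcov hA hE.symm hx hn hnα
  · exact hc.mem_of_end_mem₁ c.swap hcov.swap hA hE.symm hx hn hnα
  · exact h₃ E x hE.symm hx hn
  · exact absurd (c.eq_of_mem hx).1.symm (hN.loopless _ _ _ hE)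

/-- If `A = ∅`, then the arc `α` contains no sprout. -/
lemma not_sprout_arc (hc : Ctx G X H Y) (c : Cfg H (nbrIn G X Y) L₁ L₂ L₃ A α P₁ P₂ M₁ M₂ M₃)
    (hl : H.IsLink α P₁.x P₂.x) :
    ¬ ∃ T ⊆ α, IsSprout G (nbrIn G X Y ∩ α) P₁.x P₂.x T := by
  obtain ⟨g, hg⟩ := c.exists_leg
  exact hc.not_sprout c.triple c.sconn₁ c.sconn₂ c.mem₁ c.mem₂ c.port₁.mem c.port₂.mem c.disj₁₂
    (hc.inArcs_disjoint c) (hc.inArcs_disjoint c.swap) hl hg c.disj₁₃ c.disj₂₃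

lemma not_leaf_of_mem (hc : Ctx G X H Y) {N : Set V} {v : V} (hv : v ∈ N)
    (hvF : v ∈ nbrIn G X Y) : ¬ IsLeafNode H N := fun h => hc.leaf_disjoint h hv hvF

lemma shape_of_conflict (hc : Ctx G X H Y)
    (c : Cfg H (nbrIn G X Y) L₁ L₂ L₃ A α P₁ P₂ M₁ M₂ M₃) (hcov : Covers H A M₁ M₂ M₃)
    {g p q : Set V} {h : V} (hl : H.IsLink g p q) (hhg : h ∈ g) (hh : h ∈ nbrIn G X Y \ α)
    (hp : p ∈ M₁) (hq : q ∈ M₃) (hhq : h ∉ q) : Shape G H (nbrIn G X Y) := by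
  have hN := hc.net.toIsNet
  obtain ⟨hsub, hfree, t, ht, htg, htp⟩ := hc.subset_arc_of_conflict c hcov hl hhg hh hp hhq
  have hsg := hc.not_sprout c.triple.swap₂₃ c.sconn₁ c.sconn₃ c.mem₁ c.mem₃ hp hq c.disj₁₃
    (hc.inArcs_disjoint c) hfree hl c.port_leg (Set.disjoint_union_right.2 ⟨c.disj₁₂, c.disjA₁⟩)
    (Set.disjoint_union_right.2 ⟨c.disj₂₃.symm, c.disjA₃⟩)
  have hF : nbrIn G X Y ⊆ α ∪ g := fun v hv => by
    by_cases hvα : v ∈ α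
    · exact Or.inl hvα
    · exact Or.inr (hsub v ⟨hv, hvα⟩)
  have hpF : ∃ v ∈ nbrIn G X Y ∩ g, v ∉ p := ⟨t, ⟨ht.1, htg⟩, htp⟩
  have hqF : ∃ v ∈ nbrIn G X Y ∩ g, v ∉ q := ⟨h, ⟨hh.1, hhg⟩, hhq⟩
  rcases c.kind with ⟨hA, ho₁, -, hp₁, -⟩ | ⟨-, he₁, -, ho₁, -, hp₁, hp₂⟩
  · have hαA : α ∈ A := hA ▸ rfl
    have hαp : α ≠ p := by
      rintro rfl
      exact Set.disjoint_left.1 c.disjA₁ hp hαA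
    have hαq : α ≠ q := by
      rintro rfl
      exact Set.disjoint_left.1 c.disjA₃ hq hαA
    refine .node_solid α p q g (ho₁ ▸ c.port₁.link.right_mem)
      (hc.not_leaf_of_mem hp₁ c.port₁.p_mem') hl hαp hαq (fun n hn => ?_) hF hsg hpF hqF
    refine hc.node_subset c hcov hαA hn fun E x hE hx hnE => ?_
    refine hc.mem_of_end_mem₃ c hcov hαA le_rfl c.sconn₃ c.mem₃ hfree (D := M₁) (g := g)
      (Serves.leg (v := h) ⟨hhg, p, hp, q, hl, fun h => absurd h hhq⟩ hh.1 c.sconn₁ c.mem₁)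
      c.disj₁₂.symm c.disj₁₃.symm (fun h => Set.disjoint_left.1 c.disjA₁ h hαA) hE hx ?_ hnE hn
    intro v hv hvF
    by_contra hvα
    obtain rfl := hN.arc_eq hE.edge_mem hl.edge_mem hv (hsub v ⟨hvF, hvα⟩)
    rcases hE.inc_right.eq_or_eq_of_isLink hl with h | h <;> contradiction
  · have hlα := c.port₁.link
    rw [he₁, ho₁] at hlα
    refine .two_arcs α g P₁.x P₂.x p q hlα hl ?_ hF (hc.not_sprout_arc c hlα) hsg
      ⟨P₂.p, ⟨c.port₂.p_mem', ?_⟩, hp₂⟩ ⟨P₁.p, ⟨c.port₁.p_mem', he₁ ▸ c.port₁.p_mem⟩, hp₁⟩ hpF hqF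
    · rintro rfl
      exact hh.2 hhg
    · rcases c.kind with ⟨-, -, -, -, h⟩ | ⟨-, -, h, -⟩
      · exact h
      · exact h ▸ c.port₂.p_mem

lemma shape_of_subsingleton (hc : Ctx G X H Y)
    (c : Cfg H (nbrIn G X Y) L₁ L₂ L₃ A α P₁ P₂ M₁ M₂ M₃) (hcov : Covers H A M₁ M₂ M₃)
    (hM₃ : ∀ N ∈ M₃, N = L₃)
    (hno : ∀ g p q h, H.IsLink g p q → h ∈ g → h ∈ nbrIn G X Y \ α → (p ∈ M₁ ∨ p ∈ M₂) → q ∈ M₃ →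
      h ∈ q) : Shape G H (nbrIn G X Y) := by
  have hN := hc.net.toIsNet
  have key : ∀ v ∈ nbrIn G X Y \ α, α ∈ A ∧ ∃ E, H.IsLink E α L₃ ∧ v ∈ E := by
    intro v hv
    obtain ⟨E, p, q, hl, hvE, hq⟩ := hc.exists_end c hcov hv
    have hqL := hM₃ q hq
    have hnot : ¬ (p ∈ M₁ ∨ p ∈ M₂) := fun hp =>
      hc.leaf_disjoint c.triple.leaf₃ (hqL ▸ hno E p q v hl hvE hv hp hq) hv.1
    rcases hcov p hl.left_mem with hp | hp | hp | hp
    · exact absurd (Or.inl hp) hnot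
    · exact absurd (Or.inr hp) hnot
    · exact absurd ((hM₃ p hp).trans hqL.symm) (hN.loopless _ _ _ hl)
    · have hpα := (c.eq_of_mem hp).1
      rw [hpα, hqL] at hl
      exact ⟨hpα ▸ hp, E, hl, hvE⟩
  obtain ⟨f, hf⟩ := c.leg
  obtain ⟨t, ht, -⟩ := hf.exists_serves
  obtain ⟨hαA, g, hg, -⟩ := key t ht
  refine .node_arc α L₃ g hg (fun v hv => ?_) (fun v hv => ?_)
  · by_cases hvα : v ∈ α
    · exact Or.inl hvα
    · obtain ⟨-, E, hE, hvE⟩ := key v ⟨hv, hvα⟩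
      exact Or.inr (hc.net.simple hE hg ▸ hvE)
  · refine hc.node_subset c hcov hαA hv.1 fun E x hE hx hvE => ?_
    rw [hM₃ x hx] at hE
    exact absurd (hc.net.simple hE.symm hg ▸ hvE) hv.2

/-- Vertices of `F` at a node `q` between part of `M₃` and `M₁`. -/
lemma mem_iff_of_node (hc : Ctx G X H Y)
    (c : Cfg H (nbrIn G X Y) L₁ L₂ L₃ A α P₁ P₂ M₁ M₂ M₃)
    {q : Set V} (hq : q ∈ M₃) (hqN : q ∉ N₃) (hN₃ : N₃ ⊆ M₃) (hs : SConn (netGraph H) N₃)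
    (hL : L₃ ∈ N₃) (hfree : Disjoint (inArcs H N₃) (nbrIn G X Y))
    (hF : ∀ v ∈ nbrIn G X Y \ α, v ∈ q ∨ α ∈ A ∧ ∃ E, H.IsLink E α q ∧ v ∈ E)
    {E E' x y : Set V} {z w : V} (hE : H.IsLink E x q) (hx : x ∈ N₃) (hz : z ∈ E) (hzq : z ∈ q)
    (hE' : H.IsLink E' y q) (hy : y ∈ M₁) (hw : w ∈ E') (hwq : w ∈ q) :
    z ∈ nbrIn G X Y ↔ w ∈ nbrIn G X Y := by
  have hN := hc.net.toIsNet
  have d₁₃ := Set.disjoint_left.1 c.disj₁₃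
  have d₂₃ := Set.disjoint_left.1 c.disj₂₃
  have dA₁ := Set.disjoint_left.1 c.disjA₁
  have dA₃ := Set.disjoint_left.1 c.disjA₃
  have hend : ∀ {E x}, H.IsLink E x q → (x ∈ M₁ ∨ x ∈ N₃) → ∀ v ∈ E, v ∈ nbrIn G X Y → v ∈ q := by
    intro E x hE hx v hv hvF
    have hxA : x ∉ A := hx.elim (fun h => dA₁ h) (fun h => dA₃ (hN₃ h))
    have hvα : v ∉ α := fun h => by
      rcases c.arc_of_mem hN hE hv h with h | h | h | h
      exacts [hxA h, dA₃ hq h, d₂₃ h.2 hq, d₁₃ h.2 hq]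
    rcases hF v ⟨hvF, hvα⟩ with h | ⟨hαA, E', hE', hvE'⟩
    · exact h
    · obtain rfl := hN.arc_eq hE.edge_mem hE'.edge_mem hv hvE'
      rcases hE'.inc_left.eq_or_eq_of_isLink hE with rfl | rfl
      · exact absurd hαA hxA
      · exact absurd hαA (dA₃ hq)
  have hf₁ := hc.net.free (x := y) c.triple.leaf₁ c.sconn₁ c.mem₁ hy (hc.inArcs_disjoint c)
  have hf₃ := hc.net.free (x := x) c.triple.leaf₃ hs hL hx hfree
  have dl₁ := Set.disjoint_union_right.2 ⟨c.disj₁₂, c.disjA₁⟩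
  have dl₃ := (Set.disjoint_union_right.2 ⟨c.disj₂₃.symm, c.disjA₃⟩).mono_left hN₃
  have hq₁ : q ∉ M₁ := fun h => d₁₃ h hq
  have hqD : q ∉ M₂ ∪ A := fun h => h.elim (fun h => d₂₃ h hq) (dA₃ hq)
  constructor
  · intro hzF
    by_contra hwF
    exact hc.not_prong_node c.triple.swap₁₃.swap₂₃ hx hy hf₃ hf₁ (c.disj₁₃.mono_right hN₃).symm hqN
      hq₁ hE hE' hz hzq hzF (hend hE (Or.inr hx)) hw hwq hwF (hend hE' (Or.inl hy)) c.port_leg dl₃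
      dl₁ hqD
  · intro hwF
    by_contra hzF
    exact hc.not_prong_node c.triple.swap₂₃ hy hx hf₁ hf₃ (c.disj₁₃.mono_right hN₃) hq₁ hqN hE' hE
      hw hwq hwF (hend hE' (Or.inl hy)) hz hzq hzF (hend hE (Or.inr hx)) c.port_leg dl₁ dl₃ hqD

lemma shape_of_node (hc : Ctx G X H Y)
    (c : Cfg H (nbrIn G X Y) L₁ L₂ L₃ A α P₁ P₂ M₁ M₂ M₃) (hcov : Covers H A M₁ M₂ M₃)
    {q y x : Set V} (hM₃ : M₃ = insert q N₃) (hqN : q ∉ N₃) (hs : SConn (netGraph H) N₃)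
    (hL : L₃ ∈ N₃) (hfree : Disjoint (inArcs H N₃) (nbrIn G X Y))
    (hF : ∀ v ∈ nbrIn G X Y \ α, v ∈ q ∨ α ∈ A ∧ ∃ E, H.IsLink E α q ∧ v ∈ E)
    (hy : y ∈ M₁) (hyq : (netGraph H).Adj y q) (hx : x ∈ N₃) (hxq : (netGraph H).Adj x q) :
    Shape G H (nbrIn G X Y) := by
  have hN := hc.net.toIsNet
  have hq : q ∈ M₃ := hM₃ ▸ Or.inl rfl
  have hN₃ : N₃ ⊆ M₃ := hM₃ ▸ Set.subset_insert _ _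
  have dA₃ := Set.disjoint_left.1 c.disjA₃
  obtain ⟨-, Ex, hEx⟩ := hxq
  obtain ⟨-, Ey, hEy⟩ := id hyq
  obtain ⟨z₀, hz₀E, hz₀⟩ := hN.exists_mem hEx.symm
  obtain ⟨w₀, hw₀E, hw₀⟩ := hN.exists_mem hEy.symm
  have hqH : q ∈ H.vertexSet := hEx.right_mem
  -- all vertices of `q` outside the arc `αq` behave in the same way
  have huni : ∀ v ∈ q, ¬ (α ∈ A ∧ ∃ E, H.IsLink E α q ∧ v ∈ E) →
      (v ∈ nbrIn G X Y ↔ z₀ ∈ nbrIn G X Y) := by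
    intro v hv hvE
    obtain ⟨E, _, _, hl, hvE'⟩ := hN.exists_link (hN.node_subset q hqH hv)
    obtain ⟨u, hu⟩ := hN.inc_of_mem hl.edge_mem hvE' hv hqH
    rcases hcov u hu.right_mem with h | h | h | h
    · exact (hc.mem_iff_of_node c hq hqN hN₃ hs hL hfree hF hEx hx hz₀E hz₀ hu.symm h hvE' hv).symm
    · exact (hc.mem_iff_of_node c.swap hq hqN hN₃ hs hL hfree hF hEx hx hz₀E hz₀ hu.symm h hvE'
        hv).symm
    · have hu₃ : u ∈ N₃ := by
        rw [hM₃] at h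
        exact h.resolve_left (hN.loopless _ _ _ hu).symm
      exact (hc.mem_iff_of_node c hq hqN hN₃ hs hL hfree hF hu.symm hu₃ hvE' hv hEy hy hw₀E hw₀).trans
        (hc.mem_iff_of_node c hq hqN hN₃ hs hL hfree hF hEx hx hz₀E hz₀ hEy hy hw₀E hw₀).symm
    · have := (c.eq_of_mem h).1
      exact absurd ⟨this ▸ h, E, this ▸ hu.symm, hvE'⟩ hvE
  have hw₀F : w₀ ∈ nbrIn G X Y ↔ z₀ ∈ nbrIn G X Y :=
    (hc.mem_iff_of_node c hq hqN hN₃ hs hL hfree hF hEx hx hz₀E hz₀ hEy hy hw₀E hw₀).symm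
  have hd₂ : Disjoint M₂ (insert q M₁) := Set.disjoint_insert_right.2
    ⟨fun h => Set.disjoint_left.1 c.disj₂₃ h hq, c.disj₁₂.symm⟩
  have hd₃ : Disjoint N₃ (insert q M₁) := Set.disjoint_insert_right.2
    ⟨hqN, (c.disj₁₃.mono_right hN₃).symm⟩
  -- the vertices of `α` outside the arc `αq`
  have hαsub : α ∈ A → (∃ g, Leg H (nbrIn G X Y) L₁ (insert q M₁) g) →
      ∀ n ∈ α, (∀ E, H.IsLink E α q → n ∉ E) → n ∈ nbrIn G X Y := by
    rintro hαA ⟨g, hleg⟩ n hn hnE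
    have hαq : α ≠ q := fun h => dA₃ hq (h ▸ hαA)
    refine hc.node_subset c hcov hαA hn fun E u hE hu hnE' => ?_
    have hu₃ : u ∈ N₃ := by
      rw [hM₃] at hu
      refine hu.resolve_left ?_
      rintro rfl
      exact hnE E hE.symm hnE'
    refine hc.mem_of_end_mem₃ c hcov hαA hN₃ hs hL hfree hleg hd₂ hd₃ ?_ hE hu₃ ?_ hnE' hn
    · rintro (h | h)
      · exact hαq h
      · exact Set.disjoint_left.1 c.disjA₁ h hαA
    · intro v hv hvF
      by_contra hvα
      have hqE : q = u ∨ q = α := by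
        rcases hF v ⟨hvF, hvα⟩ with h | ⟨-, E', hE', hvE'⟩
        · exact hN.end_of_mem hE hv h hqH
        · obtain rfl := hN.arc_eq hE.edge_mem hE'.edge_mem hv hvE'
          exact hE'.inc_right.eq_or_eq_of_isLink hE
      rcases hqE with rfl | rfl
      · exact hqN hu₃
      · exact hαq rfl
  by_cases hz₀F : z₀ ∈ nbrIn G X Y
  · have hqF : ¬ IsLeafNode H q := hc.not_leaf_of_mem hz₀ hz₀F
    rcases c.kind with ⟨hA, ho₁, -, hp₁, -⟩ | ⟨hA, he₁, he₂, ho₁, -, hp₁, hp₂⟩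
    · have hαA : α ∈ A := hA ▸ rfl
      have hαq : α ≠ q := fun h => dA₃ hq (h ▸ hαA)
      refine .two_nodes α q (ho₁ ▸ c.port₁.link.right_mem) hqH
        (hc.not_leaf_of_mem hp₁ c.port₁.p_mem') hqF hαq ?_
        (hαsub hαA ⟨Ey, M₁, Set.subset_insert _ _, c.sconn₁, c.mem₁, y, hy, q, hEy, w₀, hw₀E,
          hw₀F.2 hz₀F, fun _ => Or.inl rfl⟩) ?_
      · intro v hv
        by_cases hvα : v ∈ α
        · exact Or.inl hvα
        · exact Or.inr ((hF v ⟨hv, hvα⟩).imp_right And.right)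
      · exact fun v hv hvE => (huni v hv fun ⟨_, E, hE, h⟩ => hvE E hE h).2 hz₀F
    · have hlα := c.port₁.link
      rw [he₁, ho₁] at hlα
      have hαA : α ∉ A := by rw [hA]; exact Set.notMem_empty _
      refine .node_solid q P₁.x P₂.x α hqH hqF hlα ?_ ?_ ?_ ?_ (hc.not_sprout_arc c hlα)
        ⟨P₂.p, ⟨c.port₂.p_mem', he₂ ▸ c.port₂.p_mem⟩, hp₂⟩
        ⟨P₁.p, ⟨c.port₁.p_mem', he₁ ▸ c.port₁.p_mem⟩, hp₁⟩
      · rintro rfl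
        exact Set.disjoint_left.1 c.disj₁₃ c.port₁.mem hq
      · rintro rfl
        exact Set.disjoint_left.1 c.disj₂₃ c.port₂.mem hq
      · exact fun v hv => (huni v hv fun h => hαA h.1).2 hz₀F
      · intro v hv
        by_cases hvα : v ∈ α
        · exact Or.inr hvα
        · exact Or.inl ((hF v ⟨hv, hvα⟩).resolve_right fun h => hαA h.1)
  · have hF' : ∀ v ∈ nbrIn G X Y \ α, α ∈ A ∧ ∃ E, H.IsLink E α q ∧ v ∈ E := by
      intro v hv
      rcases hF v hv with h | h
      · by_contra hcon
        exact hz₀F ((huni v h hcon).1 hv.1)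
      · exact h
    obtain ⟨f, hf⟩ := c.leg
    obtain ⟨t, ht, -⟩ := hf.exists_serves
    obtain ⟨hαA, g, hg, htg⟩ := hF' t ht
    refine .node_arc α q g hg (fun v hv => ?_) (fun v hv => ?_)
    · by_cases hvα : v ∈ α
      · exact Or.inl hvα
      · obtain ⟨-, E, hE, hvE⟩ := hF' v ⟨hv, hvα⟩
        exact Or.inr (hc.net.simple hE hg ▸ hvE)
    · refine hαsub hαA ⟨g, insert q M₁, le_rfl, c.sconn₁.insert_of_adj hy hyq, Or.inr c.mem₁, q,
        Or.inl rfl, α, hg.symm, t, htg, ht.1, fun h => absurd h ht.2⟩ v hv.1 fun E hE hvE => ?_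
      exact hv.2 (hc.net.simple hE hg ▸ hvE)

lemma exists_shape (hc : Ctx G X H Y) : Shape G H (nbrIn G X Y) := by
  have hN := hc.net.toIsNet
  obtain ⟨L₁, L₂, L₃, A, α, P₁, P₂, M₁, M₂, M₃, c, hcov, hmin⟩ := hc.exists_min_cfg
  by_cases hno : ∀ g p q h, H.IsLink g p q → h ∈ g → h ∈ nbrIn G X Y \ α →
      (p ∈ M₁ ∨ p ∈ M₂) → q ∈ M₃ → h ∈ q
  swap
  · push Not at hno
    obtain ⟨g, p, q, h, hl, hhg, hh, hp | hp, hq, hhq⟩ := hno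
    · exact hc.shape_of_conflict c hcov hl hhg hh hp hq hhq
    · exact hc.shape_of_conflict c.swap hcov.swap hl hhg hh hp hq hhq
  by_cases hM₃ : ∀ N ∈ M₃, N = L₃
  · exact hc.shape_of_subsingleton c hcov hM₃ hno
  push Not at hM₃
  have d₁₃ := Set.disjoint_left.1 c.disj₁₃
  have d₂₃ := Set.disjoint_left.1 c.disj₂₃
  have dA₃ := Set.disjoint_left.1 c.disjA₃
  obtain ⟨U, hUA, hU⟩ := c.exists_avoid
  have hU₃ : U ∉ M₃ := fun h => hU.elim (dA₃ h) (fun h' => d₁₃ h' h)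
  have hleaf₃ : ∀ N ∈ M₃, N ≠ L₃ → ¬ IsLeafNode H N := by
    intro N hN' hne hNl
    rcases c.triple.eq hN hNl with rfl | rfl | rfl
    exacts [d₁₃ c.mem₁ hN', d₂₃ c.mem₂ hN', hne rfl]
  have hvert : ∀ N ∈ M₃, N ≠ L₃ → N ∈ H.vertexSet := by
    intro N hN' hne
    obtain ⟨u, -, hu⟩ := c.sconn₃.exists_comp_diff_adj c.mem₃ hN' hne.symm
    exact (netGraph_adj_mem hu).2
  have hside : ∀ y ∈ H.vertexSet, y ∉ M₃ → y ≠ U → y ∈ M₁ ∨ y ∈ M₂ := by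
    intro y hy hy₃ hyU
    rcases hcov y hy with h | h | h | h
    exacts [Or.inl h, Or.inr h, absurd h hy₃, absurd (hUA y h) hyU]
  set S : Set (Set V) := {q ∈ M₃ | q ≠ L₃ ∧ ∃ y, (y ∈ M₁ ∨ y ∈ M₂) ∧ (netGraph H).Adj y q} with hS
  have hSne : S.Nonempty := by
    obtain ⟨N, hN₃, hNL⟩ := hM₃
    obtain ⟨x, hx, y, hy, hyL, hyU, hxy⟩ := hc.net.exists_adj L₃ U (M₃ \ {L₃})
      (fun N hN => hvert N hN.1 hN.2) ⟨N, hN₃, hNL⟩ (fun h => h.2 rfl) (fun h => hU₃ h.1)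
      (fun N hN => hleaf₃ N hN.1 hN.2)
    exact ⟨x, hx.1, hx.2, y, hside y (netGraph_adj_mem hxy).2 (fun h => hy ⟨h, hyL⟩) hyU, hxy.symm⟩
  obtain ⟨q, ⟨hq, hqL, y, hy, hyq⟩, hmax⟩ := Set.exists_max_image S
    (fun q => (comp (netGraph H) (M₃ \ {q}) L₃).ncard) (Set.toFinite _) hSne
  have hL₃ : L₃ ∈ M₃ \ {q} := ⟨c.mem₃, hqL.symm⟩
  set N₃ := comp (netGraph H) (M₃ \ {q}) L₃ with hN₃def
  have hN₃ : N₃ ⊆ M₃ := comp_diff_subset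
  have hqN : q ∉ N₃ := notMem_comp_diff
  have hs : SConn (netGraph H) N₃ := comp_sconn hL₃
  have hL : L₃ ∈ N₃ := mem_comp hL₃
  obtain ⟨x, hx, hxq⟩ := c.sconn₃.exists_comp_diff_adj c.mem₃ hq hqL.symm
  have hM₃' : M₃ = insert q N₃ := by
    refine Set.Subset.antisymm ?_ (Set.insert_subset hq hN₃)
    by_contra hcon
    obtain ⟨N, hNM, hNn⟩ := Set.not_subset.1 hcon
    have hCL : ∀ N ∈ M₃ \ insert q N₃, N ≠ L₃ := fun N hN h => hN.2 (Or.inr (h ▸ hL))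
    obtain ⟨u, hu, w, hw, hwq, hwU, huw⟩ := hc.net.exists_adj q U (M₃ \ insert q N₃)
      (fun N hN => hvert N hN.1 (hCL N hN)) ⟨N, hNM, hNn⟩ (fun h => h.2 (Or.inl rfl))
      (fun h => hU₃ h.1) (fun N hN => hleaf₃ N hN.1 (hCL N hN))
    have hwM : w ∉ M₃ := fun h => by
      have hwN : w ∈ N₃ := by
        by_contra hwN
        exact hw ⟨h, fun h' => h'.elim hwq hwN⟩
      exact hu.2 (Or.inr (comp_closed w hwN u
        ⟨hu.1, fun h => hu.2 (Or.inl h)⟩ huw.symm))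
    have huS : u ∈ S := ⟨hu.1, hCL u hu, w, hside w (netGraph_adj_mem huw).2 hwM hwU, huw.symm⟩
    have hle := hmax u huS
    have hsub : insert q N₃ ⊆ comp (netGraph H) (M₃ \ {u}) L₃ := by
      refine (hs.insert_of_adj hx hxq).subset_comp ?_ (Or.inr hL)
      intro N hN
      refine ⟨hN.elim (fun h => h ▸ hq) (fun h => hN₃ h), ?_⟩
      rintro rfl
      exact hu.2 hN
    have h1 := Set.ncard_le_ncard hsub (Set.toFinite _)
    rw [Set.ncard_insert_of_notMem hqN (Set.toFinite _)] at h1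
    omega
  have hlt : ¬ M₃.ncard ≤ N₃.ncard := by
    rw [hM₃', Set.ncard_insert_of_notMem hqN (Set.toFinite _)]
    omega
  have hq₁ : q ∉ M₁ := fun h => d₁₃ h hq
  have hq₂ : q ∉ M₂ := fun h => d₂₃ h hq
  have hun : ∀ v ∈ nbrIn G X Y \ α, ∀ E, ¬ Serves H N₃ E v := by
    intro v hv E hsv
    have c' := c.restrict₃ hN₃ hs hL (hsv.leg hv hs hL)
    rcases hy with hy | hy
    · refine hlt (hmin _ _ _ (c'.insert₁ hy hyq hq₂ hqN (dA₃ hq)) fun N hN => ?_)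
      rcases hcov N hN with h | h | h | h
      · exact Or.inl (Or.inr h)
      · exact Or.inr (Or.inl h)
      · rw [hM₃'] at h
        exact h.elim (fun h => Or.inl (Or.inl h)) (fun h => Or.inr (Or.inr (Or.inl h)))
      · exact Or.inr (Or.inr (Or.inr h))
    · refine hlt (hmin _ _ _ (c'.swap.insert₁ hy hyq hq₁ hqN (dA₃ hq)).swap fun N hN => ?_)
      rcases hcov N hN with h | h | h | h
      · exact Or.inl h
      · exact Or.inr (Or.inl (Or.inr h))
      · rw [hM₃'] at h
        exact h.elim (fun h => Or.inr (Or.inl (Or.inl h))) (fun h => Or.inr (Or.inr (Or.inl h)))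
      · exact Or.inr (Or.inr (Or.inr h))
  have hfree : Disjoint (inArcs H N₃) (nbrIn G X Y) := by
    rw [Set.disjoint_left]
    rintro v ⟨E, a, b, hE, ha, hb, hv⟩ hvF
    refine hun v ⟨hvF, fun h => ?_⟩ E ⟨hv, a, ha, b, hE, fun _ => hb⟩
    rcases c.arc_of_mem hN hE hv h with h | h | h | h
    exacts [dA₃ (hN₃ ha) h, dA₃ (hN₃ hb) h, d₁₃ h.1 (hN₃ ha), d₂₃ h.1 (hN₃ ha)]
  have hF : ∀ v ∈ nbrIn G X Y \ α, v ∈ q ∨ α ∈ A ∧ ∃ E, H.IsLink E α q ∧ v ∈ E := by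
    intro v hv
    obtain ⟨E, a, b, hE, hvE, hb⟩ := hc.exists_end c hcov hv
    have hsv : ∀ b a, H.IsLink E a b → b ∈ N₃ → v ∈ a := fun b a hE hb => by
      by_contra hva
      exact hun v hv E ⟨hvE, b, hb, a, hE.symm, fun h => absurd h hva⟩
    by_cases hbq : b = q
    · subst hbq
      rcases hcov a hE.left_mem with ha | ha | ha | ha
      · exact Or.inl (hno E a b v hE hvE hv (Or.inl ha) hb)
      · exact Or.inl (hno E a b v hE hvE hv (Or.inr ha) hb)
      · rw [hM₃'] at ha
        exact Or.inl (hsv a b hE.symm (ha.resolve_left (hN.loopless _ _ _ hE)))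
      · have := (c.eq_of_mem ha).1
        exact Or.inr ⟨this ▸ ha, E, this ▸ hE, hvE⟩
    · have hbN : b ∈ N₃ := by
        rw [hM₃'] at hb
        exact hb.resolve_left hbq
      have hva := hsv b a hE hbN
      rcases hcov a hE.left_mem with ha | ha | ha | ha
      · exact absurd (hno E a b v hE hvE hv (Or.inl ha) hb)
          (hc.not_chord c hN₃ hs hL hfree hE hvE hv.1 ha hbN hva)
      · exact absurd (hno E a b v hE hvE hv (Or.inr ha) hb)
          (hc.not_chord c.swap hN₃ hs hL hfree hE hvE hv.1 ha hbN hva)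
      · rw [hM₃'] at ha
        rcases ha with rfl | ha
        · exact Or.inl hva
        · exact absurd ⟨hvE, a, ha, b, hE, fun _ => hbN⟩ (hun v hv E)
      · exact absurd ((c.eq_of_mem ha).1 ▸ hva) hv.2
  rcases hy with hy | hy
  · exact hc.shape_of_node c hcov hM₃' hqN hs hL hfree hF hy hyq hx hxq
  · exact hc.shape_of_node c.swap hcov.swap hM₃' hqN hs hL hfree hF hy hyq hx hxq

end Ctx

end Shape

/-! ### Shapes are sticky -/

section Sticky

variable {V : Type*} {G : SimpleGraph V} {X Y A B : Set V} {H : Graph (Set V) (Set V)} {y₁ y₂ : V}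

/-- The path `G[Y]` has at least two vertices and ends `y₁`, `y₂`; the sets `A` and `B` consist of the
neighbors in `X` of `Y ∖ {y₂}` and `Y ∖ {y₁}`. -/
structure Ends (G : SimpleGraph V) (X : Set V) (H : Graph (Set V) (Set V)) (Y A B : Set V)
    (y₁ y₂ : V) : Prop where
  cover : ∀ v ∈ nbrIn G X Y, v ∈ A ∨ v ∈ B
  subset_left : A ⊆ nbrIn G X Y
  subset_right : B ⊆ nbrIn G X Y
  ends : ∀ y, IsEndOf G Y y → y = y₁ ∨ y = y₂
  inner : ∀ y ∈ Y, ¬ IsEndOf G Y y → nbrIn G X {y} ⊆ A ∩ B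
  tamed_left : Tamed H A
  tamed_right : Tamed H B
  adj_left : ∀ v ∈ nbrIn G X Y, v ∉ B → G.Adj y₁ v
  adj_right : ∀ v ∈ nbrIn G X Y, v ∉ A → G.Adj y₂ v
  mem_left : ∀ v ∈ X, G.Adj y₁ v → v ∈ A
  mem_right : ∀ v ∈ X, G.Adj y₂ v → v ∈ B

lemma Ends.swap (h : Ends G X H Y A B y₁ y₂) : Ends G X H Y B A y₂ y₁ where
  cover v hv := (h.cover v hv).symm
  subset_left := h.subset_right
  subset_right := h.subset_left
  ends y hy := (h.ends y hy).symm
  inner y hy hy' := (h.inner y hy hy').trans (Set.inter_comm A B).subset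
  tamed_left := h.tamed_right
  tamed_right := h.tamed_left
  adj_left := h.adj_right
  adj_right := h.adj_left
  mem_left := h.mem_right
  mem_right := h.mem_left

lemma IndPath.isEndOf_iff {n : ℕ} {f : ℕ → V} (hf : IndPath G n f) {i : ℕ} (hi : i ≤ n) :
    IsEndOf G (seg f 0 n) (f i) ↔ i = 0 ∨ i = n := by
  constructor
  · rintro ⟨-, h⟩
    by_contra hcon
    push Not at hcon
    have h1 : f (i - 1) ∈ {w ∈ seg f 0 n | G.Adj (f i) w} :=
      ⟨mem_seg (by omega) (by omega), (hf.adj _ hi _ (by omega)).2 (by omega)⟩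
    have h2 : f (i + 1) ∈ {w ∈ seg f 0 n | G.Adj (f i) w} :=
      ⟨mem_seg (by omega) (by omega), (hf.adj _ hi _ (by omega)).2 (by omega)⟩
    have := hf.inj _ (by omega) _ (by omega) (h h1 h2)
    omega
  · intro h
    refine ⟨mem_seg (by omega) hi, ?_⟩
    rintro _ ⟨⟨j, ⟨-, hj⟩, rfl⟩, hij⟩ _ ⟨⟨k, ⟨-, hk⟩, rfl⟩, hik⟩
    rw [hf.adj _ hi _ hj] at hij
    rw [hf.adj _ hi _ hk] at hik
    congr 1
    omega

lemma Ctx.exists_ends (hc : Ctx G X H Y) :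
    (∃ A B y₁ y₂, Ends G X H Y A B y₁ y₂) ∨
      ∀ y ∈ Y, IsEndOf G Y y ∧ ∀ v ∈ nbrIn G X Y, G.Adj y v := by
  obtain ⟨n, f, hf, hY⟩ := hc.exists_indPath
  rcases Nat.eq_zero_or_pos n with rfl | hn
  · right
    intro y hy
    rw [hY] at hy ⊢
    obtain ⟨i, ⟨-, hi⟩, rfl⟩ := hy
    refine ⟨(hf.isEndOf_iff hi).2 (by omega), ?_⟩
    rintro v ⟨-, _, ⟨j, ⟨-, hj⟩, rfl⟩, hjv⟩
    obtain rfl : i = j := by omega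
    exact hjv
  · left
    have hl : seg f 0 (n - 1) ⊆ Y := hY ▸ seg_subset le_rfl (by omega)
    have hr : seg f 1 n ⊆ Y := hY ▸ seg_subset (by omega) le_rfl
    have hmem : ∀ i ≤ n, ∀ v ∈ X, G.Adj (f i) v → (i ≠ n → v ∈ nbrIn G X (seg f 0 (n - 1))) ∧
        (i ≠ 0 → v ∈ nbrIn G X (seg f 1 n)) := fun i hi v hv hiv =>
      ⟨fun h => ⟨hv, f i, mem_seg (by omega) (by omega), hiv⟩,
        fun h => ⟨hv, f i, mem_seg (by omega) (by omega), hiv⟩⟩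
    have hnb : ∀ v ∈ nbrIn G X Y, ∃ i ≤ n, G.Adj (f i) v := by
      rintro v ⟨-, y, hy, hyv⟩
      rw [hY] at hy
      obtain ⟨i, ⟨-, hi⟩, rfl⟩ := hy
      exact ⟨i, hi, hyv⟩
    refine ⟨nbrIn G X (seg f 0 (n - 1)), nbrIn G X (seg f 1 n), f 0, f n, ?_, nbrIn_mono hl,
      nbrIn_mono hr, ?_, ?_, hc.tamed_seg hf hY (by omega) (by omega) (by omega),
      hc.tamed_seg hf hY (by omega) (by omega) (by omega), ?_, ?_, ?_, ?_⟩
    · intro v hv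
      obtain ⟨i, hi, hiv⟩ := hnb v hv
      by_cases hin : i = n
      · exact Or.inr ((hmem i hi v hv.1 hiv).2 (by omega))
      · exact Or.inl ((hmem i hi v hv.1 hiv).1 hin)
    · intro y hy
      have hyY := hy.1
      rw [hY] at hyY hy
      obtain ⟨i, ⟨-, hi⟩, rfl⟩ := hyY
      rcases (hf.isEndOf_iff hi).1 hy with rfl | rfl
      exacts [Or.inl rfl, Or.inr rfl]
    · intro y hyY hy
      rw [hY] at hyY hy
      obtain ⟨i, ⟨-, hi⟩, rfl⟩ := hyY
      rw [hf.isEndOf_iff hi] at hy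
      push Not at hy
      rintro v ⟨hv, _, rfl, hiv⟩
      exact ⟨(hmem i hi v hv hiv).1 hy.2, (hmem i hi v hv hiv).2 hy.1⟩
    · intro v hv hvB
      obtain ⟨i, hi, hiv⟩ := hnb v hv
      by_cases hi0 : i = 0
      · exact hi0 ▸ hiv
      · exact absurd ((hmem i hi v hv.1 hiv).2 hi0) hvB
    · intro v hv hvA
      obtain ⟨i, hi, hiv⟩ := hnb v hv
      by_cases hin : i = n
      · exact hin ▸ hiv
      · exact absurd ((hmem i hi v hv.1 hiv).1 hin) hvA
    · exact fun v hv h => (hmem 0 (by omega) v hv h).1 (by omega)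
    · exact fun v hv h => (hmem n le_rfl v hv h).2 (by omega)

lemma isChunk_arc {E U W : Set V} (h : H.IsLink E U W) : IsChunk H U W E :=
  ⟨{{E}}, Set.singleton_nonempty _, by rintro _ rfl; exact Or.inl ⟨E, h, rfl⟩, by simp⟩

namespace Ctx

lemma solid_of_union (hc : Ctx G X H Y) {S₁ S₂ : Set V} (h₁ : SolidSet G H S₁)
    (h₂ : SolidSet G H S₂) (hF : nbrIn G X Y = S₁ ∪ S₂)
    (hd : ∀ A B y₁ y₂, Ends G X H Y A B y₁ y₂ → ∀ v ∈ A, v ∉ B) : Sticky G X H Y := by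
  refine Or.inl ⟨⟨S₁, S₂, h₁, h₂, hF⟩, fun y hy hy' => ?_⟩
  rcases hc.exists_ends with ⟨A, B, y₁, y₂, h⟩ | h
  · rw [Set.eq_empty_iff_forall_notMem]
    intro v hv
    have := h.inner y hy hy' hv
    exact hd A B y₁ y₂ h v this.1 this.2
  · exact absurd (h y hy).1 hy'

lemma link_of_mem_mem (hc : Ctx G X H Y) {a b E : Set V} {v : V} (ha : a ∈ H.vertexSet) (hb : b ∈ H.vertexSet)
    (hab : a ≠ b) (hE : E ∈ H.edgeSet) (hv : v ∈ E) (hva : v ∈ a) (hvb : v ∈ b) :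
    H.IsLink E a b := by
  obtain ⟨x, hx⟩ := hc.net.inc_of_mem hE hv hva ha
  rcases hc.net.end_of_mem hx hv hvb hb with rfl | rfl
  · exact absurd rfl hab
  · exact hx

lemma exists_adj_ne (hc : Ctx G X H Y) {a : Set V} (ha : a ∈ H.vertexSet) (hal : ¬ IsLeafNode H a) {U W : Set V}
    (hU : U ≠ a) (hW : W ≠ a) : ∃ E y, H.IsLink E a y ∧ y ≠ U ∧ y ≠ W := by
  obtain ⟨x, rfl, y, -, hyU, hyW, -, E, hE⟩ := hc.net.exists_adj U W {a}
    (Set.singleton_subset_iff.2 ha) (Set.singleton_nonempty _) hU hW (by rintro _ rfl; exact hal)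
  exact ⟨E, y, hE, hyU, hyW⟩

lemma sticky_of_node_arc (hc : Ctx G X H Y) {a b g : Set V} (hl : H.IsLink g a b) (hF : nbrIn G X Y ⊆ a ∪ g)
    (haF : a \ g ⊆ nbrIn G X Y) : Sticky G X H Y := by
  have hN := hc.net.toIsNet
  have hab := hN.loopless _ _ _ hl
  have hga : ∀ v ∈ a, v ∈ b → v ∈ g := fun v hva hvb => by
    obtain ⟨E, _, _, hE, hvE⟩ := hN.exists_link (hN.node_subset a hl.left_mem hva)
    exact hc.net.simple (hc.link_of_mem_mem hl.left_mem hl.right_mem hab hE.edge_mem hvE hva hvb) hl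
      ▸ hvE
  refine Or.inr ⟨g, a, b, isChunk_arc hl, fun v hv => Or.inl (hF hv), fun y hy => ⟨?_, Or.inl ?_⟩⟩
  · rcases hc.exists_ends with ⟨A, B, y₁, y₂, h⟩ | h
    · obtain ⟨t, ht, hta⟩ : ∃ t ∈ nbrIn G X Y, t ∉ a := by
        by_contra hcon
        push Not at hcon
        exact hc.wild.prop.2.2 fun u hu v hv => Or.inr ⟨a, hl.left_mem, hcon u hu, hcon v hv⟩
      have htg : t ∈ g := (hF ht).resolve_left hta
      have key : ∀ T, Tamed H T → t ∈ T → ∀ x ∈ a, x ∈ T → x ∈ g := by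
        intro T hT htT x hxa hxT
        rcases hT x hxT t htT with ⟨E, hE, hxE, htE⟩ | ⟨N, hNH, hxN, htN⟩
        · exact hN.arc_eq hE hl.edge_mem htE htg ▸ hxE
        · rcases hN.end_of_mem hl htg htN hNH with rfl | rfl
          · exact absurd htN hta
          · exact hga x hxa hxN
      have main : ∀ A B y₁ y₂, Ends G X H Y A B y₁ y₂ → t ∈ A →
          (y = y₁ ∨ y = y₂) → G.neighborSet y ∩ a ⊆ g ∨ a ⊆ g ∪ G.neighborSet y := by
        rintro A B y₁ y₂ h htA (rfl | rfl)
        · exact Or.inl fun v hv => key A h.tamed_left htA v hv.2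
            (h.mem_left v (hN.node_subset a hl.left_mem hv.2) hv.1)
        · refine Or.inr fun v hv => ?_
          by_cases hvg : v ∈ g
          · exact Or.inl hvg
          · exact Or.inr (h.adj_right v (haF ⟨hv, hvg⟩) fun hvA =>
              hvg (key A h.tamed_left htA v hv hvA))
      rcases h.cover t ht with htA | htB
      · exact main A B y₁ y₂ h htA (h.ends y hy)
      · exact main B A y₂ y₁ h.swap htB (h.ends y hy).symm
    · refine Or.inr fun v hv => ?_
      by_cases hvg : v ∈ g
      · exact Or.inl hvg
      · exact Or.inr ((h y hy.1).2 v (haF ⟨hv, hvg⟩))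
  · rintro v ⟨hyv, hvb⟩
    rcases hF ⟨hN.node_subset b hl.right_mem hvb, y, hy.1, hyv⟩ with hva | hvg
    · exact hga v hva hvb
    · exact hvg

lemma sticky_of_node_solid (hc : Ctx G X H Y) {a p q g : Set V} (ha : a ∈ H.vertexSet) (hal : ¬ IsLeafNode H a)
    (hl : H.IsLink g p q) (hap : a ≠ p) (haq : a ≠ q)
    (haF : a ⊆ nbrIn G X Y) (hF : nbrIn G X Y ⊆ a ∪ g)
    (hs : ¬ ∃ T ⊆ g, IsSprout G (nbrIn G X Y ∩ g) p q T)
    (hp : ∃ v ∈ nbrIn G X Y ∩ g, v ∉ p) (hq : ∃ v ∈ nbrIn G X Y ∩ g, v ∉ q) :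
    Sticky G X H Y := by
  have hN := hc.net.toIsNet
  refine hc.solid_of_union (Or.inl ha) (Or.inr ⟨g, p, q, hl, Set.inter_subset_right, hs⟩) ?_ ?_
  · refine Set.Subset.antisymm (fun v hv => ?_) (Set.union_subset haF Set.inter_subset_left)
    exact (hF hv).imp_right fun h => ⟨hv, h⟩
  intro A B y₁ y₂ h z hzA hzB
  have htame : ∀ v ∈ nbrIn G X Y, (∃ E ∈ H.edgeSet, z ∈ E ∧ v ∈ E) ∨
      ∃ N ∈ H.vertexSet, z ∈ N ∧ v ∈ N := fun v hv => by
    rcases h.cover v hv with hvA | hvB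
    exacts [h.tamed_left z hzA v hvA, h.tamed_right z hzB v hvB]
  have hag : ∀ v ∈ a, v ∉ g := fun v hva hvg => by
    rcases hN.end_of_mem hl hvg hva ha with h | h <;> contradiction
  -- vertices of `a` and `g` are tamed only by a common node in `{p, q}`
  have hshare : ∀ u ∈ a, ∀ v ∈ g, ((∃ E ∈ H.edgeSet, u ∈ E ∧ v ∈ E) ∨
      ∃ N ∈ H.vertexSet, u ∈ N ∧ v ∈ N) →
      ∃ N, (N = p ∨ N = q) ∧ u ∈ N ∧ v ∈ N := by
    rintro u hu v hv (⟨E, hE, huE, hvE⟩ | ⟨N, hNH, huN, hvN⟩)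
    · exact absurd (hN.arc_eq hE hl.edge_mem hvE hv ▸ huE) (hag u hu)
    · exact ⟨N, hN.end_of_mem hl hv hvN hNH, huN, hvN⟩
  have hpH := hl.left_mem
  have hqH := hl.right_mem
  rcases hF (h.subset_left hzA) with hza | hzg
  · obtain ⟨v, hv, hvp⟩ := hp
    obtain ⟨w, hw, hwq⟩ := hq
    obtain ⟨N, hNp | hNp, hzN, hvN⟩ := hshare z hza v hv.2 (htame v hv.1)
    · exact hvp (hNp ▸ hvN)
    subst hNp
    obtain ⟨N', hN' | hN', hzN', hwN'⟩ := hshare z hza w hw.2 (htame w hw.1)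
    · subst hN'
      obtain ⟨E, _, _, hE, hzE⟩ := hN.exists_link (h.subset_left hzA).1
      have h1 := hc.link_of_mem_mem ha hpH hap hE.edge_mem hzE hza hzN'
      rcases hN.end_of_mem h1 hzE hzN hqH with h | h
      · exact haq h.symm
      · exact hN.loopless _ _ _ hl h.symm
    · exact hwq (hN' ▸ hwN')
  · obtain ⟨E, y, hE, hyp, hyq⟩ := hc.exists_adj_ne ha hal hap.symm haq.symm
    obtain ⟨x, hxE, hxa⟩ := hN.exists_mem hE
    obtain ⟨N, hNpq, hxN, -⟩ := hshare x hxa z hzg (by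
      rcases htame x (haF hxa) with ⟨E, hE, h1, h2⟩ | ⟨N, hNH, h1, h2⟩
      exacts [Or.inl ⟨E, hE, h2, h1⟩, Or.inr ⟨N, hNH, h2, h1⟩])
    have hNH : N ∈ H.vertexSet := by rcases hNpq with rfl | rfl <;> assumption
    rcases hN.end_of_mem hE hxE hxN hNH with rfl | rfl <;> rcases hNpq with rfl | rfl <;>
      contradiction

lemma sticky_of_two_arcs (hc : Ctx G X H Y) {e g x y p q : Set V} (he : H.IsLink e x y) (hg : H.IsLink g p q)
    (heg : e ≠ g) (hF : nbrIn G X Y ⊆ e ∪ g)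
    (hse : ¬ ∃ T ⊆ e, IsSprout G (nbrIn G X Y ∩ e) x y T)
    (hsg : ¬ ∃ T ⊆ g, IsSprout G (nbrIn G X Y ∩ g) p q T)
    (hx : ∃ v ∈ nbrIn G X Y ∩ e, v ∉ x) (hy : ∃ v ∈ nbrIn G X Y ∩ e, v ∉ y)
    (hp : ∃ v ∈ nbrIn G X Y ∩ g, v ∉ p) (hq : ∃ v ∈ nbrIn G X Y ∩ g, v ∉ q) :
    Sticky G X H Y := by
  have hN := hc.net.toIsNet
  refine hc.solid_of_union (Or.inr ⟨e, x, y, he, Set.inter_subset_right, hse⟩)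
    (Or.inr ⟨g, p, q, hg, Set.inter_subset_right, hsg⟩) ?_ ?_
  · refine Set.Subset.antisymm (fun v hv => ?_)
      (Set.union_subset Set.inter_subset_left Set.inter_subset_left)
    exact (hF hv).imp (fun h => ⟨hv, h⟩) fun h => ⟨hv, h⟩
  intro A B y₁ y₂ h z hzA hzB
  have htame : ∀ v ∈ nbrIn G X Y, (∃ E ∈ H.edgeSet, z ∈ E ∧ v ∈ E) ∨
      ∃ N ∈ H.vertexSet, z ∈ N ∧ v ∈ N := fun v hv => by
    rcases h.cover v hv with hvA | hvB
    exacts [h.tamed_left z hzA v hvA, h.tamed_right z hzB v hvB]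
  have key : ∀ e g x y p q, H.IsLink e x y → H.IsLink g p q → e ≠ g → z ∈ e →
      (∃ v ∈ nbrIn G X Y ∩ g, v ∉ p) → (∃ v ∈ nbrIn G X Y ∩ g, v ∉ q) → False := by
    rintro e g x y p q he hg heg hze ⟨v, hv, hvp⟩ ⟨w, hw, hwq⟩
    have hshare : ∀ v ∈ nbrIn G X Y ∩ g, (z ∈ p ∧ v ∈ p) ∨ (z ∈ q ∧ v ∈ q) := by
      rintro v ⟨hvF, hvg⟩
      rcases htame v hvF with ⟨E, hE, hzE, hvE⟩ | ⟨N, hNH, hzN, hvN⟩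
      · exact absurd ((hN.arc_eq he.edge_mem hE hze hzE).trans
          (hN.arc_eq hE hg.edge_mem hvE hvg)) heg
      · rcases hN.end_of_mem hg hvg hvN hNH with rfl | rfl
        exacts [Or.inl ⟨hzN, hvN⟩, Or.inr ⟨hzN, hvN⟩]
    have hzq := ((hshare v hv).resolve_left fun h => hvp h.2).1
    have hzp := ((hshare w hw).resolve_right fun h => hwq h.2).1
    exact heg (hc.net.simple (hc.link_of_mem_mem hg.left_mem hg.right_mem (hN.loopless _ _ _ hg)
      he.edge_mem hze hzp hzq) hg)
  rcases hF (h.subset_left hzA) with hze | hzg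
  · exact key e g x y p q he hg heg hze hp hq
  · exact key g e p q x y hg he heg.symm hzg hx hy

end Ctx

end Sticky

section TwoNodes

variable {V : Type*} {G : SimpleGraph V} {X Y A B S T : Set V} {H : Graph (Set V) (Set V)}

/-- `v` is a vertex of the node `a` outside the arc `aq`. -/
def OffArc (H : Graph (Set V) (Set V)) (a q : Set V) (v : V) : Prop :=
  v ∈ a ∧ ∀ E, H.IsLink E a q → v ∉ E

namespace Ctx

lemma OffArc.exists_link (hc : Ctx G X H Y) {a q : Set V} (ha : a ∈ H.vertexSet) {v : V}
    (hv : OffArc H a q v) : ∃ E x, H.IsLink E a x ∧ v ∈ E ∧ x ≠ q := by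
  obtain ⟨E, _, _, hE, hvE⟩ := hc.net.exists_link (hc.net.node_subset a ha hv.1)
  obtain ⟨x, hx⟩ := hc.net.inc_of_mem hE.edge_mem hvE hv.1 ha
  refine ⟨E, x, hx, hvE, ?_⟩
  rintro rfl
  exact hv.2 E hx hvE

lemma exists_offArc (hc : Ctx G X H Y) {a q E x : Set V} (hE : H.IsLink E a x) (hxq : x ≠ q)
    (haq : a ≠ q) : ∃ v ∈ E, OffArc H a q v := by
  obtain ⟨v, hvE, hva⟩ := hc.net.exists_mem hE
  refine ⟨v, hvE, hva, fun E' hE' hvE' => ?_⟩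
  obtain rfl := hc.net.arc_eq hE.edge_mem hE'.edge_mem hvE hvE'
  rcases hE'.inc_right.eq_or_eq_of_isLink hE with h | h
  · exact haq h.symm
  · exact hxq h.symm

/-- Tamed vertices at `a` and `q` outside the arc `aq` belong to a common third node. -/
lemma end_eq_of_tamed (hc : Ctx G X H Y) {a q : Set V} (haq : a ≠ q) (hT : Tamed H T) {u v : V}
    (hu : OffArc H a q u) (hv : OffArc H q a v) (huT : u ∈ T) (hvT : v ∈ T) {E E' x y : Set V}
    (hE : H.IsLink E a x) (huE : u ∈ E) (hE' : H.IsLink E' q y) (hvE : v ∈ E') : x = y := by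
  have hN := hc.net.toIsNet
  have hxq : x ≠ q := by
    rintro rfl
    exact hu.2 E hE huE
  have hya : a ≠ y := by
    rintro rfl
    exact hv.2 E' hE' hvE
  rcases hT u huT v hvT with ⟨D, hD, huD, hvD⟩ | ⟨N, hNH, huN, hvN⟩
  · obtain rfl := hN.arc_eq hE.edge_mem hD huE huD
    obtain rfl := hN.arc_eq hE'.edge_mem hD hvE hvD
    rcases hE.inc_left.eq_or_eq_of_isLink hE' with h | h <;> contradiction
  · rcases hN.end_of_mem hE huE huN hNH with rfl | rfl <;>
      rcases hN.end_of_mem hE' hvE hvN hNH with h | h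
    exacts [absurd h haq, absurd h hya, absurd h hxq, h]

lemma exists_notMem_of_tamed (hc : Ctx G X H Y) {a q : Set V} (ha : a ∈ H.vertexSet)
    (hq : q ∈ H.vertexSet) (hql : ¬ IsLeafNode H q) (haq : a ≠ q) (hT : Tamed H T) {u : V}
    (hu : OffArc H a q u) (huT : u ∈ T) : ∃ v, OffArc H q a v ∧ v ∉ T := by
  obtain ⟨E, x, hE, huE, hxq⟩ := OffArc.exists_link hc ha hu
  obtain ⟨E', y, hE', hya, hyx⟩ := hc.exists_adj_ne hq hql haq hxq
  obtain ⟨v, hvE, hv⟩ := hc.exists_offArc hE' hya haq.symm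
  exact ⟨v, hv, fun hvT => hyx (hc.end_eq_of_tamed haq hT hu hv huT hvT hE huE hE' hvE).symm⟩

lemma not_tamed_of_offArc (hc : Ctx G X H Y) {a q : Set V} (ha : a ∈ H.vertexSet)
    (hq : q ∈ H.vertexSet) (hal : ¬ IsLeafNode H a) (hql : ¬ IsLeafNode H q) (haq : a ≠ q)
    (hT : Tamed H T) (hS : Tamed H S) (haTS : ∀ v, OffArc H a q v → v ∈ T ∨ v ∈ S)
    (hqTS : ∀ v, OffArc H q a v → v ∈ T ∨ v ∈ S) {u v : V} (hu : OffArc H a q u)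
    (hv : OffArc H q a v) (huT : u ∈ T) : v ∉ T := by
  intro hvT
  obtain ⟨u', hu', hu'T⟩ := hc.exists_notMem_of_tamed hq ha hal haq.symm hT hv hvT
  obtain ⟨v', hv', hv'T⟩ := hc.exists_notMem_of_tamed ha hq hql haq hT hu huT
  have hu'S := (haTS u' hu').resolve_left hu'T
  have hv'S := (hqTS v' hv').resolve_left hv'T
  obtain ⟨E₁, x₁, hE₁, huE, hx₁⟩ := OffArc.exists_link hc ha hu
  obtain ⟨E₂, x₂, hE₂, hvE, hx₂⟩ := OffArc.exists_link hc hq hv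
  obtain ⟨E₃, x₃, hE₃, hu'E, hx₃⟩ := OffArc.exists_link hc ha hu'
  obtain ⟨E₄, x₄, hE₄, hv'E, hx₄⟩ := OffArc.exists_link hc hq hv'
  have h12 := hc.end_eq_of_tamed haq hT hu hv huT hvT hE₁ huE hE₂ hvE
  have h34 := hc.end_eq_of_tamed haq hS hu' hv' hu'S hv'S hE₃ hu'E hE₄ hv'E
  have hne₁ := hc.net.loopless _ _ _ hE₁
  have hne₃ := hc.net.loopless _ _ _ hE₃
  obtain ⟨w, hw, y, hy, hyx₁, hyx₃, -, E, hE⟩ := hc.net.exists_adj x₁ x₃ {a, q}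
    (by rintro _ (rfl | rfl) <;> assumption) ⟨a, Or.inl rfl⟩
    (by rintro (h | h); exacts [hne₁ h.symm, hx₁ h])
    (by rintro (h | h); exacts [hne₃ h.symm, hx₃ h])
    (by rintro _ (rfl | rfl) <;> assumption)
  have hya : y ≠ a := fun h => hy (Or.inl h)
  have hyq : y ≠ q := fun h => hy (Or.inr h)
  rcases hw with rfl | rfl
  · obtain ⟨z, hzE, hz⟩ := hc.exists_offArc hE hyq haq
    rcases haTS z hz with hzT | hzS
    · exact hyx₁ ((hc.end_eq_of_tamed haq hT hz hv hzT hvT hE hzE hE₂ hvE).trans h12.symm)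
    · exact hyx₃ ((hc.end_eq_of_tamed haq hS hz hv' hzS hv'S hE hzE hE₄ hv'E).trans h34.symm)
  · obtain ⟨z, hzE, hz⟩ := hc.exists_offArc hE hya haq.symm
    rcases hqTS z hz with hzT | hzS
    · exact hyx₁ (hc.end_eq_of_tamed haq hT hu hz huT hzT hE₁ huE hE hzE).symm
    · exact hyx₃ (hc.end_eq_of_tamed haq hS hu' hz hu'S hzS hE₃ hu'E hE hzE).symm

lemma sticky_of_two_nodes (hc : Ctx G X H Y) {a q : Set V} (ha : a ∈ H.vertexSet)
    (hq : q ∈ H.vertexSet) (hal : ¬ IsLeafNode H a) (hql : ¬ IsLeafNode H q) (haq : a ≠ q)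
    (hF : ∀ v ∈ nbrIn G X Y, v ∈ a ∨ v ∈ q ∨ ∃ E, H.IsLink E a q ∧ v ∈ E)
    (haF : ∀ v, OffArc H a q v → v ∈ nbrIn G X Y)
    (hqF : ∀ v, OffArc H q a v → v ∈ nbrIn G X Y) : Sticky G X H Y := by
  have hN := hc.net.toIsNet
  have hsplit : ∀ A B y₁ y₂, Ends G X H Y A B y₁ y₂ →
      ((∀ v, OffArc H a q v → v ∉ B) ∧ ∀ v, OffArc H q a v → v ∉ A) ∨
      ((∀ v, OffArc H a q v → v ∉ A) ∧ ∀ v, OffArc H q a v → v ∉ B) := by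
    intro A B y₁ y₂ h
    have hA : ∀ u v, OffArc H a q u → OffArc H q a v → u ∈ A → v ∉ A := fun u v hu hv =>
      hc.not_tamed_of_offArc ha hq hal hql haq h.tamed_left h.tamed_right
        (fun v hv => h.cover v (haF v hv)) (fun v hv => h.cover v (hqF v hv)) hu hv
    have hB : ∀ u v, OffArc H a q u → OffArc H q a v → u ∈ B → v ∉ B := fun u v hu hv =>
      hc.not_tamed_of_offArc ha hq hal hql haq h.tamed_right h.tamed_left
        (fun v hv => (h.cover v (haF v hv)).symm) (fun v hv => (h.cover v (hqF v hv)).symm) hu hv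
    obtain ⟨E, x, hE, hxq, -⟩ := hc.exists_adj_ne ha hal haq.symm haq.symm
    obtain ⟨u₀, -, hu₀⟩ := hc.exists_offArc hE hxq haq
    obtain ⟨E', x', hE', hxa, -⟩ := hc.exists_adj_ne hq hql haq haq
    obtain ⟨v₀, -, hv₀⟩ := hc.exists_offArc hE' hxa haq.symm
    rcases h.cover u₀ (haF u₀ hu₀) with hu₀A | hu₀B
    · left
      have h1 : ∀ v, OffArc H q a v → v ∉ A := fun v hv => hA u₀ v hu₀ hv hu₀A
      have hv₀B := (h.cover v₀ (hqF v₀ hv₀)).resolve_left (h1 v₀ hv₀)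
      exact ⟨fun v hv hvB => hB v v₀ hv hv₀ hvB hv₀B, h1⟩
    · right
      have h1 : ∀ v, OffArc H q a v → v ∉ B := fun v hv => hB u₀ v hu₀ hv hu₀B
      have hv₀A := (h.cover v₀ (hqF v₀ hv₀)).resolve_right (h1 v₀ hv₀)
      exact ⟨fun v hv hvA => hA v v₀ hv hv₀ hvA hv₀A, h1⟩
  by_cases hadj : ∃ E, H.IsLink E a q
  · obtain ⟨E, hE⟩ := hadj
    have hoff₁ : ∀ v ∈ a, v ∉ E → OffArc H a q v := fun v hv hvE =>
      ⟨hv, fun E' hE' h => hvE (hc.net.simple hE' hE ▸ h)⟩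
    have hoff₂ : ∀ v ∈ q, v ∉ E → OffArc H q a v := fun v hv hvE =>
      ⟨hv, fun E' hE' h => hvE (hc.net.simple hE'.symm hE ▸ h)⟩
    refine Or.inr ⟨E, a, q, isChunk_arc hE, ?_, fun y hy => ?_⟩
    · intro v hv
      rcases hF v hv with h | h | ⟨E', hE', h⟩
      · exact Or.inl (Or.inl h)
      · exact Or.inr h
      · exact Or.inl (Or.inr (hc.net.simple hE' hE ▸ h))
    rcases hc.exists_ends with ⟨A, B, y₁, y₂, h⟩ | h
    · have main : ∀ A B y₁ y₂, Ends G X H Y A B y₁ y₂ → (∀ v, OffArc H a q v → v ∉ B) →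
          (∀ v, OffArc H q a v → v ∉ A) → (y = y₁ ∨ y = y₂) →
          (G.neighborSet y ∩ a ⊆ E ∨ a ⊆ E ∪ G.neighborSet y) ∧
          (G.neighborSet y ∩ q ⊆ E ∨ q ⊆ E ∪ G.neighborSet y) := by
        rintro A B y₁ y₂ h h₁ h₂ (rfl | rfl)
        · refine ⟨Or.inr fun v hv => ?_, Or.inl fun v hv => ?_⟩
          · by_cases hvE : v ∈ E
            · exact Or.inl hvE
            · exact Or.inr (h.adj_left v (haF v (hoff₁ v hv hvE)) (h₁ v (hoff₁ v hv hvE)))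
          · by_contra hvE
            exact h₂ v (hoff₂ v hv.2 hvE) (h.mem_left v (hN.node_subset q hq hv.2) hv.1)
        · refine ⟨Or.inl fun v hv => ?_, Or.inr fun v hv => ?_⟩
          · by_contra hvE
            exact h₁ v (hoff₁ v hv.2 hvE) (h.mem_right v (hN.node_subset a ha hv.2) hv.1)
          · by_cases hvE : v ∈ E
            · exact Or.inl hvE
            · exact Or.inr (h.adj_right v (hqF v (hoff₂ v hv hvE)) (h₂ v (hoff₂ v hv hvE)))
      rcases hsplit A B y₁ y₂ h with h' | h'
      · exact main A B y₁ y₂ h h'.1 h'.2 (h.ends y hy)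
      · exact main B A y₂ y₁ h.swap h'.1 h'.2 (h.ends y hy).symm
    · refine ⟨Or.inr fun v hv => ?_, Or.inr fun v hv => ?_⟩
      · by_cases hvE : v ∈ E
        · exact Or.inl hvE
        · exact Or.inr ((h y hy.1).2 v (haF v (hoff₁ v hv hvE)))
      · by_cases hvE : v ∈ E
        · exact Or.inl hvE
        · exact Or.inr ((h y hy.1).2 v (hqF v (hoff₂ v hv hvE)))
  · push Not at hadj
    have hoff₁ : ∀ v ∈ a, OffArc H a q v := fun v hv => ⟨hv, fun E hE => absurd hE (hadj E)⟩
    have hoff₂ : ∀ v ∈ q, OffArc H q a v := fun v hv => ⟨hv, fun E hE => absurd hE.symm (hadj E)⟩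
    have hF' : ∀ v ∈ nbrIn G X Y, v ∈ a ∨ v ∈ q := fun v hv =>
      (hF v hv).imp_right fun h => h.resolve_right fun ⟨E, hE, _⟩ => hadj E hE
    refine hc.solid_of_union (Or.inl ha) (Or.inl hq) ?_ ?_
    · exact Set.Subset.antisymm hF' (Set.union_subset (fun v hv => haF v (hoff₁ v hv))
        fun v hv => hqF v (hoff₂ v hv))
    · intro A B y₁ y₂ h v hvA hvB
      rcases hsplit A B y₁ y₂ h with ⟨h₁, h₂⟩ | ⟨h₁, h₂⟩ <;>
        rcases hF' v (h.subset_left hvA) with hva | hvq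
      exacts [h₁ v (hoff₁ v hva) hvB, h₂ v (hoff₂ v hvq) hvA, h₁ v (hoff₁ v hva) hvA,
        h₂ v (hoff₂ v hvq) hvB]

lemma sticky [Finite V] (hc : Ctx G X H Y) : Sticky G X H Y := by
  rcases hc.exists_shape with ⟨a, q, ha, hq, hal, hql, haq, hF, haF, hqF⟩ | ⟨a, b, g, hl, hF, haF⟩ |
    ⟨a, p, q, g, ha, hal, hl, hap, haq, haF, hF, hs, hp, hq⟩ |
    ⟨e, g, x, y, p, q, he, hg, heg, hF, hse, hsg, hx, hy, hp, hq⟩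
  · exact hc.sticky_of_two_nodes ha hq hal hql haq hF (fun v hv => haF v hv.1 hv.2)
      (fun v hv => hqF v hv.1 fun E hE => hv.2 E hE.symm)
  · exact hc.sticky_of_node_arc hl hF haF
  · exact hc.sticky_of_node_solid ha hal hl hap haq haF hF hs hp hq
  · exact hc.sticky_of_two_arcs he hg heg hF hse hsg hx hy hp hq

end Ctx

/-- Every leaf of `G` is the vertex of a leaf node. -/
lemma IsNet.isLeafNode_of_isLeaf [Finite V] (hN : IsNet G X H) (hG : {v | IsLeaf G v}.ncard = 3)
    {v : V} (hv : IsLeaf G v) : IsLeafNode H {v} := by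
  have himg : (fun v : V => ({v} : Set V)) '' {v | IsLeafNode H {v}} = {N | IsLeafNode H N} := by
    ext N
    constructor
    · rintro ⟨v, hv, rfl⟩
      exact hv
    · intro hNl
      obtain ⟨v, -, rfl⟩ := hN.leaf_single N hNl
      exact ⟨v, hNl, rfl⟩
  have hcard : {v | IsLeafNode H {v}}.ncard = 3 := by
    rw [← hN.leaf_card, ← himg, Set.ncard_image_of_injective _ Set.singleton_injective]
  have hsub : {v | IsLeafNode H {v}} ⊆ {v | IsLeaf G v} := by
    intro v hv
    obtain ⟨w, hw, hvw⟩ := hN.leaf_single {v} hv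
    exact Set.singleton_injective hvw ▸ hw
  have := Set.eq_of_subset_of_ncard_le hsub (by rw [hG, hcard]) (Set.toFinite _)
  have hmem : v ∈ {v | IsLeafNode H {v}} := this ▸ hv
  exact hmem

end TwoNodes

end ThreeInATree

theorem self_aiding_wild_nonsticky_gives_sapling
    {V : Type*} [Finite V] (G : SimpleGraph V) (hconn : G.Connected)
    (hleaves : {v | ThreeInATree.IsLeaf G v}.ncard = 3)
    (X : Set V) (H₀ : Graph (Set V) (Set V))
    (hnet : ThreeInATree.IsNet G X H₀) (hself : ThreeInATree.SelfAiding H₀)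
    (Y : Set V) (hwild : ThreeInATree.Wild G X H₀ Y)
    (hnonsticky : ¬ ThreeInATree.Sticky G X H₀ Y) :
    ∃ T ⊆ X ∪ Y, ThreeInATree.IsSapling G T := by
  by_contra hno
  have hc : ThreeInATree.Ctx G X H₀ Y :=
    ⟨hnet.tightNet hself, fun _ hv => hnet.isLeafNode_of_isLeaf hleaves hv, hwild, hno⟩
  exact hnonsticky hc.sticky
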